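/- There is no finite set V ⊆ ℝ⁴ such that the polytope P = convexHull ℝ V has exactly 12 proper faces of dimension 0, 35 of dimension 1, 33 of dimension 2, and 10 of dimension 3; that is, (12,35,33,10) is not the f-vector of any convex 4-polytope. -/

import Mathlib

open Module

/-- The number of proper faces of dimension `k` of the polytope `convexHull ℝ V`. -/
noncomputable def fVec (V : Set (EuclideanSpace ℝ (Fin 4))) (k : ℕ) : ℕ :=
  {F : Set (EuclideanSpace ℝ (Fin 4)) | F ≠ ∅ ∧ F ≠ convexHull ℝ V ∧
    IsExposed ℝ (convexHull ℝ V) F ∧ finrank ℝ (vectorSpan ℝ F) = k}.ncard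

namespace PS

structure St where
  B : List ℕ
  F : List ℕ
  O : List ℕ
  nb : ℕ
  rem : ℕ

noncomputable def cnd {β : Type} (c : Bool) (t e : β) : β := @Bool.rec (fun _ => β) e t c

noncomputable def frc {β : Type} (n : ℕ) (f : ℕ → β) : β :=
  @Nat.rec (fun _ => β) (f 0) (fun m _ => f (Nat.succ m)) n

def subb (a b : ℕ) : Bool := Nat.beq (Nat.land a b) a

noncomputable def anyb (p : ℕ → Bool) (l : List ℕ) : Bool :=
  @List.rec ℕ (fun _ => Bool) false (fun x _ ih => cnd (p x) true ih) l

noncomputable def allb (p : ℕ → Bool) (l : List ℕ) : Bool :=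
  @List.rec ℕ (fun _ => Bool) true (fun x _ ih => cnd (p x) ih false) l

noncomputable def elm (a : ℕ) (l : List ℕ) : Bool := anyb (Nat.beq a) l

/-- continuation-passing filter, prepended to `acc` -/
noncomputable def filtK {β : Type} (p : ℕ → Bool) (l acc : List ℕ) (k : List ℕ → β) : β :=
  @List.rec ℕ (fun _ => (List ℕ → β) → β) (fun k => k acc)
    (fun x _ ih k => cnd (p x) (frc x fun x => ih fun r => k (x :: r)) (ih k)) l k

/-- union of the masks satisfying `p` -/
noncomputable def uni (p : ℕ → Bool) (l : List ℕ) : ℕ :=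
  @List.rec ℕ (fun _ => ℕ) 0 (fun x _ ih => cnd (p x) (Nat.lor x ih) ih) l

def cpl (a : ℕ) : ℕ := Nat.xor 1023 a
def clr (a : ℕ) : ℕ := Nat.land a (Nat.pred a)
def low (a : ℕ) : ℕ := Nat.xor a (clr a)
def dbl (a : ℕ) : ℕ := Nat.add a a

def isBit (a : ℕ) : Bool := Nat.beq (clr a) 0

noncomputable def resK {β : Type} (nt : ℕ) (F : List ℕ) (bad : ℕ) (prs : List ℕ)
    (k : ℕ → List ℕ → β) : β :=
  @List.rec ℕ (fun _ => ℕ → List ℕ → β) k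
    (fun x _ ih bad prs => frc (Nat.land x nt) fun r =>
      cnd (isBit r) (frc (Nat.lor r bad) fun b => ih b prs) (ih bad (r :: prs))) F bad prs

inductive Cd where
  | tet (x n : ℕ)
  | bip (u v a b c n : ℕ)

def BITS : List ℕ := [1, 2, 4, 8, 16, 32, 64, 128, 256, 512]

noncomputable def bitsK {β : Type} (M : ℕ) (k : List ℕ → β) : β :=
  filtK (fun x => subb x M) BITS [] k

noncomputable def tetC (nb : ℕ) (l : List ℕ) (acc : List Cd) : List Cd :=
  @List.rec ℕ (fun _ => List Cd) acc
    (fun x _ ih => Cd.tet x (cnd (Nat.beq x nb) (dbl nb) nb) :: ih) l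

noncomputable def bipC2 (nb u v a b : ℕ) (prs lc : List ℕ) (acc : List Cd) : List Cd :=
  @List.rec ℕ (fun _ => List Cd) acc
    (fun c _ ih => cnd (Nat.beq v c) ih (cnd (elm (Nat.lor v c) prs) ih
      (Cd.bip u v a b c (cnd (Nat.beq c nb) (dbl nb) (cnd (Nat.beq v nb) (dbl nb) nb)) :: ih))) lc

noncomputable def bipC1 (nb u a b : ℕ) (prs lv lc : List ℕ) (acc : List Cd) : List Cd :=
  @List.rec ℕ (fun _ => List Cd) acc
    (fun v _ ih => bipC2 nb u v a b prs lc ih) lv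

noncomputable def bipC (B : List ℕ) (nb al u a b : ℕ) (prs : List ℕ) (acc : List Cd) : List Cd :=
  bitsK (Nat.land al (cpl (uni (subb u) B))) fun lv =>
  bitsK (Nat.land al (cpl (uni (subb (Nat.lor a b)) B))) fun lc =>
  bipC1 nb u a b prs lv lc
    (cnd (Nat.ble (dbl nb) 512) (Cd.bip u nb a b (dbl nb) (dbl (dbl nb)) :: acc) acc)

noncomputable def cands (st : St) (t : ℕ) : List Cd :=
  resK (cpl t) st.F t [] fun bad prs =>
  frc (Nat.land (Nat.lor (Nat.pred st.nb) (cnd (Nat.ble 1024 st.nb) 0 st.nb)) (cpl bad)) fun al =>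
  frc (low t) fun x1 => frc (low (clr t)) fun x2 => frc (clr (clr t)) fun x3 =>
  bitsK al fun la =>
  cnd (Nat.beq st.rem 0) id (tetC st.nb la)
    (bipC st.B st.nb al x1 x2 x3 prs (bipC st.B st.nb al x2 x1 x3 prs
      (bipC st.B st.nb al x3 x1 x2 prs [])))

noncomputable def upd {β : Type} (st : St) (b : ℕ) (nf rid : List ℕ) (n rem : ℕ) (k : St → β) : β :=
  frc b fun b =>
  frc n fun n =>
  filtK (fun t => subb t b) st.O st.F fun F1 =>
  filtK (fun _ => true) nf F1 fun F2 =>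
  filtK (fun t => cnd (subb t b) false true) st.O [] fun O1 =>
  filtK (fun t => cnd (elm t st.O) false true) rid O1 fun O2 =>
  k ⟨b :: st.B, F2, O2, n, rem⟩

noncomputable def child {β : Type} (st : St) (t : ℕ) (c : Cd) (k : St → β) : β :=
  @Cd.rec (fun _ => β)
    (fun x n =>
      frc (low t) fun x1 => frc (low (clr t)) fun x2 => frc (clr (clr t)) fun x3 =>
      upd st (Nat.lor t x) [Nat.lor t x]
        [t, Nat.lor x (Nat.lor x1 x2), Nat.lor x (Nat.lor x1 x3), Nat.lor x (Nat.lor x2 x3)]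
        n (Nat.pred st.rem) k)
    (fun u v a b c n =>
      upd st (Nat.lor t (Nat.lor v c)) [Nat.lor u v, Nat.lor (Nat.lor a b) c]
        [Nat.lor u (Nat.lor a b), Nat.lor u (Nat.lor a c), Nat.lor u (Nat.lor b c),
         Nat.lor v (Nat.lor a b), Nat.lor v (Nat.lor a c), Nat.lor v (Nat.lor b c)]
        n st.rem k) c

noncomputable def nth {α : Type} (l : List α) (d : α) (n : ℕ) : α :=
  @List.rec α (fun _ => ℕ → α) (fun _ => d)
    (fun x _ ih n => @Nat.rec (fun _ => α) x (fun m _ => ih m) n) l n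

/-- image of a mask under the label map coded by `s` -/
noncomputable def mpm (s M : ℕ) : ℕ :=
  @List.rec ℕ (fun _ => ℕ → ℕ) (fun _ => 0)
    (fun b _ ih s => cnd (subb b M)
      (Nat.lor (Nat.pow 2 (Nat.mod s 16)) (ih (Nat.div s 16))) (ih (Nat.div s 16))) BITS s

noncomputable def mapK {β : Type} (s : ℕ) (l : List ℕ) (k : List ℕ → β) : β :=
  @List.rec ℕ (fun _ => (List ℕ → β) → β) (fun k => k [])
    (fun x _ ih k => frc (mpm s x) fun y => ih fun r => k (y :: r)) l k

noncomputable def isoChk (s : ℕ) (r st : St) : Bool :=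
  cnd (Nat.beq r.nb st.nb) (
  cnd (Nat.beq (mpm s (Nat.pred r.nb)) (Nat.pred st.nb)) (
  cnd (Nat.ble st.rem r.rem) (
  mapK s r.B fun B' =>
  cnd (allb (fun x => elm x st.B) B') (
  cnd (allb (fun x => elm x B') st.B) (
  mapK s r.F fun F' =>
  cnd (allb (fun x => elm x st.F) F') (
  mapK s r.O fun O' =>
  cnd (allb (fun x => elm x st.O) O') (
  cnd (allb (fun x => elm x O') st.O) (
  cnd (allb (fun x => Nat.ble x (Nat.pred st.nb)) r.B) (
  cnd (allb (fun x => Nat.ble x (Nat.pred st.nb)) r.F) (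
  cnd (allb (fun x => Nat.ble x (Nat.pred st.nb)) r.O)
  (Nat.ble r.B.length st.B.length) false) false) false) false) false) false) false) false) false) false) false

def st0 : St := ⟨[], [], [], 0, 0⟩

noncomputable def check (fuel : ℕ) : ℕ → List St → St → (ℕ → List St → Bool) → Bool :=
  @Nat.rec (fun _ => ℕ → List St → St → (ℕ → List St → Bool) → Bool)
    (fun _ _ _ _ => false)
    (fun _ ih s refs st k =>
      frc (Nat.mod s 128) fun d => frc (Nat.div s 128) fun s =>
      cnd (Nat.beq d 127)
        (frc (Nat.mod s 256) fun j => frc (Nat.mod (Nat.div s 256) 1099511627776) fun sg =>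
          frc (Nat.div s 281474976710656) fun s' =>
          cnd (Nat.ble refs.length j) false
          (cnd (isoChk sg (nth refs st0 j) st) (k s' refs) false))
      (cnd (Nat.beq d 126)
        (cnd (Nat.ble 8 st.B.length) (cnd (Nat.ble st.B.length 11)
          (@List.rec ℕ (fun _ => Bool) (k s refs) (fun _ _ _ => false) st.O) false) false)
        (frc (nth st.O 0 (Nat.mod d 64)) fun t =>
          cnd (Nat.beq t 0) false
          (@List.rec Cd (fun _ => ℕ → List St → Bool)
            (fun s refs => cnd (Nat.ble 64 d) (k s (st :: refs)) (k s refs))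
            (fun c _ go s refs => child st t c fun st' => ih s refs st' go)
            (cands st t) s refs)))) fuel

def sA : St := ⟨[15], [15], [7, 11, 13, 14], 16, 0⟩
def sO : St := ⟨[63], [3, 12, 48], [21, 37, 25, 41, 22, 38, 26, 42], 64, 2⟩
def sP : St := ⟨[63], [3, 6, 12, 49, 56], [21, 37, 52, 25, 41, 26, 42, 50], 64, 2⟩
def sB : St := ⟨[31, 47], [5, 10], [19, 22, 28, 25, 35, 38, 44, 41], 64, 0⟩
end PS

namespace PS

theorem frc_eq {β : Type} (n : ℕ) (f : ℕ → β) : frc n f = f n := by cases n <;> rfl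
theorem cnd_eq {β : Type} (c : Bool) (t e : β) : cnd c t e = if c then t else e := by cases c <;> rfl
theorem anyb_eq (p : ℕ → Bool) (l : List ℕ) : anyb p l = l.any p := by
  induction l with
  | nil => rfl
  | cons x l ih =>
    have : anyb p (x :: l) = cnd (p x) true (anyb p l) := rfl
    rw [this, cnd_eq, ih]; cases h : p x <;> simp [h]
theorem allb_eq (p : ℕ → Bool) (l : List ℕ) : allb p l = l.all p := by
  induction l with
  | nil => rfl
  | cons x l ih =>
    have : allb p (x :: l) = cnd (p x) (allb p l) false := rfl
    rw [this, cnd_eq, ih]; cases h : p x <;> simp [h]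
theorem elm_iff (a : ℕ) (l : List ℕ) : elm a l = true ↔ a ∈ l := by
  simp [elm, anyb_eq]
theorem filtK_eq {β : Type} (p : ℕ → Bool) (l acc : List ℕ) (k : List ℕ → β) :
    filtK p l acc k = k (l.filter p ++ acc) := by
  induction l generalizing k with
  | nil => rfl
  | cons x l ih =>
    have : filtK p (x :: l) acc k =
      cnd (p x) (frc x fun x => filtK p l acc fun r => k (x :: r)) (filtK p l acc k) := rfl
    rw [this, cnd_eq, frc_eq, ih, ih]; cases h : p x <;> simp [h]

/-- the set of labels of a mask -/
def ms (m : ℕ) : Finset ℕ := (Finset.range 10).filter (fun i => m.testBit i = true)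

theorem mem_ms {m i : ℕ} : i ∈ ms m ↔ i < 10 ∧ m.testBit i = true := by simp [ms]

theorem ms_lor (a b : ℕ) : ms (Nat.lor a b) = ms a ∪ ms b := by
  ext i; rw [Finset.mem_union, mem_ms, mem_ms, mem_ms]
  have : (Nat.lor a b).testBit i = (a.testBit i || b.testBit i) := Nat.testBit_or a b i
  rw [this]; simp; tauto
theorem ms_land (a b : ℕ) : ms (Nat.land a b) = ms a ∩ ms b := by
  ext i; rw [Finset.mem_inter, mem_ms, mem_ms, mem_ms]
  have : (Nat.land a b).testBit i = (a.testBit i && b.testBit i) := Nat.testBit_and a b i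
  rw [this]; simp; tauto
theorem ms_cpl {a i : ℕ} : i ∈ ms (cpl a) ↔ i < 10 ∧ i ∉ ms a := by
  rw [mem_ms, mem_ms]
  have : (cpl a).testBit i = ((1023:ℕ).testBit i ^^ a.testBit i) := Nat.testBit_xor 1023 a i
  rw [this]
  constructor
  · rintro ⟨h, h2⟩
    refine ⟨h, ?_⟩
    interval_cases i <;> simp_all [Nat.testBit]
  · rintro ⟨h, h2⟩
    refine ⟨h, ?_⟩
    interval_cases i <;> simp_all [Nat.testBit]
theorem ms_zero : ms 0 = ∅ := by ext; simp [mem_ms]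
theorem ms_pow {i : ℕ} (h : i < 10) : ms (2 ^ i) = {i} := by
  ext j; rw [mem_ms, Nat.testBit_two_pow]; simp; omega
theorem ms_lt {m i k : ℕ} (h : m < 2 ^ k) (hi : i ∈ ms m) : i < k := by
  by_contra hc
  have : m < 2 ^ i := lt_of_lt_of_le h (Nat.pow_le_pow_right (by norm_num) (by omega))
  have := Nat.testBit_eq_false_of_lt this
  rw [mem_ms] at hi; simp_all
theorem ms_inj {a b : ℕ} (ha : a < 1024) (hb : b < 1024) (h : ms a = ms b) : a = b := by
  apply Nat.eq_of_testBit_eq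
  intro i
  by_cases hi : i < 10
  · have := congrArg (i ∈ ·) h
    simp only [mem_ms, hi, true_and, eq_iff_iff] at this
    exact Bool.eq_iff_iff.mpr this
  · have e : (1024:ℕ) ≤ 2 ^ i := by
      calc (1024:ℕ) = 2^10 := by norm_num
        _ ≤ _ := Nat.pow_le_pow_right (by norm_num) (by omega)
    rw [Nat.testBit_eq_false_of_lt (by omega), Nat.testBit_eq_false_of_lt (by omega)]
theorem subb_ms {a b : ℕ} (h : subb a b = true) : ms a ⊆ ms b := by
  have h2 : Nat.land a b = a := by simpa [subb] using h
  rw [← h2, ms_land]; exact Finset.inter_subset_right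
theorem subb_of {a b : ℕ} (ha : a < 1024) (h : ms a ⊆ ms b) : subb a b = true := by
  have : Nat.land a b = a := by
    apply ms_inj _ ha
    · rw [ms_land]; exact Finset.inter_eq_left.mpr h
    · exact lt_of_le_of_lt (Nat.and_le_left) ha
  unfold subb; rw [this]; simp
theorem lor_lt {a b k : ℕ} (ha : a < 2^k) (hb : b < 2^k) : Nat.lor a b < 2^k := Nat.or_lt_two_pow ha hb
theorem ms_pred {i k : ℕ} (hk : k ≤ 10) : i ∈ ms (Nat.pred (2^k)) ↔ i < k := by
  rw [mem_ms]
  have : Nat.pred (2^k) = 2^k - 1 := rfl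
  rw [this, Nat.testBit_two_pow_sub_one]; simp; omega

theorem uni_ms (p : ℕ → Bool) (l : List ℕ) (i : ℕ) :
    i ∈ ms (uni p l) ↔ ∃ m ∈ l, p m = true ∧ i ∈ ms m := by
  induction l with
  | nil => simp [show uni p [] = 0 from rfl, ms_zero]
  | cons x l ih =>
    have : uni p (x :: l) = cnd (p x) (Nat.lor x (uni p l)) (uni p l) := rfl
    rw [this, cnd_eq]
    cases h : p x
    · simp [h, ih]
    · rw [if_pos rfl, ms_lor, Finset.mem_union, ih]; simp [h]

theorem isBit_ms : ∀ r < 1024, isBit r = true → ∀ i < 10, r.testBit i = true → ms r ⊆ {i} := by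
  intro r hr h i hi ht
  have key : ∀ r < 1024, isBit r = true → r = 0 ∨ ∃ j < 10, r = 2^j := by
    decide +kernel
  rcases key r hr h with rfl | ⟨j, hj, rfl⟩
  · simp [ms_zero]
  · rw [ms_pow hj]; rw [Nat.testBit_two_pow] at ht; simp at ht; simp [ht]

def okT (t : ℕ) : Bool :=
  let i := Nat.log2 (low t); let j := Nat.log2 (low (clr t)); let l := Nat.log2 (clr (clr t))
  Nat.blt i 10 && Nat.blt j 10 && Nat.blt l 10 && !Nat.beq i j && !Nat.beq i l && !Nat.beq j l &&
  Nat.beq (low t) (2^i) && Nat.beq (low (clr t)) (2^j) && Nat.beq (clr (clr t)) (2^l) &&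
  Nat.beq t (Nat.lor (2^i) (Nat.lor (2^j) (2^l)))

theorem okT_all : ∀ a < 10, ∀ b < 10, ∀ c < 10, (Nat.beq a b || Nat.beq a c || Nat.beq b c ||
    okT (Nat.lor (2^a) (Nat.lor (2^b) (2^c)))) = true := by decide +kernel

theorem three_bits (t : ℕ) (ht : t < 1024) (h : (ms t).card = 3) :
    ∃ i < 10, ∃ j < 10, ∃ l < 10, i ≠ j ∧ i ≠ l ∧ j ≠ l ∧ low t = 2^i ∧ low (clr t) = 2^j ∧ clr (clr t) = 2^l
      ∧ ms t = {i, j, l} := by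
  obtain ⟨a, b, c, hab, hac, hbc, e⟩ := Finset.card_eq_three.mp h
  have ha : a < 10 := (mem_ms.mp (e ▸ (by simp) : a ∈ ms t)).1
  have hb : b < 10 := (mem_ms.mp (e ▸ (by simp) : b ∈ ms t)).1
  have hc : c < 10 := (mem_ms.mp (e ▸ (by simp) : c ∈ ms t)).1
  have e2 : t = Nat.lor (2^a) (Nat.lor (2^b) (2^c)) := by
    apply ms_inj ht
    · exact lor_lt (k := 10) (Nat.pow_lt_pow_right (by norm_num) ha) (lor_lt (Nat.pow_lt_pow_right (by norm_num) hb) (Nat.pow_lt_pow_right (by norm_num) hc))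
    · rw [ms_lor, ms_lor, ms_pow ha, ms_pow hb, ms_pow hc, e]; rfl
  have k := okT_all a ha b hb c hc
  rw [← e2] at k
  have k2 : okT t = true := by
    rw [Bool.or_eq_true, Bool.or_eq_true, Bool.or_eq_true, Nat.beq_eq, Nat.beq_eq, Nat.beq_eq] at k
    tauto
  simp only [okT, Bool.and_eq_true, Nat.blt_eq, Nat.beq_eq, Bool.not_eq_true'] at k2
  obtain ⟨⟨⟨⟨⟨⟨⟨⟨⟨hi, hj⟩, hl⟩, h1⟩, h2⟩, h3⟩, h4⟩, h5⟩, h6⟩, h7⟩ := k2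
  refine ⟨_, hi, _, hj, _, hl, Nat.ne_of_beq_eq_false h1, Nat.ne_of_beq_eq_false h2, Nat.ne_of_beq_eq_false h3, h4, h5, h6, ?_⟩
  conv_lhs => rw [h7]
  rw [ms_lor, ms_lor, ms_pow hi, ms_pow hj, ms_pow hl]; rfl

section sem
variable {α : Type} [DecidableEq α]

def im (φ : ℕ → α) (m : ℕ) : Finset α := (ms m).image φ

/-- only `b` contains `f` -/
def Excl (𝓑 : Finset (Finset α)) (f b : Finset α) : Prop := ∀ c ∈ 𝓑, f ⊆ c → c = b
def Good (𝓑 : Finset (Finset α)) (f b : Finset α) : Prop :=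
  ∃ b' ∈ 𝓑, b' ≠ b ∧ f ⊆ b' ∧ ∀ c ∈ 𝓑, f ⊆ c → c = b ∨ c = b'
def IsBip (𝓑 : Finset (Finset α)) (b : Finset α) : Prop :=
  ∃ U A : Finset α, U.card = 2 ∧ A.card = 3 ∧ Disjoint U A ∧ b = U ∪ A ∧ Excl 𝓑 U b ∧ Excl 𝓑 A b ∧
    ∀ T ⊆ b, T.card = 3 → ¬ U ⊆ T → T ≠ A → Good 𝓑 T b
def IsTet (𝓑 : Finset (Finset α)) (b : Finset α) : Prop :=
  b.card = 4 ∧ Excl 𝓑 b b ∧ ∀ T ⊆ b, T.card = 3 → Good 𝓑 T b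

/-- `b` is not one of the blocks of the state -/
def Out (φ : ℕ → α) (B : List ℕ) (b : Finset α) : Prop := ∀ m ∈ B, b ≠ im φ m

structure Holds (𝓑 : Finset (Finset α)) (φ : ℕ → α) (st : St) : Prop where
  nb : ∃ k ≤ 10, st.nb = 2 ^ k ∧ Set.InjOn φ {i | i < k}
  Blt : ∀ m ∈ st.B, m < st.nb
  Flt : ∀ m ∈ st.F, m < st.nb
  Olt : ∀ m ∈ st.O, m < st.nb
  hB : ∀ m ∈ st.B, im φ m ∈ 𝓑
  hF : ∀ f ∈ st.F, ∀ b ∈ 𝓑, im φ f ⊆ b → ¬ Out φ st.B b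
  O3 : ∀ t ∈ st.O, (im φ t).card = 3
  hO : ∀ t ∈ st.O, ∃ m ∈ st.B, im φ t ⊆ im φ m ∧ ∃ b ∈ 𝓑, Out φ st.B b ∧ im φ t ⊆ b ∧
    ∀ c ∈ 𝓑, im φ t ⊆ c → c = im φ m ∨ c = b
  rem : Set.ncard {b | b ∈ 𝓑 ∧ b.card = 4 ∧ Out φ st.B b} ≤ st.rem
  types : ∀ b ∈ 𝓑, Out φ st.B b → IsBip 𝓑 b ∨ IsTet 𝓑 b
  cnt : Set.ncard {b | b ∈ 𝓑 ∧ Out φ st.B b} + st.B.length ≤ 12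
  cov : ∀ m ∈ st.B, ∀ b ∈ 𝓑, Out φ st.B b → ∀ T ⊆ b, T.card = 3 → T ⊆ im φ m → ∃ t ∈ st.O, im φ t = T

def Sat (𝓑 : Finset (Finset α)) (st : St) : Prop := ∃ φ, Holds 𝓑 φ st

theorem im_lor (φ : ℕ → α) (a b : ℕ) : im φ (Nat.lor a b) = im φ a ∪ im φ b := by
  rw [im, ms_lor, Finset.image_union]; rfl
theorem im_pow (φ : ℕ → α) {i : ℕ} (h : i < 10) : im φ (2^i) = {φ i} := by
  rw [im, ms_pow h]; simp
theorem im_congr {φ φ' : ℕ → α} {k m : ℕ} (h : ∀ i < k, φ' i = φ i) (hm : m < 2^k) : im φ' m = im φ m := by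
  apply Finset.image_congr
  intro i hi
  exact h i (ms_lt hm hi)
theorem im_sub {φ : ℕ → α} {k a b : ℕ} (h : Set.InjOn φ {i | i < k}) (ha : a < 2^k) (hb : b < 2^k) :
    im φ a ⊆ im φ b ↔ ms a ⊆ ms b := by
  constructor
  · intro hs i hi
    obtain ⟨j, hj, e⟩ := Finset.mem_image.mp (hs (Finset.mem_image_of_mem φ hi))
    have := h (ms_lt hb hj) (ms_lt ha hi) e
    rwa [← this]
  · exact Finset.image_subset_image
theorem im_inj {φ : ℕ → α} {k a b : ℕ} (hk : k ≤ 10) (h : Set.InjOn φ {i | i < k}) (ha : a < 2^k) (hb : b < 2^k)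
    (e : im φ a = im φ b) : a = b := by
  have hp : (2:ℕ)^k ≤ 1024 := by
    calc 2^k ≤ 2^10 := Nat.pow_le_pow_right (by norm_num) hk
      _ = 1024 := by norm_num
  apply ms_inj (by omega) (by omega)
  exact Finset.Subset.antisymm ((im_sub h ha hb).mp e.subset) ((im_sub h hb ha).mp e.symm.subset)
theorem im_card {φ : ℕ → α} {k a : ℕ} (h : Set.InjOn φ {i | i < k}) (ha : a < 2^k) : (im φ a).card = (ms a).card :=
  Finset.card_image_of_injOn (fun _ hi _ hj e => h (ms_lt ha hi) (ms_lt ha hj) e)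
end sem
end PS

namespace PS
section sem
variable {α : Type} [DecidableEq α]

noncomputable def updS (st : St) (b : ℕ) (nf rid : List ℕ) (n rem : ℕ) : St :=
  ⟨b :: st.B, nf ++ (st.O.filter (fun t => subb t b) ++ st.F),
    rid.filter (fun t => !elm t st.O) ++ st.O.filter (fun t => !subb t b), n, rem⟩

theorem upd_eq {β : Type} (st : St) (b : ℕ) (nf rid : List ℕ) (n rem : ℕ) (k : St → β) :
    upd st b nf rid n rem k = k (updS st b nf rid n rem) := by
  have e : ∀ c : Bool, cnd c false true = !c := by intro c; cases c <;> rfl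
  simp only [upd, frc_eq, filtK_eq, e, updS, List.append_nil, List.filter_true]

theorem upd_holds {𝓑 : Finset (Finset α)} {φ φ' : ℕ → α} {st : St} (H : Holds 𝓑 φ st)
    {k k' : ℕ} (hk : st.nb = 2 ^ k) (hkk : k ≤ k') (hk' : k' ≤ 10)
    (hφ : ∀ i < k, φ' i = φ i) (hinj : Set.InjOn φ' {i | i < k'})
    {b' : Finset α} (hb' : b' ∈ 𝓑) (hout : Out φ st.B b') {bm : ℕ} (hbm : bm < 2 ^ k') (hbe : im φ' bm = b')
    {nf rid : List ℕ} (hnf : ∀ f ∈ nf, f < 2 ^ k' ∧ Excl 𝓑 (im φ' f) b')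
    (hrid : ∀ t ∈ rid, t < 2 ^ k' ∧ (im φ' t).card = 3 ∧ im φ' t ⊆ b' ∧ Good 𝓑 (im φ' t) b')
    (hcov : ∀ T ⊆ b', T.card = 3 → (∃ c ∈ 𝓑, c ≠ b' ∧ T ⊆ c) → ∃ t ∈ rid, im φ' t = T)
    {rem : ℕ} (hrem : Set.ncard {b | b ∈ 𝓑 ∧ b.card = 4 ∧ Out φ st.B b ∧ b ≠ b'} ≤ rem) :
    Holds 𝓑 φ' (updS st bm nf rid (2 ^ k') rem) := by
  have hpow : (2:ℕ) ^ k ≤ 2 ^ k' := Nat.pow_le_pow_right (by norm_num) hkk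
  have cB : ∀ m ∈ st.B, im φ' m = im φ m := fun m hm => im_congr hφ (hk ▸ H.Blt m hm)
  have cF : ∀ m ∈ st.F, im φ' m = im φ m := fun m hm => im_congr hφ (hk ▸ H.Flt m hm)
  have cO : ∀ m ∈ st.O, im φ' m = im φ m := fun m hm => im_congr hφ (hk ▸ H.Olt m hm)
  have Bl : ∀ m ∈ st.B, m < 2 ^ k' := fun m hm => lt_of_lt_of_le (hk ▸ H.Blt m hm) hpow
  have Fl : ∀ m ∈ st.F, m < 2 ^ k' := fun m hm => lt_of_lt_of_le (hk ▸ H.Flt m hm) hpow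
  have Ol : ∀ m ∈ st.O, m < 2 ^ k' := fun m hm => lt_of_lt_of_le (hk ▸ H.Olt m hm) hpow
  have hp : (2:ℕ) ^ k' ≤ 1024 := by
    calc 2^k' ≤ 2^10 := Nat.pow_le_pow_right (by norm_num) hk'
      _ = 1024 := by norm_num
  have outI : ∀ c, Out φ' (bm :: st.B) c ↔ c ≠ b' ∧ Out φ st.B c := by
    intro c
    simp only [Out, List.mem_cons, forall_eq_or_imp, hbe]
    refine and_congr_right fun _ => ?_
    exact forall₂_congr fun m hm => by rw [cB m hm]
  have sb : ∀ t, t < 2 ^ k' → (subb t bm = true ↔ im φ' t ⊆ b') := by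
    intro t ht
    rw [← hbe, im_sub hinj ht hbm]
    exact ⟨subb_ms, subb_of (by omega)⟩
  have key : ∀ t ∈ st.O, ∀ c ∈ 𝓑, Out φ st.B c → im φ t ⊆ c → im φ t ⊆ b' → c = b' := by
    intro t ht c hc hco hs hs'
    obtain ⟨m, hm, -, b, hb, hbo, -, hu⟩ := H.hO t ht
    have h1 := (hu c hc hs).resolve_left (hco m hm)
    have h2 := (hu b' hb' hs').resolve_left (hout m hm)
    rw [h1, h2]
  refine ⟨⟨k', hk', rfl, hinj⟩, ?_, ?_, ?_, ?_, ?_, ?_, ?_, ?_, ?_, ?_, ?_⟩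
  · intro m hm
    rcases List.mem_cons.mp hm with rfl | hm
    exacts [hbm, Bl m hm]
  · intro m hm
    simp only [updS, List.mem_append, List.mem_filter] at hm
    rcases hm with hm | hm | hm
    exacts [(hnf m hm).1, Ol m hm.1, Fl m hm]
  · intro m hm
    simp only [updS, List.mem_append, List.mem_filter] at hm
    rcases hm with hm | hm
    exacts [(hrid m hm.1).1, Ol m hm.1]
  · intro m hm
    rcases List.mem_cons.mp hm with rfl | hm
    · rw [hbe]; exact hb'
    · rw [cB m hm]; exact H.hB m hm
  · intro f hf b hb hs hbo
    rw [show (updS st bm nf rid (2^k') rem).B = bm :: st.B from rfl, outI] at hbo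
    simp only [updS, List.mem_append, List.mem_filter] at hf
    rcases hf with hf | hf | hf
    · exact hbo.1 ((hnf f hf).2 b hb hs)
    · have h1 := (sb f (Ol f hf.1)).mp hf.2
      rw [cO f hf.1] at h1 hs
      exact hbo.1 (key f hf.1 b hb hbo.2 hs h1)
    · rw [cF f hf] at hs
      exact H.hF f hf b hb hs hbo.2
  · intro m hm
    simp only [updS, List.mem_append, List.mem_filter] at hm
    rcases hm with hm | hm
    · exact (hrid m hm.1).2.1
    · rw [cO m hm.1]; exact H.O3 m hm.1
  · intro t ht
    simp only [updS, List.mem_append, List.mem_filter] at ht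
    rcases ht with ht | ht
    · obtain ⟨h1, h2, h3, b, hb, hne, hs, hu⟩ := hrid t ht.1
      refine ⟨bm, List.mem_cons_self, by rw [hbe]; exact h3, b, hb, ?_, hs, by rw [hbe]; exact hu⟩
      change Out φ' (bm :: st.B) b
      rw [outI]
      refine ⟨hne, ?_⟩
      intro m hm e
      obtain ⟨t0, ht0, e0⟩ := H.cov m hm b' hb' hout (im φ' t) h3 h2 (e ▸ hs)
      rw [← cO t0 ht0] at e0
      have := im_inj hk' hinj (Ol t0 ht0) h1 e0
      subst this
      have := (elm_iff t0 st.O).mpr ht0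
      simp [this] at ht
    · obtain ⟨hto, hts⟩ := ht
      obtain ⟨m, hm, hms, b, hb, hbo, hs, hu⟩ := H.hO t hto
      refine ⟨m, List.mem_cons_of_mem _ hm, by rw [cO t hto, cB m hm]; exact hms, b, hb, ?_, by rw [cO t hto]; exact hs, by rw [cO t hto, cB m hm]; exact hu⟩
      change Out φ' (bm :: st.B) b
      rw [outI]
      refine ⟨?_, hbo⟩
      rintro rfl
      have : subb t bm = true := (sb t (Ol t hto)).mpr (by rw [cO t hto]; exact hs)
      simp [this] at hts
  · refine le_trans (le_of_eq ?_) hrem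
    congr 1; ext b
    simp only [Set.mem_ofPred_eq, updS, outI]; tauto
  · intro b hb hbo
    exact H.types b hb ((outI b).mp hbo).2
  · have hc := H.cnt
    have e : {b | b ∈ 𝓑 ∧ Out φ st.B b} = insert b' {b | b ∈ 𝓑 ∧ Out φ' (updS st bm nf rid (2^k') rem).B b} := by
      ext b
      simp only [Set.mem_ofPred_eq, Set.mem_insert_iff, updS, outI]
      by_cases h : b = b'
      · subst h; simp [hb', hout]
      · simp [h]
    have hfin : {b | b ∈ 𝓑 ∧ Out φ' (updS st bm nf rid (2^k') rem).B b}.Finite :=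
      𝓑.finite_toSet.subset (fun b hb => hb.1)
    rw [e, Set.ncard_insert_of_notMem _ hfin] at hc
    · simp only [updS, List.length_cons] at hc ⊢; omega
    · simp only [Set.mem_ofPred_eq, updS, outI]; tauto
  · intro m hm b hb hbo T hT hT3 hTm
    rw [show (updS st bm nf rid (2^k') rem).B = bm :: st.B from rfl, outI] at hbo
    simp only [updS, List.mem_append, List.mem_filter]
    rcases List.mem_cons.mp hm with rfl | hm
    · rw [hbe] at hTm
      obtain ⟨t, ht, e⟩ := hcov T hTm hT3 ⟨b, hb, hbo.1, hT⟩
      refine ⟨t, Or.inl ⟨ht, ?_⟩, e⟩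
      by_contra hc
      have : elm t st.O = true := by simpa using hc
      rw [elm_iff] at this
      rw [cO t this] at e
      exact hbo.1 (key t this b hb hbo.2 (e ▸ hT) (e ▸ hTm))
    · rw [cB m hm] at hTm
      obtain ⟨t, ht, e⟩ := H.cov m hm b hb hbo.2 T hT hT3 hTm
      refine ⟨t, Or.inr ⟨ht, ?_⟩, by rw [cO t ht]; exact e⟩
      by_contra hc
      have hc : subb t bm = true := by simpa using hc
      have h1 := (sb t (Ol t ht)).mp hc
      rw [cO t ht] at h1
      exact hbo.1 (key t ht b hb hbo.2 (e ▸ hT) h1)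
end sem
end PS

namespace PS
section sem
variable {α : Type} [DecidableEq α]

theorem resK_eq {β : Type} (nt : ℕ) (F : List ℕ) (hnt : nt < 1024) : ∀ (bad : ℕ) (prs : List ℕ), ∃ bad' prs',
    (∀ k : ℕ → List ℕ → β, resK nt F bad prs k = k bad' prs') ∧
    (∀ i ∈ ms bad', i ∈ ms bad ∨ ∃ f ∈ F, ms f ∩ ms nt ⊆ {i}) ∧
    (∀ r ∈ prs', r ∈ prs ∨ ∃ f ∈ F, r = Nat.land f nt) := by
  induction F with
  | nil => intro bad prs; exact ⟨bad, prs, fun k => rfl, fun i h => Or.inl h, fun r h => Or.inl h⟩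
  | cons x F ih =>
    intro bad prs
    have e : ∀ k : ℕ → List ℕ → β, resK nt (x :: F) bad prs k = if isBit (Nat.land x nt) = true then
        resK nt F (Nat.lor (Nat.land x nt) bad) prs k else resK nt F bad (Nat.land x nt :: prs) k := by
      intro k
      have : resK nt (x :: F) bad prs k = frc (Nat.land x nt) fun r =>
        cnd (isBit r) (frc (Nat.lor r bad) fun b => resK nt F b prs k) (resK nt F bad (r :: prs) k) := rfl
      rw [this, frc_eq, cnd_eq, frc_eq]
    by_cases h : isBit (Nat.land x nt) = true
    · obtain ⟨bad', prs', h1, h2, h3⟩ := ih (Nat.lor (Nat.land x nt) bad) prs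
      refine ⟨bad', prs', fun k => by rw [e, if_pos h, h1], ?_, ?_⟩
      · intro i hi
        rcases h2 i hi with hh | ⟨f, hf, hh⟩
        · rw [ms_lor, Finset.mem_union] at hh
          rcases hh with hh | hh
          · right
            refine ⟨x, List.mem_cons_self, ?_⟩
            rw [← ms_land]
            have hm := mem_ms.mp hh
            exact isBit_ms _ (lt_of_le_of_lt Nat.and_le_right hnt) h i hm.1 hm.2
          · exact Or.inl hh
        · exact Or.inr ⟨f, List.mem_cons_of_mem _ hf, hh⟩
      · intro r hr
        rcases h3 r hr with hh | ⟨f, hf, hh⟩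
        exacts [Or.inl hh, Or.inr ⟨f, List.mem_cons_of_mem _ hf, hh⟩]
    · obtain ⟨bad', prs', h1, h2, h3⟩ := ih bad (Nat.land x nt :: prs)
      refine ⟨bad', prs', fun k => by rw [e, if_neg h, h1], ?_, ?_⟩
      · intro i hi
        rcases h2 i hi with hh | ⟨f, hf, hh⟩
        exacts [Or.inl hh, Or.inr ⟨f, List.mem_cons_of_mem _ hf, hh⟩]
      · intro r hr
        rcases h3 r hr with hh | ⟨f, hf, hh⟩
        · rcases List.mem_cons.mp hh with hh | hh
          exacts [Or.inr ⟨x, List.mem_cons_self, hh⟩, Or.inl hh]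
        · exact Or.inr ⟨f, List.mem_cons_of_mem _ hf, hh⟩

theorem bitsK_eq {β : Type} (M : ℕ) (k : List ℕ → β) : bitsK M k = k (BITS.filter (fun x => subb x M)) := by
  rw [bitsK, filtK_eq, List.append_nil]
theorem mem_bits {M i : ℕ} (h : i ∈ ms M) : 2^i ∈ BITS.filter (fun x => subb x M) := by
  have hi := (mem_ms.mp h).1
  rw [List.mem_filter]
  constructor
  · clear h; interval_cases i <;> decide
  · apply subb_of
    · calc 2^i < 2^10 := Nat.pow_lt_pow_right (by norm_num) hi
        _ = 1024 := by norm_num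
    · rw [ms_pow hi]; simpa using h

theorem tetC_acc (nb : ℕ) (l : List ℕ) (acc : List Cd) {c : Cd} (h : c ∈ acc) : c ∈ tetC nb l acc := by
  induction l with
  | nil => exact h
  | cons x l ih => exact List.mem_cons_of_mem _ ih
theorem tetC_mem (nb : ℕ) (l : List ℕ) (acc : List Cd) {x : ℕ} (h : x ∈ l) :
    Cd.tet x (if x = nb then 2 * nb else nb) ∈ tetC nb l acc := by
  induction l with
  | nil => simp at h
  | cons y l ih =>
    have e : tetC nb (y :: l) acc = Cd.tet y (cnd (Nat.beq y nb) (dbl nb) nb) :: tetC nb l acc := rfl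
    rw [e]
    rcases List.mem_cons.mp h with rfl | h
    · rw [cnd_eq]
      have : dbl nb = 2 * nb := by unfold dbl; exact (two_mul nb).symm
      rw [this]; simp
    · exact List.mem_cons_of_mem _ (ih h)

theorem bipC2_cons (nb u v a b : ℕ) (prs : List ℕ) (c : ℕ) (lc : List ℕ) (acc : List Cd) :
  bipC2 nb u v a b prs (c :: lc) acc = if v = c then bipC2 nb u v a b prs lc acc else
    if Nat.lor v c ∈ prs then bipC2 nb u v a b prs lc acc else
      Cd.bip u v a b c (if c = nb ∨ v = nb then 2 * nb else nb) :: bipC2 nb u v a b prs lc acc := by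
  have e : bipC2 nb u v a b prs (c :: lc) acc = cnd (Nat.beq v c) (bipC2 nb u v a b prs lc acc)
    (cnd (elm (Nat.lor v c) prs) (bipC2 nb u v a b prs lc acc)
      (Cd.bip u v a b c (cnd (Nat.beq c nb) (dbl nb) (cnd (Nat.beq v nb) (dbl nb) nb)) :: bipC2 nb u v a b prs lc acc)) := rfl
  have : dbl nb = 2 * nb := by unfold dbl; exact (two_mul nb).symm
  rw [e, this]
  simp only [cnd_eq, Nat.beq_eq, elm_iff]
  congr 2
  split_ifs <;> simp_all

theorem bipC2_acc (nb u v a b : ℕ) (prs : List ℕ) (lc : List ℕ) (acc : List Cd) {c : Cd} (h : c ∈ acc) :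
    c ∈ bipC2 nb u v a b prs lc acc := by
  induction lc with
  | nil => exact h
  | cons x l ih => rw [bipC2_cons]; split_ifs <;> simp [ih]
theorem bipC2_mem (nb u v a b : ℕ) (prs : List ℕ) (lc : List ℕ) (acc : List Cd) {c : ℕ} (h : c ∈ lc)
    (h1 : v ≠ c) (h2 : Nat.lor v c ∉ prs) :
    Cd.bip u v a b c (if c = nb ∨ v = nb then 2 * nb else nb) ∈ bipC2 nb u v a b prs lc acc := by
  induction lc with
  | nil => simp at h
  | cons x l ih =>
    rw [bipC2_cons]
    rcases List.mem_cons.mp h with rfl | h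
    · rw [if_neg h1, if_neg h2]; exact List.mem_cons_self
    · by_cases e1 : v = x
      · rw [if_pos e1]; exact ih h
      · rw [if_neg e1]
        by_cases e2 : Nat.lor v x ∈ prs
        · rw [if_pos e2]; exact ih h
        · rw [if_neg e2]; exact List.mem_cons_of_mem _ (ih h)
theorem bipC1_acc (nb u a b : ℕ) (prs : List ℕ) (lv lc : List ℕ) (acc : List Cd) {c : Cd} (h : c ∈ acc) :
    c ∈ bipC1 nb u a b prs lv lc acc := by
  induction lv with
  | nil => exact h
  | cons x l ih => exact bipC2_acc _ _ _ _ _ _ _ _ ih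
theorem bipC1_mem (nb u a b : ℕ) (prs : List ℕ) (lv lc : List ℕ) (acc : List Cd) {v c : ℕ} (hv : v ∈ lv) (h : c ∈ lc)
    (h1 : v ≠ c) (h2 : Nat.lor v c ∉ prs) :
    Cd.bip u v a b c (if c = nb ∨ v = nb then 2 * nb else nb) ∈ bipC1 nb u a b prs lv lc acc := by
  induction lv with
  | nil => simp at hv
  | cons x l ih =>
    rcases List.mem_cons.mp hv with rfl | hv
    · exact bipC2_mem _ _ _ _ _ _ _ _ h h1 h2
    · exact bipC2_acc _ _ _ _ _ _ _ _ (ih hv)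

theorem bipC_eq (B : List ℕ) (nb al u a b : ℕ) (prs : List ℕ) (acc : List Cd) :
  bipC B nb al u a b prs acc = bipC1 nb u a b prs
    (BITS.filter (fun x => subb x (Nat.land al (cpl (uni (subb u) B)))))
    (BITS.filter (fun x => subb x (Nat.land al (cpl (uni (subb (Nat.lor a b)) B)))))
    (if 2 * nb ≤ 512 then Cd.bip u nb a b (2 * nb) (2 * (2 * nb)) :: acc else acc) := by
  have e : ∀ n, dbl n = 2 * n := by intro n; unfold dbl; exact (two_mul n).symm
  simp only [bipC, bitsK_eq, e, cnd_eq, Nat.ble_eq]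
theorem bipC_acc (B : List ℕ) (nb al u a b : ℕ) (prs : List ℕ) (acc : List Cd) {c : Cd} (h : c ∈ acc) :
    c ∈ bipC B nb al u a b prs acc := by
  rw [bipC_eq]
  apply bipC1_acc
  split_ifs <;> simp [h]

theorem label [Fintype α] (hα : Fintype.card α = 10) {φ : ℕ → α} {k : ℕ} (hk : k ≤ 10)
    (inj : Set.InjOn φ {i | i < k}) (p : α) :
    ∃ i k' φ', k ≤ k' ∧ k' ≤ 10 ∧ i < k' ∧ (∀ j < k, φ' j = φ j) ∧ Set.InjOn φ' {i | i < k'} ∧ φ' i = p ∧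
      ((i < k ∧ k' = k) ∨ (i = k ∧ k' = k + 1)) := by
  by_cases h : ∃ i < k, φ i = p
  · obtain ⟨i, hi, e⟩ := h
    exact ⟨i, k, φ, le_rfl, hk, hi, fun _ _ => rfl, inj, e, Or.inl ⟨hi, rfl⟩⟩
  · push Not at h
    have agree : ∀ j < k, Function.update φ k p j = φ j := fun j hj => by
      rw [Function.update_of_ne (by omega)]
    have inj' : Set.InjOn (Function.update φ k p) {i | i < k + 1} := by
      intro i hi j hj e
      have hi : i < k + 1 := hi
      have hj : j < k + 1 := hj
      rcases Nat.lt_succ_iff_lt_or_eq.mp hi with hi | rfl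
      · rcases Nat.lt_succ_iff_lt_or_eq.mp hj with hj | rfl
        · rw [agree i hi, agree j hj] at e
          exact inj hi hj e
        · rw [agree i hi, Function.update_self] at e
          exact absurd e (h i hi)
      · rcases Nat.lt_succ_iff_lt_or_eq.mp hj with hj | rfl
        · rw [agree j hj, Function.update_self] at e
          exact absurd e.symm (h j hj)
        · rfl
    refine ⟨k, k + 1, Function.update φ k p, by omega, ?_, by omega, agree, inj', by simp, Or.inr ⟨rfl, rfl⟩⟩
    have := Finset.card_le_card_of_injOn (s := Finset.range (k+1)) (t := Finset.univ) (Function.update φ k p) (fun _ _ => Finset.mem_coe.mpr (Finset.mem_univ _))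
      (by intro i hi j hj e; exact inj' (by simpa using hi) (by simpa using hj) e)
    rw [Finset.card_range, Finset.card_univ, hα] at this
    exact this

theorem bip_good {𝓑 : Finset (Finset α)} {b U A : Finset α} (hU : U.card = 2) (hd : Disjoint U A) (hb : b = U ∪ A)
    (hG : ∀ T ⊆ b, T.card = 3 → ¬ U ⊆ T → T ≠ A → Good 𝓑 T b) {x y z : α} (hx : x ∈ U) (hy : y ∈ A) (hz : z ∈ A)
    (hyz : y ≠ z) : ({x, y, z} : Finset α).card = 3 ∧ ({x, y, z} : Finset α) ⊆ b ∧ Good 𝓑 {x, y, z} b := by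
  have hxy : x ≠ y := fun h => Finset.disjoint_left.mp hd hx (h ▸ hy)
  have hxz : x ≠ z := fun h => Finset.disjoint_left.mp hd hx (h ▸ hz)
  have h3 : ({x, y, z} : Finset α).card = 3 := Finset.card_eq_three.mpr ⟨x, y, z, hxy, hxz, hyz, rfl⟩
  have hs : ({x, y, z} : Finset α) ⊆ b := by
    rw [hb]; intro w hw; simp only [Finset.mem_insert, Finset.mem_singleton] at hw
    rw [Finset.mem_union]
    rcases hw with rfl | rfl | rfl
    exacts [Or.inl hx, Or.inr hy, Or.inr hz]
  refine ⟨h3, hs, hG _ hs h3 ?_ ?_⟩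
  · intro hsub
    obtain ⟨p, q, hpq, e⟩ := Finset.card_eq_two.mp hU
    have h2 : ∀ p ∈ U, p = x := by
      intro p hp
      have := hsub hp
      simp only [Finset.mem_insert, Finset.mem_singleton] at this
      rcases this with h | h | h
      · exact h
      · exact absurd (h ▸ hy) (Finset.disjoint_left.mp hd hp)
      · exact absurd (h ▸ hz) (Finset.disjoint_left.mp hd hp)
    apply hpq
    rw [h2 p (by simp [e]), h2 q (by simp [e])]
  · intro e
    exact Finset.disjoint_left.mp hd hx (e ▸ (by simp))

theorem five_cases {u v a b c : α} {T : Finset α} (hT : T ⊆ {u, v, a, b, c}) (h3 : T.card = 3)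
    (h1 : ¬ ({u, v} : Finset α) ⊆ T) (h2 : T ≠ {a, b, c})
    (h4 : ({u, a, b, c} : Finset α).card = 4) (h5 : ({v, a, b, c} : Finset α).card = 4) :
    T = {u, a, b} ∨ T = {u, a, c} ∨ T = {u, b, c} ∨ T = {v, a, b} ∨ T = {v, a, c} ∨ T = {v, b, c} := by
  have e : T = ({u, v, a, b, c} : Finset α).filter (· ∈ T) := by
    ext x; simp only [Finset.mem_filter]; exact ⟨fun h => ⟨hT h, h⟩, fun h => h.2⟩
  have c1 : ∀ x : α, ({x} : Finset α).card ≤ 2 := fun x => by simp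
  have c2 : ∀ x y : α, ({x, y} : Finset α).card ≤ 2 := fun x y => Finset.card_le_two
  have bad : T.card ≤ 2 → False := by omega
  by_cases hu : u ∈ T <;> by_cases hv : v ∈ T
  · exact absurd (by intro x hx; simp at hx; rcases hx with rfl | rfl <;> assumption) h1
  all_goals
    by_cases ha : a ∈ T <;> by_cases hb : b ∈ T <;> by_cases hc : c ∈ T <;>
    simp only [Finset.filter_insert, Finset.filter_singleton, hu, hv, ha, hb, hc, if_true, if_false, insert_empty_eq] at e
  all_goals first
    | exact absurd e h2
    | (exfalso; apply bad; rw [e]; first | exact c2 _ _ | exact c1 _ | (simp; done))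
    | (simp only [e, true_or, or_true]; done)
    | (rw [e] at h3; omega)
end sem
end PS

namespace PS
section sem
variable {α : Type} [DecidableEq α]

noncomputable def childS (st : St) (t : ℕ) : Cd → St
  | Cd.tet x n => updS st (Nat.lor t x) [Nat.lor t x]
        [t, Nat.lor x (Nat.lor (low t) (low (clr t))), Nat.lor x (Nat.lor (low t) (clr (clr t))),
          Nat.lor x (Nat.lor (low (clr t)) (clr (clr t)))] n (Nat.pred st.rem)
  | Cd.bip u v a b c n => updS st (Nat.lor t (Nat.lor v c)) [Nat.lor u v, Nat.lor (Nat.lor a b) c]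
        [Nat.lor u (Nat.lor a b), Nat.lor u (Nat.lor a c), Nat.lor u (Nat.lor b c),
         Nat.lor v (Nat.lor a b), Nat.lor v (Nat.lor a c), Nat.lor v (Nat.lor b c)] n st.rem

theorem child_eq {β : Type} (st : St) (t : ℕ) (c : Cd) (k : St → β) : child st t c k = k (childS st t c) := by
  cases c with
  | tet x n => simp only [child, frc_eq, upd_eq, childS]
  | bip u v a b c n => simp only [child, upd_eq, childS]

/-- a forbidden mask cannot lie inside an outside block -/
theorem forb {𝓑 : Finset (Finset α)} {φ φ' : ℕ → α} {st : St} (H : Holds 𝓑 φ st) {k : ℕ} (hk : st.nb = 2 ^ k)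
    (hφ : ∀ i < k, φ' i = φ i) {b : Finset α} (hb : b ∈ 𝓑) (ho : Out φ st.B b) {f : ℕ} (hf : f ∈ st.F)
    (hs : ∀ i ∈ ms f, φ' i ∈ b) : False := by
  refine H.hF f hf b hb ?_ ho
  rw [← im_congr hφ (hk ▸ H.Flt f hf)]
  intro x hx
  obtain ⟨i, hi, rfl⟩ := Finset.mem_image.mp hx
  exact hs i hi

theorem childS_bip (st : St) (t u v a b c n : ℕ) : childS st t (Cd.bip u v a b c n) =
    updS st (Nat.lor t (Nat.lor v c)) [Nat.lor u v, Nat.lor (Nat.lor a b) c]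
        [Nat.lor u (Nat.lor a b), Nat.lor u (Nat.lor a c), Nat.lor u (Nat.lor b c),
         Nat.lor v (Nat.lor a b), Nat.lor v (Nat.lor a c), Nat.lor v (Nat.lor b c)] n st.rem := rfl
theorem childS_tet (st : St) (t x n : ℕ) : childS st t (Cd.tet x n) =
    updS st (Nat.lor t x) [Nat.lor t x]
        [t, Nat.lor x (Nat.lor (low t) (low (clr t))), Nat.lor x (Nat.lor (low t) (clr (clr t))),
          Nat.lor x (Nat.lor (low (clr t)) (clr (clr t)))] n (Nat.pred st.rem) := rfl

theorem un5 (u v a b c : α) : ({u, v} : Finset α) ∪ {a, b, c} = {u, v, a, b, c} := by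
  ext x; simp; tauto
theorem un5' (u v a b c : α) : ({u, a, b} : Finset α) ∪ ({v} ∪ {c}) = {u, v, a, b, c} := by
  ext x; simp; tauto
theorem un3' (a b c : α) : ({a} : Finset α) ∪ {b} ∪ {c} = {a, b, c} := by ext x; simp
theorem un3 (a b c : α) : ({c} : Finset α) ∪ {a, b} = {a, b, c} := by ext x; simp; tauto

set_option maxHeartbeats 400000 in
theorem bip_core [Fintype α] (hα : Fintype.card α = 10) {𝓑 : Finset (Finset α)} {φ : ℕ → α} {st : St} (H : Holds 𝓑 φ st)
    {k : ℕ} (hk : st.nb = 2 ^ k) (hk10 : k ≤ 10) (inj : Set.InjOn φ {i | i < k})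
    {t : ℕ} (ht : t < 2 ^ k) {iu ia ib : ℕ} (hmt : ms t = {iu, ia, ib}) (hab : ia ≠ ib)
    {b U A : Finset α} (hb : b ∈ 𝓑) (ho : Out φ st.B b) (hU : U.card = 2) (hA : A.card = 3) (hd : Disjoint U A)
    (hUA : b = U ∪ A) (eU : Excl 𝓑 U b) (eA : Excl 𝓑 A b)
    (hG : ∀ T ⊆ b, T.card = 3 → ¬ U ⊆ T → T ≠ A → Good 𝓑 T b)
    (hu : φ iu ∈ U) (ha : φ ia ∈ A) (hb' : φ ib ∈ A)
    {bad al : ℕ} {prs : List ℕ} (hal : ∀ i, (i < k ∨ (i = k ∧ k < 10)) → i ∉ ms bad → i ∈ ms al)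
    (hbad : ∀ i ∈ ms bad, i ∈ ms t ∨ ∃ f ∈ st.F, ms f ∩ ms (cpl t) ⊆ {i})
    (hprs : ∀ r ∈ prs, ∃ f ∈ st.F, r = Nat.land f (cpl t)) :
    ∃ c, (∀ acc, c ∈ bipC st.B st.nb al (2^iu) (2^ia) (2^ib) prs acc) ∧ Sat 𝓑 (childS st t c) := by
  have h10 : ∀ i < k, i < 10 := fun i hi => by omega
  have liu : iu < k := ms_lt ht (by rw [hmt]; simp)
  have lia : ia < k := ms_lt ht (by rw [hmt]; simp)
  have lib : ib < k := ms_lt ht (by rw [hmt]; simp)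
  have nab : φ ia ≠ φ ib := fun e => hab (inj lia lib e)
  -- the two new points
  obtain ⟨pv, hpv, Ue⟩ : ∃ pv, pv ≠ φ iu ∧ U = {φ iu, pv} := by
    obtain ⟨p, q, hpq, e⟩ := Finset.card_eq_two.mp hU
    rw [e] at hu; simp only [Finset.mem_insert, Finset.mem_singleton] at hu
    rcases hu with h | h
    · exact ⟨q, by rw [h]; exact hpq.symm, by rw [h, e]⟩
    · exact ⟨p, by rw [h]; exact hpq, by rw [h, e, Finset.pair_comm]⟩
  obtain ⟨pc, hpc1, hpc2, Ae⟩ : ∃ pc, pc ≠ φ ia ∧ pc ≠ φ ib ∧ A = {φ ia, φ ib, pc} := by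
    have hs : ({φ ia, φ ib} : Finset α) ⊆ A := by
      intro x hx; simp only [Finset.mem_insert, Finset.mem_singleton] at hx
      rcases hx with rfl | rfl <;> assumption
    have h1 : (A \ {φ ia, φ ib}).card = 1 := by
      rw [Finset.card_sdiff_of_subset hs, hA, Finset.card_pair nab]
    obtain ⟨pc, e⟩ := Finset.card_eq_one.mp h1
    have hm : pc ∈ A \ {φ ia, φ ib} := by rw [e]; simp
    simp only [Finset.mem_sdiff, Finset.mem_insert, Finset.mem_singleton, not_or] at hm
    refine ⟨pc, hm.2.1, hm.2.2, ?_⟩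
    rw [← Finset.sdiff_union_of_subset hs, e, un3]
  have pvU : pv ∈ U := by rw [Ue]; simp
  have pcA : pc ∈ A := by rw [Ae]; simp
  have dj : ∀ x ∈ U, ∀ y ∈ A, x ≠ y := fun x hx y hy e => Finset.disjoint_left.mp hd hx (e ▸ hy)
  obtain ⟨iv, k1, φ1, hk1, hk1', hiv, ag1, inj1, ev, cv⟩ := label hα hk10 inj pv
  obtain ⟨ic, k2, φ2, hk2, hk2', hic, ag2, inj2, ec, cc⟩ := label hα hk1' inj1 pc
  have ag : ∀ i < k, φ2 i = φ i := fun i hi => by rw [ag2 i (by omega), ag1 i hi]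
  have ev2 : φ2 iv = pv := by rw [ag2 iv hiv, ev]
  have eu2 := ag iu liu
  have ea2 := ag ia lia
  have eb2 := ag ib lib
  have ivt : iv ∉ ms t := by
    rw [hmt]; simp only [Finset.mem_insert, Finset.mem_singleton, not_or]
    refine ⟨?_, ?_, ?_⟩ <;> rintro rfl
    · exact hpv (by rw [← ev2, eu2])
    · exact dj _ pvU _ ha (by rw [← ev2, ea2])
    · exact dj _ pvU _ hb' (by rw [← ev2, eb2])
  have ict : ic ∉ ms t := by
    rw [hmt]; simp only [Finset.mem_insert, Finset.mem_singleton, not_or]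
    refine ⟨?_, ?_, ?_⟩ <;> rintro rfl
    · exact dj _ hu _ pcA (by rw [← ec, eu2])
    · exact hpc1 (by rw [← ec, ea2])
    · exact hpc2 (by rw [← ec, eb2])
  have nvc : iv ≠ ic := by
    rintro rfl; exact dj _ pvU _ pcA (by rw [← ev2, ec])
  have Ub : ∀ x ∈ U, x ∈ b := fun x hx => by rw [hUA]; exact Finset.mem_union_left _ hx
  have Ab : ∀ x ∈ A, x ∈ b := fun x hx => by rw [hUA]; exact Finset.mem_union_right _ hx
  have tb : ∀ i ∈ ms t, φ2 i ∈ b := by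
    intro i hi; rw [hmt] at hi; simp only [Finset.mem_insert, Finset.mem_singleton] at hi
    rcases hi with rfl | rfl | rfl
    · rw [eu2]; exact Ub _ hu
    · rw [ea2]; exact Ab _ ha
    · rw [eb2]; exact Ab _ hb'
  have vb : φ2 iv ∈ b := by rw [ev2]; exact Ub _ pvU
  have cb : φ2 ic ∈ b := by rw [ec]; exact Ab _ pcA
  have cplt : ∀ i < 10, i ∉ ms t → i ∈ ms (cpl t) := fun i h h' => ms_cpl.mpr ⟨h, h'⟩
  have nbad : ∀ i < 10, i ∉ ms t → φ2 i ∈ b → i ∉ ms bad := by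
    intro i hi hit hib hc
    rcases hbad i hc with h | ⟨f, hf, h⟩
    · exact hit h
    · refine forb H hk ag hb ho hf fun j hj => ?_
      by_cases hjt : j ∈ ms t
      · exact tb j hjt
      · have := h (Finset.mem_inter.mpr ⟨hj, cplt j (mem_ms.mp hj).1 hjt⟩)
        rw [Finset.mem_singleton.mp this]; exact hib
  have nprs : Nat.lor (2^iv) (2^ic) ∉ prs := by
    intro hc
    obtain ⟨f, hf, e⟩ := hprs _ hc
    refine forb H hk ag hb ho hf fun j hj => ?_
    by_cases hjt : j ∈ ms t
    · exact tb j hjt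
    · have : j ∈ ms (Nat.lor (2^iv) (2^ic)) := by
        rw [e, ms_land]; exact Finset.mem_inter.mpr ⟨hj, cplt j (mem_ms.mp hj).1 hjt⟩
      rw [ms_lor, ms_pow (by omega), ms_pow (by omega)] at this
      simp only [Finset.mem_union, Finset.mem_singleton] at this
      rcases this with rfl | rfl <;> assumption
  have cB : ∀ m ∈ st.B, im φ2 m = im φ m := fun m hm => im_congr ag (hk ▸ H.Blt m hm)
  have nU : iv ∈ ms (cpl (uni (subb (2^iu)) st.B)) := by
    rw [ms_cpl]; refine ⟨by omega, fun hc => ?_⟩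
    obtain ⟨m, hm, h1, h2⟩ := (uni_ms _ _ _).mp hc
    have h1 := subb_ms h1
    rw [ms_pow (h10 _ liu), Finset.singleton_subset_iff] at h1
    refine ho m hm (eU _ (H.hB m hm) ?_).symm
    rw [← cB m hm, Ue]
    intro x hx; simp only [Finset.mem_insert, Finset.mem_singleton] at hx
    rcases hx with rfl | rfl
    · rw [← eu2]; exact Finset.mem_image_of_mem _ h1
    · rw [← ev2]; exact Finset.mem_image_of_mem _ h2
  have nA : ic ∈ ms (cpl (uni (subb (Nat.lor (2^ia) (2^ib))) st.B)) := by
    rw [ms_cpl]; refine ⟨by omega, fun hc => ?_⟩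
    obtain ⟨m, hm, h1, h2⟩ := (uni_ms _ _ _).mp hc
    have h1 := subb_ms h1
    rw [ms_lor, ms_pow (h10 _ lia), ms_pow (h10 _ lib)] at h1
    refine ho m hm (eA _ (H.hB m hm) ?_).symm
    rw [← cB m hm, Ae]
    intro x hx; simp only [Finset.mem_insert, Finset.mem_singleton] at hx
    rcases hx with rfl | rfl | rfl
    · rw [← ea2]; exact Finset.mem_image_of_mem _ (h1 (by simp))
    · rw [← eb2]; exact Finset.mem_image_of_mem _ (h1 (by simp))
    · rw [← ec]; exact Finset.mem_image_of_mem _ h2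
  have pl : ∀ i < k2, 2^i < 2^k2 := fun i hi => Nat.pow_lt_pow_right (by norm_num) hi
  have lu := pl iu (by omega)
  have la := pl ia (by omega)
  have lb := pl ib (by omega)
  have lv := pl iv (by omega)
  have lcc := pl ic hic
  have Iu : im φ2 (2^iu) = {φ iu} := by rw [im_pow _ (by omega), eu2]
  have Ia : im φ2 (2^ia) = {φ ia} := by rw [im_pow _ (by omega), ea2]
  have Ib : im φ2 (2^ib) = {φ ib} := by rw [im_pow _ (by omega), eb2]
  have Iv : im φ2 (2^iv) = {pv} := by rw [im_pow _ (by omega), ev2]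
  have Ic : im φ2 (2^ic) = {pc} := by rw [im_pow _ (by omega), ec]
  have It : im φ2 t = {φ iu, φ ia, φ ib} := by
    unfold im; rw [hmt]; simp [eu2, ea2, eb2]
  have bE : b = {φ iu, pv, φ ia, φ ib, pc} := by
    rw [hUA, Ue, Ae, un5]
  have sat : Sat 𝓑 (childS st t (Cd.bip (2^iu) (2^iv) (2^ia) (2^ib) (2^ic) (2^k2))) := by
    rw [childS_bip]
    refine ⟨φ2, upd_holds H hk (by omega) hk2' ag inj2 hb ho ?_ ?_ ?_ ?_ ?_ ?_⟩
    · have h1 : t < 2^k2 := lt_of_lt_of_le ht (Nat.pow_le_pow_right (by norm_num) (by omega))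
      exact lor_lt h1 (lor_lt lv lcc)
    · rw [im_lor, im_lor, Iv, Ic, It, bE, un5']
    · intro f hf
      simp only [List.mem_cons, List.not_mem_nil, or_false] at hf
      rcases hf with rfl | rfl
      · refine ⟨lor_lt lu lv, ?_⟩
        rw [im_lor, Iu, Iv]; rw [Ue] at eU; exact eU
      · refine ⟨lor_lt (lor_lt la lb) lcc, ?_⟩
        rw [im_lor, im_lor, Ia, Ib, Ic]; rw [Ae] at eA
        rw [un3']; exact eA
    · intro x hx
      have g : ∀ p q r : ℕ, p < 2^k2 → q < 2^k2 → r < 2^k2 → ∀ x y z : α, im φ2 p = {x} → im φ2 q = {y} → im φ2 r = {z} →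
          x ∈ U → y ∈ A → z ∈ A → y ≠ z → Nat.lor p (Nat.lor q r) < 2^k2 ∧ (im φ2 (Nat.lor p (Nat.lor q r))).card = 3 ∧
          im φ2 (Nat.lor p (Nat.lor q r)) ⊆ b ∧ Good 𝓑 (im φ2 (Nat.lor p (Nat.lor q r))) b := by
        intro p q r hp hq hr x y z e1 e2 e3 hx hy hz hyz
        refine ⟨lor_lt hp (lor_lt hq hr), ?_⟩
        have : im φ2 (Nat.lor p (Nat.lor q r)) = {x, y, z} := by rw [im_lor, im_lor, e1, e2, e3]; rfl
        rw [this]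
        exact bip_good hU hd hUA hG hx hy hz hyz
      simp only [List.mem_cons, List.not_mem_nil, or_false] at hx
      rcases hx with rfl | rfl | rfl | rfl | rfl | rfl
      · exact g _ _ _ lu la lb _ _ _ Iu Ia Ib hu ha hb' nab
      · exact g _ _ _ lu la lcc _ _ _ Iu Ia Ic hu ha pcA hpc1.symm
      · exact g _ _ _ lu lb lcc _ _ _ Iu Ib Ic hu hb' pcA hpc2.symm
      · exact g _ _ _ lv la lb _ _ _ Iv Ia Ib pvU ha hb' nab
      · exact g _ _ _ lv la lcc _ _ _ Iv Ia Ic pvU ha pcA hpc1.symm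
      · exact g _ _ _ lv lb lcc _ _ _ Iv Ib Ic pvU hb' pcA hpc2.symm
    · intro T hT h3 ⟨c, hc, hcb, hTc⟩
      have n1 : ¬ ({φ iu, pv} : Finset α) ⊆ T := fun h => hcb (eU c hc (by rw [Ue]; exact h.trans hTc))
      have n2 : T ≠ {φ ia, φ ib, pc} := fun h => hcb (eA c hc (by rw [Ae, ← h]; exact hTc))
      have c4 : ∀ x ∈ U, ({x, φ ia, φ ib, pc} : Finset α).card = 4 := by
        intro x hx
        rw [Finset.card_insert_of_notMem, ← Ae, hA]
        rw [← Ae]; exact Finset.disjoint_left.mp hd hx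
      have := five_cases (bE ▸ hT) h3 n1 n2 (c4 _ hu) (c4 _ pvU)
      simp only [List.mem_cons, List.not_mem_nil, or_false, exists_eq_or_imp, exists_eq_left, im_lor, Iu, Iv, Ia, Ib, Ic]
      rcases this with h | h | h | h | h | h <;> rw [h]
      · exact Or.inl rfl
      · exact Or.inr (Or.inl rfl)
      · exact Or.inr (Or.inr (Or.inl rfl))
      · exact Or.inr (Or.inr (Or.inr (Or.inl rfl)))
      · exact Or.inr (Or.inr (Or.inr (Or.inr (Or.inl rfl))))
      · exact Or.inr (Or.inr (Or.inr (Or.inr (Or.inr rfl))))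
    · refine le_trans (Set.ncard_le_ncard ?_ (𝓑.finite_toSet.subset (fun b hb => hb.1))) H.rem
      exact fun x hx => ⟨hx.1, hx.2.1, hx.2.2.1⟩
  have pe : ∀ i j : ℕ, (2:ℕ)^i = 2^j ↔ i = j := fun i j => Nat.pow_right_inj (le_refl 2)
  refine ⟨_, fun acc => ?_, sat⟩
  rw [bipC_eq]
  by_cases hnew : iv = k ∧ ic = k + 1
  · obtain ⟨h1, h2⟩ := hnew
    apply bipC1_acc
    have e1 : 2 * st.nb = 2 ^ ic := by rw [hk, h2]; ring
    have e2 : 2 * (2 ^ ic) = 2 ^ k2 := by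
      have : k2 = ic + 1 := by omega
      rw [this]; ring
    rw [e1, e2, if_pos, hk, ← h1]
    · exact List.mem_cons_self
    · calc 2^ic ≤ 2^9 := Nat.pow_le_pow_right (by norm_num) (by omega)
        _ = 512 := by norm_num
  · have e : 2^k2 = if 2^ic = st.nb ∨ 2^iv = st.nb then 2 * st.nb else st.nb := by
      rw [hk]
      simp only [pe]
      split_ifs with h
      · rw [← pow_succ']; congr 1; omega
      · congr 1; omega
    rw [e]
    apply bipC1_mem
    · apply mem_bits
      rw [ms_land]; exact Finset.mem_inter.mpr ⟨hal iv (by omega) (nbad iv (by omega) ivt vb), nU⟩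
    · apply mem_bits
      rw [ms_land]; exact Finset.mem_inter.mpr ⟨hal ic (by omega) (nbad ic (by omega) ict cb), nA⟩
    · rw [Ne, pe]; exact nvc
    · exact nprs
end sem
end PS

namespace PS
section sem
variable {α : Type} [DecidableEq α]

theorem un4 (a b c x : α) : ({a, b, c} : Finset α) ∪ {x} = {x, a, b, c} := by ext y; simp; tauto

theorem four_cases {x a b c : α} {T : Finset α} (hT : T ⊆ {x, a, b, c}) (h3 : T.card = 3)
    (h4 : ({x, a, b, c} : Finset α).card = 4) :
    T = {a, b, c} ∨ T = {x, a, b} ∨ T = {x, a, c} ∨ T = {x, b, c} := by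
  have e : T = ({x, a, b, c} : Finset α).filter (· ∈ T) := by
    ext x; simp only [Finset.mem_filter]; exact ⟨fun h => ⟨hT h, h⟩, fun h => h.2⟩
  have c1 : ∀ x : α, ({x} : Finset α).card ≤ 2 := fun x => by simp
  have c2 : ∀ x y : α, ({x, y} : Finset α).card ≤ 2 := fun x y => Finset.card_le_two
  have bad : T.card ≤ 2 → False := by omega
  by_cases hx : x ∈ T <;> by_cases ha : a ∈ T <;> by_cases hb : b ∈ T <;> by_cases hc : c ∈ T <;>
    simp only [Finset.filter_insert, Finset.filter_singleton, hx, ha, hb, hc, if_true, if_false, insert_empty_eq] at e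
  all_goals first
    | (exfalso; apply bad; rw [e]; first | exact c2 _ _ | exact c1 _ | (simp; done))
    | (simp only [e, true_or, or_true]; done)
    | (rw [e] at h3; omega)

set_option maxHeartbeats 400000 in
theorem tet_core [Fintype α] (hα : Fintype.card α = 10) {𝓑 : Finset (Finset α)} {φ : ℕ → α} {st : St} (H : Holds 𝓑 φ st)
    {k : ℕ} (hk : st.nb = 2 ^ k) (hk10 : k ≤ 10) (inj : Set.InjOn φ {i | i < k})
    {t : ℕ} (ht : t < 2 ^ k) {iu ia ib : ℕ} (hmt : ms t = {iu, ia, ib})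
    (l1 : low t = 2^iu) (l2 : low (clr t) = 2^ia) (l3 : clr (clr t) = 2^ib)
    (h3 : (im φ t).card = 3)
    {b : Finset α} (hb : b ∈ 𝓑) (ho : Out φ st.B b) (hT : IsTet 𝓑 b) (htb : im φ t ⊆ b)
    {bad al : ℕ} (hal : ∀ i, (i < k ∨ (i = k ∧ k < 10)) → i ∉ ms bad → i ∈ ms al)
    (hbad : ∀ i ∈ ms bad, i ∈ ms t ∨ ∃ f ∈ st.F, ms f ∩ ms (cpl t) ⊆ {i}) :
    st.rem ≠ 0 ∧ ∃ c, (∀ acc, c ∈ tetC st.nb (BITS.filter (fun x => subb x al)) acc) ∧ Sat 𝓑 (childS st t c) := by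
  obtain ⟨b4, bE, bG⟩ := hT
  have liu : iu < k := ms_lt ht (by rw [hmt]; simp)
  have lia : ia < k := ms_lt ht (by rw [hmt]; simp)
  have lib : ib < k := ms_lt ht (by rw [hmt]; simp)
  have It0 : im φ t = {φ iu, φ ia, φ ib} := by unfold im; rw [hmt]; simp
  obtain ⟨p, hp, be⟩ : ∃ p, p ∉ im φ t ∧ b = im φ t ∪ {p} := by
    have h1 : (b \ im φ t).card = 1 := by rw [Finset.card_sdiff_of_subset htb, b4, h3]
    obtain ⟨p, e⟩ := Finset.card_eq_one.mp h1
    have hm : p ∈ b \ im φ t := by rw [e]; simp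
    refine ⟨p, (Finset.mem_sdiff.mp hm).2, ?_⟩
    rw [← e, Finset.union_sdiff_of_subset htb]
  obtain ⟨iv, k1, φ1, hk1, hk1', hiv, ag, inj1, ev, cv⟩ := label hα hk10 inj p
  have It : im φ1 t = {φ iu, φ ia, φ ib} := by rw [im_congr ag ht, It0]
  have ivt : iv ∉ ms t := by
    intro h; apply hp; rw [← ev, ← im_congr ag ht]; exact Finset.mem_image_of_mem _ h
  have tb : ∀ i ∈ ms t, φ1 i ∈ b := by
    intro i hi; rw [be, ← im_congr ag ht]; exact Finset.mem_union_left _ (Finset.mem_image_of_mem _ hi)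
  have pb : p ∈ b := by rw [be]; simp
  have nbad : iv ∉ ms bad := by
    intro hc
    rcases hbad iv hc with h | ⟨f, hf, h⟩
    · exact ivt h
    · refine forb H hk ag hb ho hf fun j hj => ?_
      by_cases hjt : j ∈ ms t
      · exact tb j hjt
      · have := h (Finset.mem_inter.mpr ⟨hj, ms_cpl.mpr ⟨(mem_ms.mp hj).1, hjt⟩⟩)
        rw [Finset.mem_singleton.mp this, ev]; exact pb
  have lp : ∀ i < k1, 2^i < 2^k1 := fun i hi => Nat.pow_lt_pow_right (by norm_num) hi
  have lu := lp iu (by omega)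
  have la := lp ia (by omega)
  have lb := lp ib (by omega)
  have lv := lp iv hiv
  have lt : t < 2^k1 := lt_of_lt_of_le ht (Nat.pow_le_pow_right (by norm_num) (by omega))
  have Iu : im φ1 (2^iu) = {φ iu} := by rw [im_pow _ (by omega), ag _ liu]
  have Ia : im φ1 (2^ia) = {φ ia} := by rw [im_pow _ (by omega), ag _ lia]
  have Ib : im φ1 (2^ib) = {φ ib} := by rw [im_pow _ (by omega), ag _ lib]
  have Iv : im φ1 (2^iv) = {p} := by rw [im_pow _ (by omega), ev]
  have be4 : b = {p, φ iu, φ ia, φ ib} := by rw [be, It0, un4]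
  have bm : im φ1 (Nat.lor t (2^iv)) = b := by rw [im_lor, Iv, It, be4, un4]
  have fin : ({b | b ∈ 𝓑 ∧ b.card = 4 ∧ Out φ st.B b}).Finite := 𝓑.finite_toSet.subset (fun b hb => hb.1)
  have hr0 : Set.ncard {c | c ∈ 𝓑 ∧ c.card = 4 ∧ Out φ st.B c ∧ c ≠ b} + 1 ≤ st.rem := by
    have e : {c | c ∈ 𝓑 ∧ c.card = 4 ∧ Out φ st.B c} = insert b {c | c ∈ 𝓑 ∧ c.card = 4 ∧ Out φ st.B c ∧ c ≠ b} := by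
      ext c; simp only [Set.mem_ofPred_eq, Set.mem_insert_iff]
      by_cases h : c = b
      · subst h; simp [hb, b4, ho]
      · simp [h]
    have := H.rem
    rw [e, Set.ncard_insert_of_notMem (by simp) (fin.subset (fun c hc => ⟨hc.1, hc.2.1, hc.2.2.1⟩))] at this
    exact this
  have nuab : φ iu ≠ φ ia ∧ φ iu ≠ φ ib ∧ φ ia ≠ φ ib := by
    rw [It0] at h3; refine ⟨?_, ?_, ?_⟩ <;> intro e <;> rw [e] at h3
    · have := Finset.card_le_two (a := φ ia) (b := φ ib)
      rw [Finset.insert_eq_of_mem (by simp)] at h3; omega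
    · have := Finset.card_le_two (a := φ ia) (b := φ ib)
      rw [Finset.insert_eq_of_mem (by simp)] at h3; omega
    · have := Finset.card_le_two (a := φ iu) (b := φ ib)
      rw [Finset.pair_eq_singleton] at h3; omega
  rw [It0] at hp
  simp only [Finset.mem_insert, Finset.mem_singleton, not_or] at hp
  have sat : Sat 𝓑 (childS st t (Cd.tet (2^iv) (2^k1))) := by
    rw [childS_tet, l1, l2, l3]
    refine ⟨φ1, upd_holds H hk hk1 hk1' ag inj1 hb ho (lor_lt lt lv) bm ?_ ?_ ?_ ?_⟩
    · intro f hf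
      rw [List.mem_singleton.mp hf]
      exact ⟨lor_lt lt lv, by rw [bm]; exact bE⟩
    · intro x hx
      have g : ∀ q r : ℕ, q < 2^k1 → r < 2^k1 → ∀ y z : α, im φ1 q = {y} → im φ1 r = {z} →
          p ≠ y → p ≠ z → y ≠ z → y ∈ b → z ∈ b → Nat.lor (2^iv) (Nat.lor q r) < 2^k1 ∧ (im φ1 (Nat.lor (2^iv) (Nat.lor q r))).card = 3 ∧
          im φ1 (Nat.lor (2^iv) (Nat.lor q r)) ⊆ b ∧ Good 𝓑 (im φ1 (Nat.lor (2^iv) (Nat.lor q r))) b := by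
        intro q r hq hr y z e2 e3 hy hz hyz yb zb
        refine ⟨lor_lt lv (lor_lt hq hr), ?_⟩
        have : im φ1 (Nat.lor (2^iv) (Nat.lor q r)) = {p, y, z} := by rw [im_lor, im_lor, Iv, e2, e3]; rfl
        rw [this]
        have c3 : ({p, y, z} : Finset α).card = 3 := Finset.card_eq_three.mpr ⟨p, y, z, hy, hz, hyz, rfl⟩
        have s : ({p, y, z} : Finset α) ⊆ b := by
          intro w hw; simp only [Finset.mem_insert, Finset.mem_singleton] at hw
          rcases hw with rfl | rfl | rfl <;> assumption
        exact ⟨c3, s, bG _ s c3⟩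
      have ub : φ iu ∈ b := by rw [be4]; simp
      have ab : φ ia ∈ b := by rw [be4]; simp
      have bb : φ ib ∈ b := by rw [be4]; simp
      simp only [List.mem_cons, List.not_mem_nil, or_false] at hx
      rcases hx with rfl | rfl | rfl | rfl
      · rw [im_congr ag ht]; exact ⟨lt, h3, htb, bG _ htb h3⟩
      · exact g _ _ lu la _ _ Iu Ia hp.1 hp.2.1 nuab.1 ub ab
      · exact g _ _ lu lb _ _ Iu Ib hp.1 hp.2.2 nuab.2.1 ub bb
      · exact g _ _ la lb _ _ Ia Ib hp.2.1 hp.2.2 nuab.2.2 ab bb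
    · intro T hT hT3 _
      have := four_cases (be4 ▸ hT) hT3 (be4 ▸ b4)
      simp only [List.mem_cons, List.not_mem_nil, or_false, exists_eq_or_imp, exists_eq_left, im_lor, Iu, Iv, Ia, Ib, It]
      rcases this with h | h | h | h <;> rw [h]
      · exact Or.inl rfl
      · exact Or.inr (Or.inl rfl)
      · exact Or.inr (Or.inr (Or.inl rfl))
      · exact Or.inr (Or.inr (Or.inr rfl))
    · exact Nat.le_pred_of_lt hr0
  refine ⟨by omega, _, fun acc => ?_, sat⟩
  have pe : ∀ i j : ℕ, (2:ℕ)^i = 2^j ↔ i = j := fun i j => Nat.pow_right_inj (le_refl 2)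
  have e : 2^k1 = if 2^iv = st.nb then 2 * st.nb else st.nb := by
    rw [hk]
    simp only [pe]
    split_ifs with h
    · rw [← pow_succ']; congr 1; omega
    · congr 1; omega
  rw [e]
  exact tetC_mem _ _ _ (mem_bits (hal iv (by omega) nbad))

theorem sp12 (a b c : α) : ({a, b} : Finset α) ⊆ {a, b, c} := by intro x; simp; tauto
theorem sp13 (a b c : α) : ({a, c} : Finset α) ⊆ {a, b, c} := by intro x; simp; tauto
theorem rot3 (a b c : ℕ) : ({a, b, c} : Finset ℕ) = {c, a, b} := by ext x; simp; tauto
theorem tri_log {a b c a' b' c' : Prop} (h1 : a ∨ a') (h2 : b ∨ b') (h3 : c ∨ c') (d1 : ¬(a ∧ b)) (d2 : ¬ (a ∧ c))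
  (d3 : ¬ (b ∧ c)) (n : ¬ (a' ∧ b' ∧ c')) : (a ∧ b' ∧ c') ∨ (b ∧ a' ∧ c') ∨ (c ∧ a' ∧ b') := by tauto

set_option maxHeartbeats 400000 in
theorem cands_complete [Fintype α] (hα : Fintype.card α = 10) {𝓑 : Finset (Finset α)} {φ : ℕ → α} {st : St} (H : Holds 𝓑 φ st)
    {t : ℕ} (htO : t ∈ st.O) : ∃ c ∈ cands st t, Sat 𝓑 (childS st t c) := by
  obtain ⟨k, hk10, hk, inj⟩ := H.nb
  have ht : t < 2^k := hk ▸ H.Olt t htO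
  have hp : (2:ℕ)^k ≤ 1024 := by
    calc 2^k ≤ 2^10 := Nat.pow_le_pow_right (by norm_num) hk10
      _ = 1024 := by norm_num
  have h3 := H.O3 t htO
  obtain ⟨i, hi, j, hj, l, hl, hij, hil, hjl, l1, l2, l3, hmt⟩ :=
    three_bits t (by omega) (by rw [← im_card inj ht]; exact h3)
  obtain ⟨m, hm, -, b, hb, ho, htb, -⟩ := H.hO t htO
  have hcp : cpl t < 1024 := Nat.xor_lt_two_pow (n := 10) (by norm_num) (by omega)
  obtain ⟨bad, prs, e, hbad, hprs⟩ := resK_eq (β := List Cd) (cpl t) st.F hcp t []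
  have hprs : ∀ r ∈ prs, ∃ f ∈ st.F, r = Nat.land f (cpl t) := fun r hr => by
    rcases hprs r hr with h | h
    · simp at h
    · exact h
  unfold cands
  rw [e]
  simp only [frc_eq, bitsK_eq, l1, l2, l3]
  generalize hale : Nat.land _ (cpl bad) = al
  have hal : ∀ i, (i < k ∨ (i = k ∧ k < 10)) → i ∉ ms bad → i ∈ ms al := by
    intro i hi hib
    rw [← hale, ms_land, Finset.mem_inter, ms_lor, Finset.mem_union, ms_cpl, hk, ms_pred hk10]
    refine ⟨?_, by omega, hib⟩
    rcases hi with hi | ⟨rfl, hi⟩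
    · exact Or.inl hi
    · right
      rw [cnd_eq, if_neg, ms_pow hi]; simp
      rw [Nat.ble_eq]
      have : 2^i ≤ 2^9 := Nat.pow_le_pow_right (by norm_num) (by omega)
      norm_num at this ⊢; omega
  have acT : ∀ (c : Cd) (L M : List Cd), c ∈ M → c ∈ cnd (Nat.beq st.rem 0) id (tetC st.nb (BITS.filter (fun x => subb x al))) M := by
    intro c L M h
    rw [cnd_eq]; split_ifs
    · exact h
    · exact tetC_acc _ _ _ h
  rcases H.types b hb ho with ⟨U, A, hU, hA, hd, hUA, eU, eA, hG⟩ | hT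
  · -- bipyramid
    have It0 : im φ t = {φ i, φ j, φ l} := by unfold im; rw [hmt]; simp
    have cls : ∀ x ∈ im φ t, x ∈ U ∨ x ∈ A := fun x hx => by
      have := htb hx; rw [hUA] at this; exact Finset.mem_union.mp this
    rw [It0] at htb cls h3
    have inE : ∀ x y : α, x ∈ U → y ∈ U → ({φ i, φ j, φ l} : Finset α) = {φ i, φ j, φ l} → x ≠ y →
      ({x, y} : Finset α) ⊆ im φ t → False := by
      intro x y hx hy _ hxy hs
      have e2 : U = {x, y} := by
        symm; apply Finset.eq_of_subset_of_card_le
        · intro z hz; simp only [Finset.mem_insert, Finset.mem_singleton] at hz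
          rcases hz with rfl | rfl <;> assumption
        · rw [hU, Finset.card_pair hxy]
      obtain ⟨m, hm, htm, -⟩ := H.hO t htO
      exact ho m hm (eU _ (H.hB m hm) (by rw [e2]; exact hs.trans htm)).symm
    have nA : ¬ (φ i ∈ A ∧ φ j ∈ A ∧ φ l ∈ A) := by
      rintro ⟨h1, h2, h4⟩
      obtain ⟨m, hm, htm, -⟩ := H.hO t htO
      have e2 : A = im φ t := by
        rw [It0]; symm; apply Finset.eq_of_subset_of_card_le
        · intro z hz; simp only [Finset.mem_insert, Finset.mem_singleton] at hz
          rcases hz with rfl | rfl | rfl <;> assumption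
        · rw [hA, h3]
      exact ho m hm (eA _ (H.hB m hm) (e2 ▸ htm)).symm
    have li : i < k := ms_lt ht (by rw [hmt]; simp)
    have lj : j < k := ms_lt ht (by rw [hmt]; simp)
    have ll : l < k := ms_lt ht (by rw [hmt]; simp)
    have nij : φ i ≠ φ j := fun e => hij (inj li lj e)
    have nil : φ i ≠ φ l := fun e => hil (inj li ll e)
    have njl : φ j ≠ φ l := fun e => hjl (inj lj ll e)
    have d1 : ¬ (φ i ∈ U ∧ φ j ∈ U) := fun h => inE _ _ h.1 h.2 rfl nij (by rw [It0]; exact sp12 _ _ _)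
    have d2 : ¬ (φ i ∈ U ∧ φ l ∈ U) := fun h => inE _ _ h.1 h.2 rfl nil (by rw [It0]; exact sp13 _ _ _)
    have d3 : ¬ (φ j ∈ U ∧ φ l ∈ U) := fun h => inE _ _ h.1 h.2 rfl njl (by rw [It0]; exact Finset.subset_insert _ _)
    have ci := cls (φ i) (by simp)
    have cj := cls (φ j) (by simp)
    have cl := cls (φ l) (by simp)
    have mt2 : ms t = {j, i, l} := by rw [hmt, Finset.insert_comm]
    have mt3 : ms t = {l, i, j} := by rw [hmt, rot3]
    have : (φ i ∈ U ∧ φ j ∈ A ∧ φ l ∈ A) ∨ (φ j ∈ U ∧ φ i ∈ A ∧ φ l ∈ A) ∨ (φ l ∈ U ∧ φ i ∈ A ∧ φ j ∈ A) := tri_log ci cj cl d1 d2 d3 nA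
    rcases this with ⟨h1, h2, h4⟩ | ⟨h1, h2, h4⟩ | ⟨h1, h2, h4⟩
    · obtain ⟨c, hc, hs⟩ := bip_core hα H hk hk10 inj ht hmt hjl hb ho hU hA hd hUA eU eA hG h1 h2 h4 hal hbad hprs
      exact ⟨c, acT _ [] _ (hc _), hs⟩
    · obtain ⟨c, hc, hs⟩ := bip_core hα H hk hk10 inj ht mt2 hil hb ho hU hA hd hUA eU eA hG h1 h2 h4 hal hbad hprs
      exact ⟨c, acT _ [] _ (bipC_acc _ _ _ _ _ _ _ _ (hc _)), hs⟩
    · obtain ⟨c, hc, hs⟩ := bip_core hα H hk hk10 inj ht mt3 hij hb ho hU hA hd hUA eU eA hG h1 h2 h4 hal hbad hprs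
      exact ⟨c, acT _ [] _ (bipC_acc _ _ _ _ _ _ _ _ (bipC_acc _ _ _ _ _ _ _ _ (hc _))), hs⟩
  · obtain ⟨hr, c, hc, hs⟩ := tet_core hα H hk hk10 inj ht hmt l1 l2 l3 h3 hb ho hT htb hal hbad
    refine ⟨c, ?_, hs⟩
    rw [cnd_eq, if_neg]
    · exact hc _
    · simpa using hr
end sem
end PS

namespace PS
section sem
variable {α : Type} [DecidableEq α]

theorem mapK_eq {β : Type} (s : ℕ) (l : List ℕ) (k : List ℕ → β) : mapK s l k = k (l.map (mpm s)) := by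
  induction l generalizing k with
  | nil => rfl
  | cons x l ih =>
    have : mapK s (x :: l) k = frc (mpm s x) fun y => mapK s l fun r => k (y :: r) := rfl
    rw [this, frc_eq, ih]; rfl

def sg (s i : ℕ) : ℕ := s / 16 ^ i % 16

noncomputable def mpL (L : List ℕ) (s M : ℕ) : ℕ :=
  @List.rec ℕ (fun _ => ℕ → ℕ) (fun _ => 0)
    (fun b _ ih s => cnd (subb b M)
      (Nat.lor (Nat.pow 2 (Nat.mod s 16)) (ih (Nat.div s 16))) (ih (Nat.div s 16))) L s

theorem subb_pow {i M : ℕ} (hi : i < 10) : subb (2^i) M = true ↔ M.testBit i = true := by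
  have lt : 2^i < 1024 := by
    calc 2^i < 2^10 := Nat.pow_lt_pow_right (by norm_num) hi
      _ = 1024 := by norm_num
  constructor
  · intro h; have := subb_ms h
    rw [ms_pow hi, Finset.singleton_subset_iff, mem_ms] at this; exact this.2
  · intro h; apply subb_of lt; rw [ms_pow hi, Finset.singleton_subset_iff, mem_ms]; exact ⟨hi, h⟩

theorem mpL_bit (M j : ℕ) : ∀ n i0 s, i0 + n ≤ 10 →
    ((mpL ((List.range' i0 n).map (2^·)) s M).testBit j = true ↔ ∃ i, i < n ∧ M.testBit (i0 + i) = true ∧ sg s i = j) := by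
  intro n
  induction n with
  | zero => intro i0 s _; simp [mpL]
  | succ n ih =>
    intro i0 s h
    have e : mpL ((List.range' i0 (n+1)).map (2^·)) s M =
      cnd (subb (2^i0) M) (Nat.lor (Nat.pow 2 (Nat.mod s 16)) (mpL ((List.range' (i0+1) n).map (2^·)) (s/16) M))
        (mpL ((List.range' (i0+1) n).map (2^·)) (s/16) M) := rfl
    have hs : ∀ i, sg (s/16) i = sg s (i+1) := by
      intro i; unfold sg; rw [Nat.div_div_eq_div_mul, pow_succ']
    have key : (mpL ((List.range' i0 (n+1)).map (2^·)) s M).testBit j = true ↔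
       ((M.testBit i0 = true ∧ sg s 0 = j) ∨ ∃ i, i < n ∧ M.testBit (i0 + 1 + i) = true ∧ sg s (i+1) = j) := by
      rw [e, cnd_eq]
      have ihh := ih (i0+1) (s/16) (by omega)
      simp only [hs] at ihh
      rw [← ihh]
      by_cases hb : subb (2^i0) M = true
      · rw [if_pos hb]
        rw [subb_pow (by omega)] at hb
        have : ∀ x y : ℕ, (Nat.lor x y).testBit j = (x.testBit j || y.testBit j) := fun x y => Nat.testBit_or x y j
        rw [this, Bool.or_eq_true]
        have e2 : Nat.pow 2 (Nat.mod s 16) = 2 ^ (s % 16) := rfl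
        rw [e2, Nat.testBit_two_pow]
        simp [hb, sg]
      · rw [if_neg hb]
        rw [subb_pow (by omega)] at hb
        simp [hb]
    rw [key]
    constructor
    · rintro (⟨h1, h2⟩ | ⟨i, hi, h1, h2⟩)
      · exact ⟨0, by omega, h1, h2⟩
      · exact ⟨i + 1, by omega, by rw [show i0 + (i+1) = i0 + 1 + i by omega]; exact h1, h2⟩
    · rintro ⟨i, hi, h1, h2⟩
      rcases i with _ | i
      · exact Or.inl ⟨h1, h2⟩
      · exact Or.inr ⟨i, by omega, by rw [show i0 + 1 + i = i0 + (i+1) by omega]; exact h1, h2⟩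

theorem mpm_bit (s M j : ℕ) : (mpm s M).testBit j = true ↔ ∃ i, i < 10 ∧ M.testBit i = true ∧ sg s i = j := by
  have := mpL_bit M j 10 0 s (by norm_num)
  simp only [zero_add] at this
  exact this

theorem cnd_tf (c x : Bool) : cnd c x false = true ↔ c = true ∧ x = true := by cases c <;> simp [cnd]

set_option maxHeartbeats 400000 in
theorem iso_sound {𝓑 : Finset (Finset α)} {s : ℕ} {r st : St} (h : isoChk s r st = true) (hr : ¬ Sat 𝓑 r) : ¬ Sat 𝓑 st := by
  rintro ⟨φ, H⟩
  apply hr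
  simp only [isoChk, mapK_eq, allb_eq, cnd_tf, List.all_eq_true, elm_iff, Nat.ble_eq, Nat.beq_eq, List.mem_map, forall_exists_index, and_imp, forall_apply_eq_imp_iff₂] at h
  obtain ⟨h1, h2, h3, h4, h5, h6, h7, h8, h9, h10, h11, h⟩ := h
  obtain ⟨k, hk10, hk, inj⟩ := H.nb
  have pk : 0 < 2^k := Nat.two_pow_pos k
  have lt : ∀ m, m ≤ Nat.pred st.nb → m < 2^k := by
    intro m hm; rw [hk] at hm; have : Nat.pred (2^k) = 2^k - 1 := rfl; omega
  have pr : ∀ i, (Nat.pred st.nb).testBit i = true ↔ i < k := by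
    intro i; rw [hk]
    have : Nat.pred (2^k) = 2^k - 1 := rfl
    rw [this, Nat.testBit_two_pow_sub_one]; simp
  have lt2 : ∀ i < k, sg s i < k := by
    intro i hi
    rw [← pr, ← h2, mpm_bit]
    exact ⟨i, by omega, by rw [h1, pr]; exact hi, rfl⟩
  have sur : ∀ j < k, ∃ i < k, sg s i = j := by
    intro j hj
    rw [← pr, ← h2, mpm_bit] at hj
    obtain ⟨i, -, hi, e⟩ := hj
    rw [h1, pr] at hi
    exact ⟨i, hi, e⟩
  have sinj : Set.InjOn (sg s) {i | i < k} := by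
    have h1 : Set.InjOn (sg s) (Finset.range k : Set ℕ) := by
      apply Finset.injOn_of_surjOn_of_card_le (t := Finset.range k) (sg s)
      · intro i hi; simp at hi ⊢; exact lt2 i hi
      · intro j hj; simp at hj ⊢; exact sur j hj
      · simp
    intro i hi j hj e; exact h1 (by simpa using hi) (by simpa using hj) e
  have ime : ∀ m, m < 2^k → im (φ ∘ sg s) m = im φ (mpm s m) := by
    intro m hm
    unfold im; rw [← Finset.image_image]; congr 1
    ext j; rw [Finset.mem_image, mem_ms, mpm_bit]
    constructor
    · rintro ⟨i, hi, rfl⟩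
      have := lt2 i (ms_lt hm hi)
      exact ⟨by omega, i, (mem_ms.mp hi).1, (mem_ms.mp hi).2, rfl⟩
    · rintro ⟨-, i, hi, hb, e⟩
      exact ⟨i, mem_ms.mpr ⟨hi, hb⟩, e⟩
  have eB : ∀ m ∈ r.B, im (φ ∘ sg s) m = im φ (mpm s m) := fun m hm => ime m (lt _ (h9 m hm))
  have eF : ∀ m ∈ r.F, im (φ ∘ sg s) m = im φ (mpm s m) := fun m hm => ime m (lt _ (h10 m hm))
  have eO : ∀ m ∈ r.O, im (φ ∘ sg s) m = im φ (mpm s m) := fun m hm => ime m (lt _ (h11 m hm))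
  have out : ∀ b, Out (φ ∘ sg s) r.B b ↔ Out φ st.B b := by
    intro b; constructor
    · intro ho m hm e
      obtain ⟨m', hm', e'⟩ := h5 m hm
      exact ho m' hm' (by rw [eB m' hm', e', e])
    · intro ho m hm e
      exact ho _ (h4 m hm) (by rw [← eB m hm, e])
  refine ⟨φ ∘ sg s, ⟨k, hk10, by rw [h1, hk], ?_⟩, ?_, ?_, ?_, ?_, ?_, ?_, ?_, ?_, ?_, ?_, ?_⟩
  · intro i hi j hj e
    exact sinj hi hj (inj (lt2 i hi) (lt2 j hj) e)
  · intro m hm; rw [h1, hk]; exact lt _ (h9 m hm)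
  · intro m hm; rw [h1, hk]; exact lt _ (h10 m hm)
  · intro m hm; rw [h1, hk]; exact lt _ (h11 m hm)
  · intro m hm; rw [eB m hm]; exact H.hB _ (h4 m hm)
  · intro f hf b hb hs ho
    rw [out] at ho; rw [eF f hf] at hs
    exact H.hF _ (h6 f hf) b hb hs ho
  · intro t ht; rw [eO t ht]; exact H.O3 _ (h7 t ht)
  · intro t ht
    obtain ⟨m, hm, hs, b, hb, ho, hsb, hu⟩ := H.hO _ (h7 t ht)
    obtain ⟨m', hm', e'⟩ := h5 m hm
    refine ⟨m', hm', by rw [eO t ht, eB m' hm', e']; exact hs, b, hb, (out b).mpr ho, by rw [eO t ht]; exact hsb, ?_⟩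
    rw [eO t ht, eB m' hm', e']; exact hu
  · simp only [out]; exact le_trans H.rem h3
  · intro b hb ho; exact H.types b hb ((out b).mp ho)
  · simp only [out]; have := H.cnt; omega
  · intro m hm b hb ho T hT hT3 hTm
    rw [eB m hm] at hTm
    obtain ⟨t, ht, e⟩ := H.cov _ (h4 m hm) b hb ((out b).mp ho) T hT hT3 hTm
    obtain ⟨t', ht', e'⟩ := h8 t ht
    exact ⟨t', ht', by rw [eO t' ht', e', e]⟩

set_option maxHeartbeats 400000 in
theorem closed_sound {𝓑 : Finset (Finset α)} (h12 : 𝓑.card = 12) {st : St} (hO : st.O = []) (h8 : 8 ≤ st.B.length)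
    (h11 : st.B.length ≤ 11) : ¬ Sat 𝓑 st := by
  rintro ⟨φ, H⟩
  obtain ⟨b, hb, ho⟩ : ∃ b ∈ 𝓑, Out φ st.B b := by
    by_contra hc
    have : 𝓑 ⊆ (st.B.map (im φ)).toFinset := by
      intro b hb
      rw [List.mem_toFinset, List.mem_map]
      by_contra hc2
      exact hc ⟨b, hb, fun m hm e => hc2 ⟨m, hm, e.symm⟩⟩
    have h1 := Finset.card_le_card this
    have h2 := List.toFinset_card_le (st.B.map (im φ))
    rw [List.length_map] at h2; omega
  -- neighbours are outside
  have nbr : ∀ T ⊆ b, T.card = 3 → ∀ b' ∈ 𝓑, T ⊆ b' → Out φ st.B b' := by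
    intro T hT h3 b' hb' hTb' m hm e
    obtain ⟨t, ht, -⟩ := H.cov m hm b hb ho T hT h3 (e ▸ hTb')
    rw [hO] at ht; simp at ht
  -- four triples, pairwise not in a common other block
  obtain ⟨T, hT, hd⟩ : ∃ T : Fin 4 → Finset α, (∀ i, T i ⊆ b ∧ (T i).card = 3 ∧ Good 𝓑 (T i) b) ∧
      ∀ i j, i ≠ j → ∀ c ∈ 𝓑, T i ⊆ c → T j ⊆ c → c = b := by
    rcases H.types b hb ho with ⟨U, A, hU, hA, hd, hUA, eU, eA, hG⟩ | ⟨b4, bE, bG⟩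
    · obtain ⟨u, v, huv, rfl⟩ := Finset.card_eq_two.mp hU
      obtain ⟨x, y, z, hxy, hxz, hyz, rfl⟩ := Finset.card_eq_three.mp hA
      have g := fun {p q r : α} hp hq hr hqr => bip_good (x := p) (y := q) (z := r) hU hd hUA hG hp hq hr hqr
      have g1 := g (p := u) (q := x) (r := y) (by simp) (by simp) (by simp) hxy
      have g2 := g (p := u) (q := x) (r := z) (by simp) (by simp) (by simp) hxz
      have g3 := g (p := u) (q := y) (r := z) (by simp) (by simp) (by simp) hyz
      have g4 := g (p := v) (q := x) (r := y) (by simp) (by simp) (by simp) hxy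
      refine ⟨![{u, x, y}, {u, x, z}, {u, y, z}, {v, x, y}], ?_, ?_⟩
      · intro i; fin_cases i
        exacts [⟨g1.2.1, g1.1, g1.2.2⟩, ⟨g2.2.1, g2.1, g2.2.2⟩, ⟨g3.2.1, g3.1, g3.2.2⟩, ⟨g4.2.1, g4.1, g4.2.2⟩]
      · have k1 : ∀ c ∈ 𝓑, x ∈ c → y ∈ c → z ∈ c → c = b := fun c hc h1 h2 h3 => eA c hc (by
          intro w hw; simp only [Finset.mem_insert, Finset.mem_singleton] at hw
          rcases hw with rfl | rfl | rfl <;> assumption)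
        have k2 : ∀ c ∈ 𝓑, u ∈ c → v ∈ c → c = b := fun c hc h1 h2 => eU c hc (by
          intro w hw; simp only [Finset.mem_insert, Finset.mem_singleton] at hw
          rcases hw with rfl | rfl <;> assumption)
        intro i j hij c hc h1 h2
        fin_cases i <;> fin_cases j <;> first | exact absurd rfl hij | skip
        all_goals
          simp [Finset.insert_subset_iff] at h1 h2
          first
          | exact k2 c hc (by simp [h1, h2]) (by simp [h1, h2])
          | exact k1 c hc (by simp [h1, h2]) (by simp [h1, h2]) (by simp [h1, h2])
    · obtain ⟨e⟩ : Nonempty (Fin 4 ≃ b) := ⟨(Fintype.equivFinOfCardEq (by simpa using b4)).symm⟩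
      refine ⟨fun i => b.erase (e i), ?_, ?_⟩
      · intro i
        have h1 : b.erase (e i) ⊆ b := Finset.erase_subset _ _
        have h2 : (b.erase (e i)).card = 3 := by rw [Finset.card_erase_of_mem (e i).2, b4]
        exact ⟨h1, h2, bG _ h1 h2⟩
      · intro i j hij c hc h1 h2
        apply bE c hc
        intro x hx
        by_cases hxi : x = e i
        · apply h2; rw [Finset.mem_erase]; refine ⟨?_, hx⟩
          rw [hxi]; intro h; exact hij (e.injective (Subtype.ext h))
        · exact h1 (Finset.mem_erase.mpr ⟨hxi, hx⟩)
  choose b' hb' hne hsub _ using fun i => (hT i).2.2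
  have inj : Function.Injective b' := by
    intro i j e
    by_contra hij
    exact hne i (hd i j hij _ (hb' i) (hsub i) (e ▸ hsub j))
  have hc := H.cnt
  have : (insert b (Finset.univ.image b') : Finset (Finset α)).card = 5 := by
    rw [Finset.card_insert_of_notMem, Finset.card_image_of_injective _ inj]; simp
    intro h; obtain ⟨i, -, e⟩ := Finset.mem_image.mp h
    exact hne i e
  have le : ((insert b (Finset.univ.image b') : Finset (Finset α)) : Set (Finset α)).ncard ≤ Set.ncard {b | b ∈ 𝓑 ∧ Out φ st.B b} := by
    apply Set.ncard_le_ncard _ (𝓑.finite_toSet.subset (fun b hb => hb.1))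
    intro c hc
    rw [Finset.mem_coe, Finset.mem_insert, Finset.mem_image] at hc
    rcases hc with rfl | ⟨i, -, rfl⟩
    · exact ⟨hb, ho⟩
    · exact ⟨hb' i, nbr _ (hT i).1 (hT i).2.1 _ (hb' i) (hsub i)⟩
  rw [Set.ncard_coe_finset, this] at le
  omega

theorem nth_mem {β : Type} (l : List β) (d : β) (n : ℕ) : nth l d n = d ∨ nth l d n ∈ l := by
  induction l generalizing n with
  | nil => left; rfl
  | cons x l ih =>
    cases n with
    | zero => right; exact List.mem_cons_self
    | succ m => 
      have : nth (x :: l) d (m+1) = nth l d m := rfl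
      rw [this]
      rcases ih m with h | h
      exacts [Or.inl h, Or.inr (List.mem_cons_of_mem _ h)]
theorem nth_mem' {β : Type} (l : List β) (d : β) (n : ℕ) (h : n < l.length) : nth l d n ∈ l := by
  induction l generalizing n with
  | nil => simp at h
  | cons x l ih =>
    cases n with
    | zero => exact List.mem_cons_self
    | succ m => 
      have : nth (x :: l) d (m+1) = nth l d m := rfl
      rw [this]
      exact List.mem_cons_of_mem _ (ih m (by simpa using h))

noncomputable def goL (ih : ℕ → List St → St → (ℕ → List St → Bool) → Bool) (st : St) (t : ℕ) (z : ℕ → List St → Bool)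
   (L : List Cd) : ℕ → List St → Bool :=
  @List.rec Cd (fun _ => ℕ → List St → Bool) z
            (fun c _ go s refs => child st t c fun st' => ih s refs st' go) L

theorem goL_sound {𝓑 : Finset (Finset α)} (ih : ℕ → List St → St → (ℕ → List St → Bool) → Bool)
    (hi : ∀ s refs st k, ih s refs st k = true → (∀ r ∈ refs, ¬ Sat 𝓑 r) → ¬ Sat 𝓑 st ∧
      ∃ s' refs', (∀ r ∈ refs', ¬ Sat 𝓑 r) ∧ k s' refs' = true) (st : St) (t : ℕ) (z : ℕ → List St → Bool)
    (L : List Cd) : ∀ s refs, goL ih st t z L s refs = true → (∀ r ∈ refs, ¬ Sat 𝓑 r) →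
      (∀ c ∈ L, ¬ Sat 𝓑 (childS st t c)) ∧ ∃ s' refs', (∀ r ∈ refs', ¬ Sat 𝓑 r) ∧ z s' refs' = true := by
  induction L with
  | nil => intro s refs h hr; exact ⟨by simp, s, refs, hr, h⟩
  | cons c L il =>
    intro s refs h hr
    have e : goL ih st t z (c :: L) s refs = child st t c fun st' => ih s refs st' (goL ih st t z L) := rfl
    rw [e, child_eq] at h
    obtain ⟨h1, s', refs', h2, h3⟩ := hi _ _ _ _ h hr
    obtain ⟨h4, h5⟩ := il s' refs' h3 h2
    refine ⟨?_, h5⟩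
    intro c' hc'
    rcases List.mem_cons.mp hc' with rfl | hc'
    exacts [h1, h4 c' hc']

theorem check_sound [Fintype α] (hα : Fintype.card α = 10) {𝓑 : Finset (Finset α)} (h12 : 𝓑.card = 12) (fuel : ℕ) :
    ∀ s refs st k, check fuel s refs st k = true → (∀ r ∈ refs, ¬ Sat 𝓑 r) → ¬ Sat 𝓑 st ∧
      ∃ s' refs', (∀ r ∈ refs', ¬ Sat 𝓑 r) ∧ k s' refs' = true := by
  induction fuel with
  | zero => intro s refs st k h; exact absurd h (by simp [check])
  | succ n ih =>
    intro s refs st k h hr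
    have e : check (n+1) s refs st k = 
      frc (Nat.mod s 128) fun d => frc (Nat.div s 128) fun s =>
      cnd (Nat.beq d 127)
        (frc (Nat.mod s 256) fun j => frc (Nat.mod (Nat.div s 256) 1099511627776) fun sg =>
          frc (Nat.div s 281474976710656) fun s' =>
          cnd (Nat.ble refs.length j) false
          (cnd (isoChk sg (nth refs st0 j) st) (k s' refs) false))
      (cnd (Nat.beq d 126)
        (cnd (Nat.ble 8 st.B.length) (cnd (Nat.ble st.B.length 11)
          (@List.rec ℕ (fun _ => Bool) (k s refs) (fun _ _ _ => false) st.O) false) false)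
        (frc (nth st.O 0 (Nat.mod d 64)) fun t =>
          cnd (Nat.beq t 0) false
          (goL (check n) st t (fun s refs => cnd (Nat.ble 64 d) (k s (st :: refs)) (k s refs)) (cands st t) s refs))) := rfl
    rw [e] at h
    clear e
    simp only [frc_eq] at h
    generalize Nat.mod s 128 = d at h
    generalize Nat.div s 128 = s at h
    simp only [cnd_eq] at h
    by_cases h1 : d.beq 127 = true
    · rw [if_pos h1] at h
      split_ifs at h with h2 h3
      refine ⟨iso_sound h3 (hr _ (nth_mem' _ _ _ ?_)), _, refs, hr, h⟩
      rw [Nat.ble_eq] at h2; omega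
    · rw [if_neg h1] at h
      by_cases h2 : d.beq 126 = true
      · rw [if_pos h2] at h
        split_ifs at h with h3 h4
        rw [Nat.ble_eq] at h3 h4
        cases hO : st.O with
        | nil =>
          rw [hO] at h
          exact ⟨closed_sound h12 hO h3 h4, s, refs, hr, h⟩
        | cons x l => rw [hO] at h; exact absurd h (by simp)
      · rw [if_neg h2] at h
        by_cases h3 : (nth st.O 0 (d.mod 64)).beq 0 = true
        · rw [if_pos h3] at h; exact absurd h (by simp)
        rw [if_neg h3] at h
        obtain ⟨h4, s', refs', h5, h6⟩ := goL_sound (check n) ih st _ _ _ s refs h hr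
        have ht : nth st.O 0 (d.mod 64) ∈ st.O := by
          rcases nth_mem st.O 0 (d.mod 64) with h | h
          · rw [h] at h3; simp at h3
          · exact h
        have ns : ¬ Sat 𝓑 st := by
          rintro ⟨φ, H⟩
          obtain ⟨c, hc, hs⟩ := cands_complete hα H ht
          exact h4 c hc hs
        refine ⟨ns, ?_⟩
        split_ifs at h6 with h7
        · refine ⟨s', st :: refs', ?_, h6⟩
          intro r hr'
          rcases List.mem_cons.mp hr' with rfl | hr'
          exacts [ns, h5 r hr']
        · exact ⟨s', refs', h5, h6⟩
end sem
end PS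

namespace PS
set_option linter.unusedSectionVars false
open Module
section geo
variable {E : Type} [AddCommGroup E] [Module ℝ E] [FiniteDimensional ℝ E]

def IsF (X A : Set E) : Prop := ∃ g : Dual ℝ E, (∀ x ∈ X, 0 ≤ g x) ∧ A = {x | x ∈ X ∧ g x = 0}
noncomputable def rk (A : Set E) : ℕ := finrank ℝ (Submodule.span ℝ A)

theorem IsF.sub {X A : Set E} (h : IsF X A) : A ⊆ X := by
  obtain ⟨g, -, rfl⟩ := h; exact fun x hx => hx.1

theorem IsF.inter {X A B : Set E} (hA : IsF X A) (hB : IsF X B) : IsF X (A ∩ B) := by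
  obtain ⟨g, hg, rfl⟩ := hA
  obtain ⟨k, hk, rfl⟩ := hB
  refine ⟨g + k, fun x hx => add_nonneg (hg x hx) (hk x hx), ?_⟩
  ext x; simp only [Set.mem_inter_iff, Set.mem_ofPred_eq, LinearMap.add_apply]
  constructor
  · rintro ⟨⟨h1, h2⟩, -, h3⟩; exact ⟨h1, by rw [h2, h3, add_zero]⟩
  · rintro ⟨h1, h2⟩
    have := hg x h1; have := hk x h1
    exact ⟨⟨h1, by linarith⟩, h1, by linarith⟩

theorem rk_mono {A B : Set E} (h : A ⊆ B) : rk A ≤ rk B := Submodule.finrank_mono (Submodule.span_mono h)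

theorem span_le_ker {A : Set E} {g : Dual ℝ E} (h : ∀ x ∈ A, g x = 0) : Submodule.span ℝ A ≤ LinearMap.ker g :=
  Submodule.span_le.mpr fun x hx => h x hx

theorem rk_lt {X A B : Set E} (hA : IsF X A) (hB : IsF X B) (h : A ⊆ B) (hne : A ≠ B) : rk A < rk B := by
  apply Submodule.finrank_lt_finrank_of_lt
  refine lt_of_le_of_ne (Submodule.span_mono h) fun e => ?_
  obtain ⟨g, hg, rfl⟩ := hA
  obtain ⟨x, hx, hxA⟩ := Set.exists_of_ssubset (h.ssubset_of_ne hne)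
  have : x ∈ Submodule.span ℝ {x | x ∈ X ∧ g x = 0} := e ▸ Submodule.subset_span hx
  exact hxA ⟨hB.sub hx, span_le_ker (fun y hy => hy.2) this⟩

theorem eq_of_rk {X A B : Set E} (hA : IsF X A) (hB : IsF X B) (h : A ⊆ B) (hr : rk B ≤ rk A) : A = B := by
  by_contra hne; have := rk_lt hA hB h hne; omega

theorem isF_univ (X : Set E) : IsF X X := ⟨0, by simp, by ext; simp⟩

theorem faces_finite {X : Set E} (hX : X.Finite) : {A | IsF X A}.Finite :=
  hX.finite_subsets.subset fun _ hA => hA.sub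

/-- functional vanishing on `A` separating a vector from the span, inside the span of `B` -/
theorem exists_dual {p : Submodule ℝ E} {y : E} (hy : y ∉ p) : ∃ g : Dual ℝ E, g y = 1 ∧ ∀ x ∈ p, g x = 0 := by
  obtain ⟨f, hf, hp⟩ := Submodule.exists_dual_map_eq_bot_of_notMem hy inferInstance
  refine ⟨(f y)⁻¹ • f, by simp [hf], fun x hx => ?_⟩
  have : f x ∈ p.map f := Submodule.mem_map_of_mem hx
  rw [hp, Submodule.mem_bot] at this
  simp [this]

/-- rotation: `gA ≥ 0` on `X`, `m` vanishing where `gA` does (within `B`), maximum of the ratio -/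
theorem rotate {X A B : Set E} (hX : X.Finite) {g gB m : Dual ℝ E} (hA : A = {x | x ∈ X ∧ g x = 0})
    (hg : ∀ x ∈ X, 0 ≤ g x) (hB : B = {x | x ∈ X ∧ gB x = 0}) (hgB : ∀ x ∈ X, 0 ≤ gB x) (hAB : A ⊆ B)
    (hne : A ≠ B) (hm : ∀ x ∈ A, m x = 0) :
    ∃ ρ : ℝ, ∃ y ∈ B, y ∉ A ∧ m y = ρ * g y ∧ (∀ x ∈ B, m x ≤ ρ * g x) ∧
      IsF X {x | x ∈ B ∧ m x = ρ * g x} := by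
  obtain ⟨y0, hy0, hy0A⟩ := Set.exists_of_ssubset (hAB.ssubset_of_ne hne)
  have BX : B ⊆ X := by rw [hB]; exact fun x hx => hx.1
  have fin : (B \ A).Finite := (hX.subset BX).subset Set.sdiff_subset
  have pos : ∀ x ∈ B \ A, 0 < g x := by
    intro x hx
    refine lt_of_le_of_ne (hg x (BX hx.1)) fun e => hx.2 ?_
    rw [hA]; exact ⟨BX hx.1, e.symm⟩
  obtain ⟨y, hy, hmax⟩ := Set.exists_max_image (B \ A) (fun x => m x / g x) fin ⟨y0, hy0, hy0A⟩
  have gz : ∀ x ∈ A, g x = 0 := fun x hx => by rw [hA] at hx; exact hx.2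
  have hle : ∀ x ∈ B, m x ≤ m y / g y * g x := by
    intro x hx
    by_cases hxA : x ∈ A
    · rw [hm x hxA, gz x hxA]; simp
    · have := hmax x ⟨hx, hxA⟩
      rwa [div_le_iff₀ (pos x ⟨hx, hxA⟩)] at this
  refine ⟨m y / g y, y, hy.1, hy.2, by field_simp [(pos y hy).ne'], hle, ?_⟩
  set ρ := m y / g y
  -- add a large multiple of gB
  have finX : (X \ B).Finite := hX.subset Set.sdiff_subset
  have posB : ∀ x ∈ X \ B, 0 < gB x := by
    intro x hx
    refine lt_of_le_of_ne (hgB x hx.1) fun e => hx.2 ?_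
    rw [hB]; exact ⟨hx.1, e.symm⟩
  obtain ⟨N, hN⟩ : ∃ N : ℝ, ∀ x ∈ X \ B, 0 < (ρ * g x - m x) + N * gB x := by
    obtain ⟨N, hN⟩ := (finX.image (fun x => (m x - ρ * g x) / gB x)).bddAbove
    refine ⟨N + 1, fun x hx => ?_⟩
    have h1 := hN (Set.mem_image_of_mem _ hx)
    have hp := posB x hx
    rw [div_le_iff₀ hp] at h1
    nlinarith
  have zB : ∀ x ∈ B, gB x = 0 := fun x hx => by rw [hB] at hx; exact hx.2
  refine ⟨ρ • g - m + N • gB, ?_, ?_⟩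
  · intro x hx
    simp only [LinearMap.add_apply, LinearMap.sub_apply, LinearMap.smul_apply, smul_eq_mul]
    by_cases hxB : x ∈ B
    · rw [zB x hxB]; have := hle x hxB; linarith
    · exact (hN x ⟨hx, hxB⟩).le
  · ext x
    simp only [Set.mem_ofPred_eq, LinearMap.add_apply, LinearMap.sub_apply, LinearMap.smul_apply, smul_eq_mul]
    constructor
    · rintro ⟨h1, h2⟩; exact ⟨BX h1, by rw [zB x h1, h2]; ring⟩
    · rintro ⟨h1, h2⟩
      by_cases hxB : x ∈ B
      · refine ⟨hxB, ?_⟩; rw [zB x hxB] at h2; linarith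
      · exact absurd h2 (hN x ⟨h1, hxB⟩).ne'

theorem diamond {X A B : Set E} (hX : X.Finite) (hA : IsF X A) (hB : IsF X B) (hAB : A ⊆ B) (hr : rk B = rk A + 2) :
    ∃ C D, C ≠ D ∧ (IsF X C ∧ rk C = rk A + 1 ∧ A ⊆ C ∧ C ⊆ B) ∧ (IsF X D ∧ rk D = rk A + 1 ∧ A ⊆ D ∧ D ⊆ B) ∧
      ∀ F, IsF X F → rk F = rk A + 1 → A ⊆ F → F ⊆ B → F = C ∨ F = D := by
  have hA0 := hA
  have hB0 := hB
  obtain ⟨g, hg, eA⟩ := hA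
  obtain ⟨gB, hgB, eB⟩ := hB
  have hne : A ≠ B := fun e => by rw [e] at hr; omega
  obtain ⟨y0, hy0, hy0A⟩ := Set.exists_of_ssubset (hAB.ssubset_of_ne hne)
  have BX := hB0.sub
  have gz : ∀ x ∈ A, g x = 0 := fun x hx => by rw [eA] at hx; exact hx.2
  have gy0 : g y0 ≠ 0 := fun e => hy0A (by rw [eA]; exact ⟨BX hy0, e⟩)
  -- p = span A + y0, of rank rk A + 1
  have hp : finrank ℝ ↥(Submodule.span ℝ A ⊔ Submodule.span ℝ {y0}) ≤ rk A + 1 := by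
    refine (Submodule.finrank_add_le_finrank_add_finrank _ _).trans ?_
    have := finrank_span_le_card (R := ℝ) ({y0} : Set E)
    simp at this
    unfold rk; omega
  obtain ⟨y1, hy1, hy1p⟩ : ∃ y1 ∈ B, y1 ∉ Submodule.span ℝ A ⊔ Submodule.span ℝ {y0} := by
    by_contra hc
    push Not at hc
    have : rk B ≤ _ := Submodule.finrank_mono (Submodule.span_le.mpr hc)
    omega
  obtain ⟨m, hmy, hmz⟩ := exists_dual hy1p
  have hmA : ∀ x ∈ A, m x = 0 := fun x hx => hmz x (Submodule.mem_sup_left (Submodule.subset_span hx))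
  have hm0 : m y0 = 0 := hmz y0 (Submodule.mem_sup_right (Submodule.mem_span_singleton_self y0))
  -- span B = span A + y0 + y1
  have hspan : Submodule.span ℝ B ≤ Submodule.span ℝ A ⊔ Submodule.span ℝ {y0} ⊔ Submodule.span ℝ {y1} := by
    have le : Submodule.span ℝ A ⊔ Submodule.span ℝ {y0} ⊔ Submodule.span ℝ {y1} ≤ Submodule.span ℝ B := by
      refine sup_le (sup_le (Submodule.span_mono hAB) ?_) ?_ <;> rw [Submodule.span_singleton_le_iff_mem]
      exacts [Submodule.subset_span hy0, Submodule.subset_span hy1]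
    refine (Submodule.eq_of_le_of_finrank_le le ?_).ge
    have l1 : Submodule.span ℝ A < Submodule.span ℝ A ⊔ Submodule.span ℝ {y0} := by
      refine lt_of_le_of_ne le_sup_left fun e => ?_
      have : y0 ∈ Submodule.span ℝ A := by
        rw [e]; exact Submodule.mem_sup_right (Submodule.mem_span_singleton_self y0)
      exact gy0 (span_le_ker gz this)
    have l2 : Submodule.span ℝ A ⊔ Submodule.span ℝ {y0} < Submodule.span ℝ A ⊔ Submodule.span ℝ {y0} ⊔ Submodule.span ℝ {y1} := by
      refine lt_of_le_of_ne le_sup_left fun e => hy1p ?_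
      rw [e]; exact Submodule.mem_sup_right (Submodule.mem_span_singleton_self y1)
    have h1 := Submodule.finrank_lt_finrank_of_lt l1
    have h2 := Submodule.finrank_lt_finrank_of_lt l2
    unfold rk at hr; omega
  -- every functional vanishing on A is a combination on B
  have comb : ∀ f : Dual ℝ E, (∀ x ∈ A, f x = 0) → ∃ p q : ℝ, ∀ x ∈ B, f x = p * g x + q * m x := by
    intro f hf
    refine ⟨f y0 / g y0, f y1 - f y0 / g y0 * g y1, fun x hx => ?_⟩
    have : ∀ z ∈ Submodule.span ℝ A ⊔ Submodule.span ℝ {y0} ⊔ Submodule.span ℝ {y1},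
      z ∈ LinearMap.ker (f - (f y0 / g y0) • g - (f y1 - f y0 / g y0 * g y1) • m) := by
      intro z hz
      refine (sup_le (sup_le ?_ ?_) ?_ : _ ≤ LinearMap.ker _) hz
      · refine span_le_ker fun x hx => ?_
        simp [hf x hx, gz x hx, hmA x hx]
      · rw [Submodule.span_singleton_le_iff_mem, LinearMap.mem_ker]
        simp [hm0]; field_simp; ring
      · rw [Submodule.span_singleton_le_iff_mem, LinearMap.mem_ker]
        simp [hmy]
    have := this x (hspan (Submodule.subset_span hx))
    rw [LinearMap.mem_ker] at this
    simp only [LinearMap.sub_apply, LinearMap.smul_apply, smul_eq_mul] at this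
    linarith
  obtain ⟨ρ, y, hy, hyA, hye, hle, hF⟩ := rotate hX eA hg eB hgB hAB hne hmA
  obtain ⟨τ, z, hz, hzA, hze, hge, hF2⟩ := rotate (m := -m) hX eA hg eB hgB hAB hne (by intro x hx; simp [hmA x hx])
  simp only [LinearMap.neg_apply] at hze hge hF2
  have gpos : ∀ x ∈ B, x ∉ A → 0 < g x := by
    intro x hx hxA
    exact lt_of_le_of_ne (hg x (BX hx)) fun e => hxA (by rw [eA]; exact ⟨BX hx, e.symm⟩)
  -- ρ > -τ
  have lt : 0 < ρ + τ := by
    have h1 := hle y0 hy0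
    have h2 := hge y0 hy0
    have h3 := gpos y0 hy0 hy0A
    rw [hm0] at h1 h2
    have r0 : 0 ≤ ρ := by by_contra hc; push Not at hc; nlinarith
    have t0 : 0 ≤ τ := by by_contra hc; push Not at hc; nlinarith
    have h4 := hle y1 hy1
    have h5 : 0 ≤ g y1 := hg _ (BX hy1)
    rw [hmy] at h4
    rcases r0.eq_or_lt with h | h
    · rw [← h] at h4; linarith
    · linarith
  have mk : ∀ (C : Set E) (y : E), IsF X C → A ⊆ C → C ⊆ B → y ∈ C → y ∉ A → C ≠ B → IsF X C ∧ rk C = rk A + 1 ∧ A ⊆ C ∧ C ⊆ B := by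
    intro C y hC h1 h2 hy hyA hne
    have l1 := rk_lt hA0 hC h1 (fun e => hyA (e ▸ hy))
    have l2 := rk_lt hC hB0 h2 hne
    exact ⟨hC, by omega, h1, h2⟩
  have zC : z ∉ {x | x ∈ B ∧ m x = ρ * g x} := by
    rintro ⟨-, h⟩
    have := gpos z hz hzA
    nlinarith
  have yD : y ∉ {x | x ∈ B ∧ -m x = τ * g x} := by
    rintro ⟨-, h⟩
    have := gpos y hy hyA
    nlinarith
  refine ⟨{x | x ∈ B ∧ m x = ρ * g x}, {x | x ∈ B ∧ -m x = τ * g x}, ?_, ?_, ?_, ?_⟩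
  · intro e; rw [e] at zC; exact zC ⟨hz, hze⟩
  · refine mk _ y hF (fun x hx => ⟨hAB hx, by simp [hmA x hx, gz x hx]⟩) (fun x hx => hx.1) ⟨hy, hye⟩ hyA (fun e => zC (e.symm.subset hz))
  · refine mk _ z hF2 (fun x hx => ⟨hAB hx, by simp [hmA x hx, gz x hx]⟩) (fun x hx => hx.1) ⟨hz, hze⟩ hzA (fun e => yD (e.symm.subset hy))
  · intro F hF hrF hAF hFB
    have FA : A ≠ F := fun e => by rw [e] at hrF; omega
    have FB : F ≠ B := fun e => by rw [e] at hrF; omega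
    obtain ⟨f, hf, eF⟩ := hF
    have fz : ∀ x ∈ A, f x = 0 := fun x hx => by have := hAF hx; rw [eF] at this; exact this.2
    obtain ⟨p, q, hpq⟩ := comb f fz
    have mem : ∀ x ∈ B, x ∈ F ↔ p * g x + q * m x = 0 := by
      intro x hx; rw [← hpq x hx]
      constructor
      · intro h; rw [eF] at h; exact h.2
      · intro h; rw [eF]; exact ⟨BX hx, h⟩
    obtain ⟨s, hs, hsA⟩ := Set.exists_of_ssubset (hAF.ssubset_of_ne FA)
    obtain ⟨s', hs', hsF'⟩ := Set.exists_of_ssubset (hFB.ssubset_of_ne FB)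
    have es := (mem s (hFB hs)).mp hs
    have gs := gpos s (hFB hs) hsA
    have nn : ∀ x ∈ B, 0 ≤ p * g x + q * m x := fun x hx => by rw [← hpq x hx]; exact hf x (BX hx)
    have ny := nn y hy
    have nz := nn z hz
    have gy := gpos y hy hyA
    have gz' := gpos z hz hzA
    have q0 : q ≠ 0 := by
      rintro rfl
      have p0 : p = 0 := by
        rcases mul_eq_zero.mp (by linarith : p * g s = 0) with h | h
        · exact h
        · exact absurd h gs.ne'
      exact hsF' ((mem s' hs').mpr (by rw [p0]; ring))
    have ls := hle s (hFB hs)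
    have ms := hge s (hFB hs)
    -- p = - q * σ with σ = m s / g s
    rw [hye] at ny
    have hmz' : m z = -(τ * g z) := by linarith
    rw [hmz'] at nz
    have ny' : 0 ≤ p + q * ρ := by
      by_contra hc; push Not at hc; nlinarith
    have nz' : 0 ≤ p - q * τ := by
      by_contra hc; push Not at hc; nlinarith
    rcases lt_or_gt_of_ne q0 with hq | hq
    · left
      have : p + q * ρ = 0 := by
        refine le_antisymm ?_ ny'
        by_contra hc; push Not at hc
        nlinarith [mul_nonneg_of_nonpos_of_nonpos hq.le (sub_nonpos.mpr ls), mul_pos hc gs]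
      ext x
      constructor
      · intro hx
        refine ⟨hFB hx, ?_⟩
        have := (mem x (hFB hx)).mp hx
        have e : q * (m x - ρ * g x) = 0 := by linear_combination this - g x * ‹p + q * ρ = 0›
        rcases mul_eq_zero.mp e with h | h
        · exact absurd h q0
        · linarith
      · rintro ⟨hx, he⟩
        rw [mem x hx, he]; linear_combination g x * this
    · right
      have : p - q * τ = 0 := by
        refine le_antisymm ?_ nz'
        by_contra hc; push Not at hc
        nlinarith [mul_nonneg hq.le (sub_nonneg.mpr ms), mul_pos hc gs]
      ext x
      constructor
      · intro hx
        refine ⟨hFB hx, ?_⟩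
        have := (mem x (hFB hx)).mp hx
        have e : q * (m x + τ * g x) = 0 := by linear_combination this - g x * ‹p - q * τ = 0›
        rcases mul_eq_zero.mp e with h | h
        · exact absurd h q0
        · linarith
      · rintro ⟨hx, he⟩
        have : m x = -(τ * g x) := by linarith
        rw [mem x hx, this]; linear_combination g x * ‹p - q * τ = 0›

/-- every face avoiding a point lies in a facet avoiding it -/
theorem coatom {X : Set E} (hX : X.Finite) (htop : Submodule.span ℝ X = ⊤) {d : ℕ} (hd : finrank ℝ E = d + 1)
    {A : Set E} (hA : IsF X A) {x : E} (hx : x ∈ X) (hxA : x ∉ A) :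
    ∃ F, IsF X F ∧ rk F = d ∧ A ⊆ F ∧ x ∉ F := by
  obtain ⟨B, ⟨hB, hAB, hxB⟩, hmax⟩ := Set.exists_max_image {B | IsF X B ∧ A ⊆ B ∧ x ∉ B} rk
    ((faces_finite hX).subset fun B hB => hB.1) ⟨A, hA, subset_rfl, hxA⟩
  refine ⟨B, hB, ?_, hAB, hxB⟩
  have rX : rk X = d + 1 := by unfold rk; rw [htop, finrank_top, hd]
  have hne : B ≠ X := fun e => hxB (e ▸ hx)
  have lt := rk_lt hB (isF_univ X) hB.sub hne
  by_contra hr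
  have hr : rk B + 2 ≤ d + 1 := by omega
  have hB0 := hB
  obtain ⟨g, hg, eB⟩ := hB
  have hp : finrank ℝ ↥(Submodule.span ℝ B ⊔ Submodule.span ℝ {x}) ≤ rk B + 1 := by
    refine (Submodule.finrank_add_le_finrank_add_finrank _ _).trans ?_
    have := finrank_span_le_card (R := ℝ) ({x} : Set E)
    simp at this
    unfold rk; omega
  obtain ⟨y1, hy1, hy1p⟩ : ∃ y1 ∈ X, y1 ∉ Submodule.span ℝ B ⊔ Submodule.span ℝ {x} := by
    by_contra hc
    push Not at hc
    have : rk X ≤ _ := Submodule.finrank_mono (Submodule.span_le.mpr hc)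
    omega
  obtain ⟨m, hmy, hmz⟩ := exists_dual hy1p
  have hmA : ∀ x ∈ B, m x = 0 := fun x hx => hmz x (Submodule.mem_sup_left (Submodule.subset_span hx))
  have hm0 : m x = 0 := hmz x (Submodule.mem_sup_right (Submodule.mem_span_singleton_self x))
  obtain ⟨ρ, y, hy, hyA, hye, hle, hF⟩ := rotate hX eB hg (B := X) (gB := 0) (by ext; simp) (by simp) hB0.sub hne hmA
  have gpos : 0 < g x := lt_of_le_of_ne (hg x hx) fun e => hxB (by rw [eB]; exact ⟨hx, e.symm⟩)
  have hρ : 0 < ρ := by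
    have h1 := hle y1 hy1
    rw [hmy] at h1
    have := hg y1 hy1
    by_contra hc; push Not at hc; nlinarith
  have gz : ∀ x ∈ B, g x = 0 := fun x hx => by rw [eB] at hx; exact hx.2
  have sub : B ⊆ {x | x ∈ X ∧ m x = ρ * g x} := fun z hz => ⟨hB0.sub hz, by simp [hmA z hz, gz z hz]⟩
  have := hmax _ ⟨hF, hAB.trans sub, fun h => by
    have := h.2; rw [hm0] at this; have := mul_pos hρ gpos; linarith⟩
  have l := rk_lt hB0 hF sub (fun e => hyA (e ▸ ⟨hy, hye⟩))
  omega
end geo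
end PS

namespace PS
set_option linter.unusedSectionVars false
open Module
structure Conf (E W Ed I : Type) [AddCommGroup E] [Module ℝ E] where
  pt : W → E
  a : I → Dual ℝ E
  o : E
  ein : Ed → I → Prop
  inc : W → Ed → Prop
  adj : I → I → Prop
  nn : ∀ i w, 0 ≤ a i (pt w)
  ao : ∀ i, a i o = 1
  ainj : Function.Injective a
  asymm : ∀ i j, adj i j → adj j i
  airr : ∀ i, ¬ adj i i
  mono : ∀ w e i, inc w e → ein e i → a i (pt w) = 0
  ends : ∀ e, ∃ w w', w ≠ w' ∧ ∀ u, inc u e ↔ u = w ∨ u = w'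
  twoE : ∀ w i j, adj i j → a i (pt w) = 0 → a j (pt w) = 0 →
    ∃ e e', e ≠ e' ∧ ∀ f, (inc w f ∧ ein f i ∧ ein f j) ↔ f = e ∨ f = e'
  twoN : ∀ e i, ein e i → ∃ j k, j ≠ k ∧ ∀ l, (ein e l ∧ adj i l) ↔ l = j ∨ l = k
  tri : ∀ w w' i j k, w ≠ w' → i ≠ j → i ≠ k → j ≠ k → a i (pt w) = 0 → a j (pt w) = 0 → a k (pt w) = 0 →
    a i (pt w') = 0 → a j (pt w') = 0 → a k (pt w') = 0 → ∃ e, inc w e ∧ inc w' e ∧ ein e i ∧ ein e j ∧ ein e k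
  e3 : ∀ e f i j k, i ≠ j → i ≠ k → j ≠ k → ein e i → ein e j → ein e k → ein f i → ein f j → ein f k → e = f
  non : ∀ w w' i j, w ≠ w' → i ≠ j → ¬ adj i j → a i (pt w) = 0 → a j (pt w) = 0 →
    a i (pt w') = 0 → a j (pt w') = 0 → ∃ e, inc w e ∧ inc w' e ∧ ein e i ∧ ein e j
  e2 : ∀ e f i j, i ≠ j → ¬ adj i j → ein e i → ein e j → ein f i → ein f j → e = f
  einj : ∀ e f w w', w ≠ w' → inc w e → inc w' e → inc w f → inc w' f → e = f
  incomp : ∀ w w', w ≠ w' → ∃ i, a i (pt w) = 0 ∧ a i (pt w') ≠ 0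
  ene : ∀ e, ∃ i, ein e i
  vtwo : ∀ w, ∃ i j, i ≠ j ∧ a i (pt w) = 0 ∧ a j (pt w) = 0

theorem dep6 {E : Type} [AddCommGroup E] [Module ℝ E] [FiniteDimensional ℝ E] (hd : finrank ℝ E = 5) (v0 v1 v2 v3 v4 v5 : E) :
    ∃ c0 c1 c2 c3 c4 c5 : ℝ, (∀ f : Dual ℝ E, c0 * f v0 + c1 * f v1 + c2 * f v2 + c3 * f v3 + c4 * f v4 + c5 * f v5 = 0) ∧
      ¬ (c0 = 0 ∧ c1 = 0 ∧ c2 = 0 ∧ c3 = 0 ∧ c4 = 0 ∧ c5 = 0) := by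
  have h : ¬ LinearIndependent ℝ ![v0, v1, v2, v3, v4, v5] := by
    intro h
    have := h.fintype_card_le_finrank
    simp [hd] at this
  rw [Fintype.not_linearIndependent_iff] at h
  obtain ⟨g, hg, i, hi⟩ := h
  refine ⟨g 0, g 1, g 2, g 3, g 4, g 5, fun f => ?_, ?_⟩
  · have := congrArg f hg
    simpa [Fin.sum_univ_succ, Fin.sum_univ_zero, ← add_assoc] using this
  · rintro ⟨h0, h1, h2, h3, h4, h5⟩
    fin_cases i <;> simp_all

namespace Conf
variable {E W Ed I : Type} [AddCommGroup E] [Module ℝ E] (C : Conf E W Ed I)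
def vin (w : W) (i : I) : Prop := C.a i (C.pt w) = 0

theorem other {w : W} {e : Ed} (h : C.inc w e) : ∃ w', w' ≠ w ∧ C.inc w' e := by
  obtain ⟨u, u', hne, hu⟩ := C.ends e
  rcases (hu w).mp h with rfl | rfl
  · exact ⟨u', hne.symm, (hu u').mpr (Or.inr rfl)⟩
  · exact ⟨u, hne, (hu u).mpr (Or.inl rfl)⟩

theorem anz {w : W} {i : I} (h : ¬ C.vin w i) : 0 < C.a i (C.pt w) := lt_of_le_of_ne (C.nn i w) (Ne.symm h)

/-- a vertex of the ridge off the edge -/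
theorem off {w : W} {e : Ed} {i u : I} (hw : C.inc w e) (hi : C.ein e i) (hu : C.ein e u) (ha : C.adj i u) :
    ∃ v, v ≠ w ∧ C.vin v i ∧ C.vin v u ∧ ¬ C.inc v e := by
  obtain ⟨f, f', hne, hf⟩ := C.twoE w i u ha (C.mono w e i hw hi) (C.mono w e u hw hu)
  obtain ⟨g, hg, hge⟩ : ∃ g, (C.inc w g ∧ C.ein g i ∧ C.ein g u) ∧ g ≠ e := by
    by_cases h : f = e
    · exact ⟨f', (hf f').mpr (Or.inr rfl), fun h' => hne (h.trans h'.symm)⟩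
    · exact ⟨f, (hf f).mpr (Or.inl rfl), h⟩
  obtain ⟨v, hv, hvg⟩ := C.other hg.1
  exact ⟨v, hv, C.mono v g i hvg hg.2.1, C.mono v g u hvg hg.2.2, fun h => hge (C.einj g e v w hv hvg hg.1 h hw)⟩

theorem inc_of {w v : W} {e : Ed} {i j k : I} (hne : v ≠ w) (ij : i ≠ j) (ik : i ≠ k) (jk : j ≠ k) (hw : C.inc w e)
    (hi : C.ein e i) (hj : C.ein e j) (hk : C.ein e k) (vi : C.vin v i) (vj : C.vin v j) (vk : C.vin v k) : C.inc v e := by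
  obtain ⟨f, h1, h2, h3, h4, h5⟩ := C.tri v w i j k hne ij ik jk vi vj vk (C.mono w e i hw hi) (C.mono w e j hw hj) (C.mono w e k hw hk)
  rwa [C.e3 e f i j k ij ik jk hi hj hk h3 h4 h5]

variable [FiniteDimensional ℝ E]

theorem unimod (hd : finrank ℝ E = 5) {x : E} {w : W} {e : Ed} {i u1 u2 j : I} (hw : C.inc w e) (hi : C.ein e i)
    (h1 : C.ein e u1) (h2 : C.ein e u2) (h12 : u1 ≠ u2) (a1 : C.adj i u1) (a2 : C.adj i u2)
    (H1 : C.a i x < C.a u1 x) (H2 : C.a i x < C.a u2 x) (hj : C.ein e j) : C.a i x ≤ C.a j x := by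
  have n1 : i ≠ u1 := fun h => C.airr i (by rw [← h] at a1; exact a1)
  have n2 : i ≠ u2 := fun h => C.airr i (by rw [← h] at a2; exact a2)
  obtain ⟨w', hw', hwe'⟩ := C.other hw
  obtain ⟨v1, hv1, v1i, v1u, v1e⟩ := C.off hw hi h1 a1
  obtain ⟨v2, hv2, v2i, v2u, v2e⟩ := C.off hw hi h2 a2
  have p1 : 0 < C.a u2 (C.pt v1) := C.anz fun h => v1e (C.inc_of hv1 n1 n2 h12 hw hi h1 h2 v1i v1u h)
  have p2 : 0 < C.a u1 (C.pt v2) := C.anz fun h => v2e (C.inc_of hv2 n1 n2 h12 hw hi h1 h2 v2i h v2u)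
  obtain ⟨c0, c1, c2, c3, c4, c5, hc, hnz⟩ := dep6 hd (C.pt w) (C.pt w') (C.pt v1) (C.pt v2) C.o x
  have ei := hc (C.a i)
  have e1 := hc (C.a u1)
  have e2 := hc (C.a u2)
  have ej := hc (C.a j)
  rw [C.ao] at ei e1 e2 ej
  unfold vin at v1i v1u v2i v2u
  rw [C.mono w e i hw hi, C.mono w' e i hwe' hi, v1i, v2i] at ei
  rw [C.mono w e _ hw h1, C.mono w' e _ hwe' h1, v1u] at e1
  rw [C.mono w e _ hw h2, C.mono w' e _ hwe' h2, v2u] at e2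
  rw [C.mono w e _ hw hj, C.mono w' e _ hwe' hj] at ej
  have q1 := C.nn j v1
  have q2 := C.nn j v2
  by_cases h5 : c5 = 0
  · exfalso
    subst h5
    have h4 : c4 = 0 := by linarith
    subst h4
    have h3 : c3 = 0 := by
      rcases mul_eq_zero.mp (by linarith : c3 * C.a u1 (C.pt v2) = 0) with h | h
      · exact h
      · exact absurd h p2.ne'
    have h2 : c2 = 0 := by
      rcases mul_eq_zero.mp (by linarith : c2 * C.a u2 (C.pt v1) = 0) with h | h
      · exact h
      · exact absurd h p1.ne'
    subst h3 h2
    obtain ⟨k, k1, k2⟩ := C.incomp w w' hw'.symm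
    obtain ⟨l, l1, l2⟩ := C.incomp w' w hw'
    have ek := hc (C.a k)
    have el := hc (C.a l)
    rw [k1] at ek; rw [l1] at el
    have : c1 = 0 := by
      rcases mul_eq_zero.mp (by linarith : c1 * C.a k (C.pt w') = 0) with h | h
      · exact h
      · exact absurd h k2
    have : c0 = 0 := by
      rcases mul_eq_zero.mp (by linarith : c0 * C.a l (C.pt w) = 0) with h | h
      · exact h
      · exact absurd h l2
    simp_all
  · have f3 : c3 = - c5 * (C.a u1 x - C.a i x) / C.a u1 (C.pt v2) := by
      field_simp; linarith
    have f2 : c2 = - c5 * (C.a u2 x - C.a i x) / C.a u2 (C.pt v1) := by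
      field_simp; linarith
    have : c5 * (C.a j x - C.a i x) = c5 * ((C.a u2 x - C.a i x) / C.a u2 (C.pt v1) * C.a j (C.pt v1) +
        (C.a u1 x - C.a i x) / C.a u1 (C.pt v2) * C.a j (C.pt v2)) := by
      have : c5 * (C.a j x - C.a i x) = - c2 * C.a j (C.pt v1) - c3 * C.a j (C.pt v2) := by linarith
      rw [this, f3, f2]; field_simp; ring
    have := mul_left_cancel₀ h5 this
    have s1 : 0 ≤ (C.a u2 x - C.a i x) / C.a u2 (C.pt v1) * C.a j (C.pt v1) :=
      mul_nonneg (div_nonneg (by linarith) p1.le) q1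
    have s2 : 0 ≤ (C.a u1 x - C.a i x) / C.a u1 (C.pt v2) * C.a j (C.pt v2) :=
      mul_nonneg (div_nonneg (by linarith) p2.le) q2
    linarith

theorem mat3 {a b c d e f x y z : ℝ} (ha : 0 < a) (hb : 0 < b) (hc : 0 < c) (hd : 0 < d) (he : 0 < e) (hf : 0 < f)
    (h1 : y * a + z * b = 0) (h2 : x * c + z * d = 0) (h3 : x * e + y * f = 0) : x = 0 ∧ y = 0 ∧ z = 0 := by
  have hz : z * (d * e * a + c * f * b) = 0 := by linear_combination - a * c * h3 + f * c * h1 + a * e * h2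
  have z0 : z = 0 := by
    rcases mul_eq_zero.mp hz with h | h
    · exact h
    · exfalso; have : 0 < d * e * a + c * f * b := by positivity
      linarith
  subst z0
  have : y = 0 := by
    rcases mul_eq_zero.mp (by linarith : y * a = 0) with h | h
    · exact h
    · exact absurd h ha.ne'
  have : x = 0 := by
    rcases mul_eq_zero.mp (by linarith : x * c = 0) with h | h
    · exact h
    · exact absurd h hc.ne'
  simp_all

def Mixed (x : E) (w : W) (i : I) (e : Ed) : Prop := C.inc w e ∧ C.ein e i ∧
  ∃ u l, C.ein e u ∧ C.ein e l ∧ C.a i x < C.a u x ∧ C.a l x < C.a i x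

theorem mixed3 (hd : finrank ℝ E = 5) {x : E} {w : W} {i : I} {e1 e2 e3 : Ed} (h1 : C.Mixed x w i e1) (h2 : C.Mixed x w i e2)
    (h3 : C.Mixed x w i e3) (n12 : e1 ≠ e2) (n13 : e1 ≠ e3) (n23 : e2 ≠ e3) : False := by
  have key : ∀ e, C.Mixed x w i e → ∃ w', w' ≠ w ∧ C.inc w' e ∧ ∃ d : Dual ℝ E, d C.o = 0 ∧ d x = 0 ∧ d (C.pt w) = 0 ∧ d (C.pt w') = 0 ∧
      ∀ f w'', C.inc w f → C.ein f i → w'' ≠ w → C.inc w'' f → f ≠ e → 0 < d (C.pt w'') := by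
    rintro e ⟨hw, hi, u, l, hu, hl, Hu, Hl⟩
    obtain ⟨w', hw', hwe'⟩ := C.other hw
    have iu : i ≠ u := by rintro rfl; exact lt_irrefl _ Hu
    have il : i ≠ l := by rintro rfl; exact lt_irrefl _ Hl
    have ul : u ≠ l := by rintro rfl; exact lt_asymm Hu Hl
    refine ⟨w', hw', hwe', (C.a i x - C.a l x) • (C.a u - C.a i) + (C.a u x - C.a i x) • (C.a l - C.a i), ?_, ?_, ?_, ?_, ?_⟩
    · simp [C.ao]
    · simp; ring
    · simp [C.mono w e _ hw hi, C.mono w e _ hw hu, C.mono w e _ hw hl]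
    · simp [C.mono w' e _ hwe' hi, C.mono w' e _ hwe' hu, C.mono w' e _ hwe' hl]
    · intro f w'' hwf hif hne hwf'' hfe
      simp only [LinearMap.add_apply, LinearMap.smul_apply, LinearMap.sub_apply, smul_eq_mul, C.mono w'' f _ hwf'' hif, sub_zero]
      have q1 := C.nn u w''
      have q2 := C.nn l w''
      have : ¬ (C.vin w'' u ∧ C.vin w'' l) := by
        rintro ⟨z1, z2⟩
        have := C.inc_of hne iu il ul hw hi hu hl (C.mono w'' f _ hwf'' hif) z1 z2
        exact hfe (C.einj f e w'' w hne hwf'' hwf this hw)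
      by_cases z1 : C.vin w'' u
      · have p : 0 < C.a l (C.pt w'') := C.anz fun z2 => this ⟨z1, z2⟩
        nlinarith [mul_pos (sub_pos.mpr Hu) p, mul_nonneg (sub_pos.mpr Hl).le q1]
      · have p := C.anz z1
        nlinarith [mul_pos (sub_pos.mpr Hl) p, mul_nonneg (sub_pos.mpr Hu).le q2]
  obtain ⟨w1, nw1, i1, d1, d1o, d1x, d1w, d11, p1⟩ := key e1 h1
  obtain ⟨w2, nw2, i2, d2, d2o, d2x, d2w, d22, p2⟩ := key e2 h2
  obtain ⟨w3, nw3, i3, d3, d3o, d3x, d3w, d33, p3⟩ := key e3 h3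
  obtain ⟨c0, c1, c2, c3, c4, c5, hc, hnz⟩ := dep6 hd C.o x (C.pt w) (C.pt w1) (C.pt w2) (C.pt w3)
  have g1 := hc d1; have g2 := hc d2; have g3 := hc d3
  rw [d1o, d1x, d1w, d11] at g1
  rw [d2o, d2x, d2w, d22] at g2
  rw [d3o, d3x, d3w, d33] at g3
  obtain ⟨z3, z4, z5⟩ := mat3 (p1 e2 w2 h2.1 h2.2.1 nw2 i2 n12.symm) (p1 e3 w3 h3.1 h3.2.1 nw3 i3 n13.symm)
    (p2 e1 w1 h1.1 h1.2.1 nw1 i1 n12) (p2 e3 w3 h3.1 h3.2.1 nw3 i3 n23.symm)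
    (p3 e1 w1 h1.1 h1.2.1 nw1 i1 n13) (p3 e2 w2 h2.1 h2.2.1 nw2 i2 n23) (x := c3) (y := c4) (z := c5)
    (by linarith) (by linarith) (by linarith)
  subst z3 z4 z5
  obtain ⟨hw, hi, u, l, hu, hl, Hu, Hl⟩ := h1
  have ei := hc (C.a i)
  have eu := hc (C.a u)
  rw [C.ao, C.mono w e1 _ hw hi] at ei
  rw [C.ao, C.mono w e1 _ hw hu] at eu
  have z1 : c1 = 0 := by
    rcases mul_eq_zero.mp (by linarith : c1 * (C.a u x - C.a i x) = 0) with h | h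
    · exact h
    · linarith
  subst z1
  obtain ⟨k, k1, k2⟩ := C.incomp w1 w nw1
  have ek := hc (C.a k)
  have z0 : c0 = 0 := by linarith
  subst z0
  rcases mul_eq_zero.mp (by linarith : c2 * C.a k (C.pt w) = 0) with h | h
  · simp_all
  · exact k2 h
end Conf
end PS

namespace PS
set_option linter.unusedSectionVars false
open Module
namespace Conf
open Finset
variable {E W Ed I : Type} [AddCommGroup E] [Module ℝ E] (C : Conf E W Ed I) [Fintype W] [Fintype Ed] [Fintype I]

open scoped Classical in
noncomputable def N (w : W) : Finset I := univ.filter fun i => C.vin w i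
open scoped Classical in
noncomputable def T (w : W) : Finset Ed := univ.filter fun e => C.inc w e
open scoped Classical in
noncomputable def K (e : Ed) : Finset I := univ.filter fun i => C.ein e i
open scoped Classical in
noncomputable def r2 (w : W) : ℕ := (univ.filter fun p : I × I => C.vin w p.1 ∧ C.vin w p.2 ∧ C.adj p.1 p.2).card

@[simp] theorem mem_N {w : W} {i : I} : i ∈ C.N w ↔ C.vin w i := by simp [N]
@[simp] theorem mem_T {w : W} {e : Ed} : e ∈ C.T w ↔ C.inc w e := by simp [T]
@[simp] theorem mem_K {e : Ed} {i : I} : i ∈ C.K e ↔ C.ein e i := by simp [K]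

variable [FiniteDimensional ℝ E]

theorem generic : ∃ x : E, ∀ i j, C.a i x = C.a j x → i = j := by
  obtain ⟨x, hx⟩ := Module.Dual.exists_forall_ne_zero_of_forall_exists
    (fun p : {p : I × I // p.1 ≠ p.2} => C.a p.1.1 - C.a p.1.2) (by
      rintro ⟨⟨i, j⟩, h⟩
      by_contra hc
      push Not at hc
      exact h (C.ainj (sub_eq_zero.mp (LinearMap.ext hc))))
  refine ⟨x, fun i j h => ?_⟩
  by_contra hne
  exact hx ⟨(i, j), hne⟩ (by simp [h])

open scoped Classical in
theorem up_count {x : E} (hx : ∀ i j, C.a i x = C.a j x → i = j) (w : W) :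
    C.r2 w = 2 * (univ.filter fun p : I × I => C.vin w p.1 ∧ C.vin w p.2 ∧ C.adj p.1 p.2 ∧ C.a p.1 x < C.a p.2 x).card := by
  have : (univ.filter fun p : I × I => C.vin w p.1 ∧ C.vin w p.2 ∧ C.adj p.1 p.2 ∧ C.a p.1 x < C.a p.2 x).card =
     (univ.filter fun p : I × I => C.vin w p.1 ∧ C.vin w p.2 ∧ C.adj p.1 p.2 ∧ C.a p.2 x < C.a p.1 x).card := by
    apply Finset.card_bij (fun p _ => (p.2, p.1))
    · rintro ⟨i, j⟩ h; simp at h ⊢; exact ⟨h.2.1, h.1, C.asymm _ _ h.2.2.1, h.2.2.2⟩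
    · rintro ⟨i, j⟩ - ⟨k, l⟩ - h; simp at h ⊢; exact ⟨h.2, h.1⟩
    · rintro ⟨i, j⟩ h; simp at h ⊢; exact ⟨h.2.1, h.1, C.asymm _ _ h.2.2.1, h.2.2.2⟩
  rw [two_mul]
  nth_rewrite 2 [this]
  unfold r2
  rw [← Finset.card_union_of_disjoint]
  · congr 1
    ext ⟨i, j⟩
    simp only [mem_filter, mem_univ, true_and, mem_union]
    constructor
    · rintro ⟨h1, h2, h3⟩
      rcases lt_trichotomy (C.a i x) (C.a j x) with h | h | h
      · exact Or.inl ⟨h1, h2, h3, h⟩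
      · exact absurd h3 (by rw [hx _ _ h]; exact C.airr j)
      · exact Or.inr ⟨h1, h2, h3, h⟩
    · rintro (⟨h1, h2, h3, -⟩ | ⟨h1, h2, h3, -⟩) <;> exact ⟨h1, h2, h3⟩
  · rw [Finset.disjoint_left]
    rintro ⟨i, j⟩ h h'
    simp at h h'
    exact lt_asymm h.2.2.2 h'.2.2.2

theorem card_two {α : Type} [Fintype α] [DecidableEq α] {P : α → Prop} [DecidablePred P] (h : ∃ x y, x ≠ y ∧ ∀ z, P z ↔ z = x ∨ z = y) :
    (univ.filter P).card = 2 := by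
  obtain ⟨x, y, hne, h⟩ := h
  have : univ.filter P = {x, y} := by ext z; simp [h]
  rw [this, card_pair hne]

theorem fib {α : Type} [Fintype α] [DecidableEq α] {P : α → α → Prop} [∀ i j, Decidable (P i j)] (S : Finset α) (h : ∀ i j, P i j → i ∈ S) :
    (univ.filter fun p : α × α => P p.1 p.2).card = ∑ i ∈ S, (univ.filter fun j => P i j).card := by
  rw [Finset.card_eq_sum_card_fiberwise (f := Prod.fst) (t := S)]
  · refine Finset.sum_congr rfl fun i hi => ?_
    apply Finset.card_bij (fun p _ => p.2)
    · rintro ⟨a, b⟩ h; simp at h; obtain ⟨h1, rfl⟩ := h; simpa using h1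
    · rintro ⟨a, b⟩ h ⟨c, d⟩ h' e; simp at h h' e; simp [h.2, h'.2, e]
    · intro j hj; exact ⟨(i, j), by simpa using hj, rfl⟩
  · rintro ⟨i, j⟩ hp; simp at hp; exact h i j hp

open scoped Classical in
theorem per_edge (hd : finrank ℝ E = 5) {x : E} (hx : ∀ i j, C.a i x = C.a j x → i = j) {w : W} {e : Ed} (hw : C.inc w e) :
    ∑ i ∈ C.K e, (univ.filter fun j => C.ein e j ∧ C.adj i j ∧ C.a i x < C.a j x).card ≤
      2 + ((C.N w).filter fun i => C.Mixed x w i e).card := by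
  obtain ⟨i0, hi0⟩ := C.ene e
  obtain ⟨m, hm, hmin⟩ := Finset.exists_min_image (C.K e) (fun i => C.a i x) ⟨i0, by simpa using hi0⟩
  have h1 : ∀ i ∈ C.K e, (univ.filter fun j => C.ein e j ∧ C.adj i j ∧ C.a i x < C.a j x).card ≤
      (if i = m then 2 else 0) + (if C.Mixed x w i e then 1 else 0) := by
    intro i hi
    rw [mem_K] at hi
    obtain ⟨j, k, hjk, hn⟩ := C.twoN e i hi
    have hj := (hn j).mpr (Or.inl rfl)
    have hk := (hn k).mpr (Or.inr rfl)
    have ij : i ≠ j := fun h => C.airr i (by have := hj.2; rwa [← h] at this)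
    have ik : i ≠ k := fun h => C.airr i (by have := hk.2; rwa [← h] at this)
    have c2 : (univ.filter fun j => C.ein e j ∧ C.adj i j) = {j, k} := by ext z; simp [hn]
    have c3 : (univ.filter fun j => C.ein e j ∧ C.adj i j ∧ C.a i x < C.a j x) = ({j, k} : Finset I).filter fun j => C.a i x < C.a j x := by
      rw [← c2, filter_filter]; simp only [and_assoc]
    rw [c3]
    by_cases uj : C.a i x < C.a j x <;> by_cases uk : C.a i x < C.a k x
    · have := C.unimod hd hw hi hj.1 hk.1 hjk hj.2 hk.2 uj uk (by simpa using hm)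
      have e := hx i m (le_antisymm this (hmin i (by simpa using hi)))
      rw [if_pos e]
      refine (Finset.card_filter_le _ _).trans ?_
      rw [card_pair hjk]; omega
    · have mx : C.Mixed x w i e := ⟨hw, hi, j, k, hj.1, hk.1, uj, lt_of_le_of_ne (not_lt.mp uk) fun h => ik (hx _ _ h).symm⟩
      rw [if_pos mx]
      simp [filter_insert, filter_singleton, uj, uk]
    · have mx : C.Mixed x w i e := ⟨hw, hi, k, j, hk.1, hj.1, uk, lt_of_le_of_ne (not_lt.mp uj) fun h => ij (hx _ _ h).symm⟩
      rw [if_pos mx]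
      simp [filter_insert, filter_singleton, uj, uk]
    · simp [filter_insert, filter_singleton, uj, uk]
  refine (Finset.sum_le_sum h1).trans ?_
  rw [Finset.sum_add_distrib]
  refine add_le_add ?_ ?_
  · rw [Finset.sum_ite_eq' ]; split_ifs; simp
  · rw [← Finset.card_filter]
    refine Finset.card_le_card fun i hi => ?_
    rw [mem_filter] at hi ⊢
    exact ⟨C.mem_N.mpr (C.mono w e i hw hi.2.2.1), hi.2⟩

theorem euler (hd : finrank ℝ E = 5) (w : W) : C.r2 w + 4 ≤ 2 * (C.N w).card + 2 * (C.T w).card := by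
  classical
  obtain ⟨x, hx⟩ := C.generic
  have e1 := C.up_count hx w
  set up := univ.filter fun p : I × I => C.vin w p.1 ∧ C.vin w p.2 ∧ C.adj p.1 p.2 ∧ C.a p.1 x < C.a p.2 x with hup
  have e2 := Finset.sum_card_bipartiteAbove_eq_sum_card_bipartiteBelow (s := up) (t := C.T w) (fun p e => C.ein e p.1 ∧ C.ein e p.2)
  have e3 : ∑ p ∈ up, (bipartiteAbove (fun (p : I × I) e => C.ein e p.1 ∧ C.ein e p.2) (C.T w) p).card = 2 * up.card := by
    rw [Finset.sum_const_nat (m := 2), mul_comm]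
    intro p hp
    simp only [hup, mem_filter, mem_univ, true_and] at hp
    have := card_two (C.twoE w p.1 p.2 hp.2.2.1 hp.1 hp.2.1)
    rw [← this]
    congr 1
    ext e; simp [bipartiteAbove]
  have e4 : ∀ e ∈ C.T w, (bipartiteBelow (fun (p : I × I) e => C.ein e p.1 ∧ C.ein e p.2) up e).card ≤
      2 + ((C.N w).filter fun i => C.Mixed x w i e).card := by
    intro e he
    rw [mem_T] at he
    refine le_trans (le_of_eq ?_) (C.per_edge hd hx he)
    have : ∀ i ∈ C.K e, (univ.filter fun j => C.ein e j ∧ C.adj i j ∧ C.a i x < C.a j x).card =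
      (univ.filter fun j => C.ein e i ∧ C.ein e j ∧ C.adj i j ∧ C.a i x < C.a j x).card := by
      intro i hi; rw [mem_K] at hi; simp [hi]
    rw [Finset.sum_congr rfl this, ← fib (P := fun i j => C.ein e i ∧ C.ein e j ∧ C.adj i j ∧ C.a i x < C.a j x) (C.K e) (by intro i j h; simpa using h.1)]
    congr 1
    ext ⟨i, j⟩
    simp only [bipartiteBelow, hup, mem_filter, mem_univ, true_and]
    constructor
    · rintro ⟨⟨-, -, h3, h4⟩, h5, h6⟩; exact ⟨h5, h6, h3, h4⟩
    · rintro ⟨h5, h6, h3, h4⟩; exact ⟨⟨C.mono w e i he h5, C.mono w e j he h6, h3, h4⟩, h5, h6⟩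
  have e5 := Finset.sum_le_sum e4
  rw [Finset.sum_add_distrib, Finset.sum_const, smul_eq_mul] at e5
  have e6 := Finset.sum_card_bipartiteAbove_eq_sum_card_bipartiteBelow (s := C.N w) (t := C.T w) (fun i e => C.Mixed x w i e)
  simp only [bipartiteAbove, bipartiteBelow] at e2 e3 e5 e6
  have e7 : ∑ i ∈ C.N w, ((C.T w).filter fun e => C.Mixed x w i e).card + 4 ≤ 2 * (C.N w).card := by
    obtain ⟨i1, i2, hne, v1, v2⟩ := C.vtwo w
    have ne : (C.N w).Nonempty := ⟨i1, C.mem_N.mpr v1⟩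
    obtain ⟨lo, hlo, mlo⟩ := Finset.exists_min_image (C.N w) (fun i => C.a i x) ne
    obtain ⟨hi, hhi, mhi⟩ := Finset.exists_max_image (C.N w) (fun i => C.a i x) ne
    have lh : lo ≠ hi := by
      rintro rfl
      have q : ∀ i ∈ C.N w, i = lo := fun i h => hx _ _ (le_antisymm (mhi i h) (mlo i h))
      exact hne ((q i1 (C.mem_N.mpr v1)).trans (q i2 (C.mem_N.mpr v2)).symm)
    have b : ∀ i ∈ C.N w, ((C.T w).filter fun e => C.Mixed x w i e).card + ((if i = lo then 2 else 0) + (if i = hi then 2 else 0)) ≤ 2 := by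
      intro i hiN
      by_cases h1 : i = lo
      · have : ((C.T w).filter fun e => C.Mixed x w i e) = ∅ := by
          rw [Finset.filter_eq_empty_iff]
          rintro e - ⟨hw, _, u, l, _, hl, _, H⟩
          have := mlo l (C.mem_N.mpr (C.mono w e l hw hl))
          rw [h1] at H; linarith
        rw [this, if_pos h1, if_neg (h1 ▸ lh)]; simp
      · by_cases h2 : i = hi
        · have : ((C.T w).filter fun e => C.Mixed x w i e) = ∅ := by
            rw [Finset.filter_eq_empty_iff]
            rintro e - ⟨hw, _, u, l, hu, _, H, _⟩
            have := mhi u (C.mem_N.mpr (C.mono w e u hw hu))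
            rw [h2] at H; linarith
          rw [this, if_pos h2, if_neg h1]; simp
        · rw [if_neg h1, if_neg h2]
          by_contra hc
          push Not at hc
          obtain ⟨f1, q1, f2, q2, f3, q3, n12, n13, n23⟩ := Finset.two_lt_card.mp hc
          exact C.mixed3 hd (mem_filter.mp q1).2 (mem_filter.mp q2).2 (mem_filter.mp q3).2 n12 n13 n23
    have := Finset.sum_le_sum b
    rw [Finset.sum_add_distrib, Finset.sum_add_distrib, Finset.sum_ite_eq', Finset.sum_ite_eq', if_pos hlo, if_pos hhi, Finset.sum_const, smul_eq_mul] at this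
    omega
  omega
end Conf
end PS

namespace PS
set_option linter.unusedSectionVars false
open Module
namespace Conf
open Finset
variable {E W Ed I : Type} [AddCommGroup E] [Module ℝ E] (C : Conf E W Ed I) [Fintype W] [Fintype Ed] [Fintype I]

open scoped Classical in
theorem adjK (e : Ed) : (univ.filter fun p : I × I => C.ein e p.1 ∧ C.ein e p.2 ∧ C.adj p.1 p.2).card = 2 * (C.K e).card := by
  rw [fib (P := fun i j => C.ein e i ∧ C.ein e j ∧ C.adj i j) (C.K e) (by intro i j h; exact C.mem_K.mpr h.1),
    Finset.sum_const_nat (m := 2), mul_comm]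
  intro i hi
  rw [mem_K] at hi
  rw [← card_two (C.twoN e i hi)]
  simp [hi]

theorem r2_eq (w : W) : C.r2 w = ∑ e ∈ C.T w, (C.K e).card := by
  classical
  have e2 := Finset.sum_card_bipartiteAbove_eq_sum_card_bipartiteBelow
    (s := univ.filter fun p : I × I => C.vin w p.1 ∧ C.vin w p.2 ∧ C.adj p.1 p.2) (t := C.T w) (fun p e => C.ein e p.1 ∧ C.ein e p.2)
  rw [Finset.sum_const_nat (m := 2), Finset.sum_congr rfl (g := fun e => 2 * (C.K e).card), ← Finset.mul_sum] at e2
  · have : C.r2 w = (univ.filter fun p : I × I => C.vin w p.1 ∧ C.vin w p.2 ∧ C.adj p.1 p.2).card := rfl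
    omega
  · intro e he
    rw [mem_T] at he
    rw [← adjK]
    congr 1
    ext ⟨i, j⟩
    simp only [bipartiteBelow, mem_filter, mem_univ, true_and]
    constructor
    · rintro ⟨⟨-, -, h3⟩, h5, h6⟩; exact ⟨h5, h6, h3⟩
    · rintro ⟨h5, h6, h3⟩; exact ⟨⟨C.mono w e i he h5, C.mono w e j he h6, h3⟩, h5, h6⟩
  · intro p hp
    simp only [mem_filter, mem_univ, true_and] at hp
    rw [← card_two (C.twoE w p.1 p.2 hp.2.2 hp.1 hp.2.1)]
    congr 1
    ext e; simp [bipartiteAbove]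

theorem sum_T (f : Ed → ℕ) : ∑ w, ∑ e ∈ C.T w, f e = 2 * ∑ e, f e := by
  classical
  have : ∀ w, ∑ e ∈ C.T w, f e = ∑ e, if C.inc w e then f e else 0 := by
    intro w; rw [← Finset.sum_filter]; rfl
  simp_rw [this]
  rw [Finset.sum_comm, Finset.mul_sum]
  refine Finset.sum_congr rfl fun e _ => ?_
  rw [← Finset.sum_filter, Finset.sum_const, card_two (C.ends e), smul_eq_mul]

theorem K_ge (e : Ed) : 3 ≤ (C.K e).card := by
  classical
  obtain ⟨i, hi⟩ := C.ene e
  obtain ⟨j, k, hjk, hn⟩ := C.twoN e i hi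
  have hj := (hn j).mpr (Or.inl rfl)
  have hk := (hn k).mpr (Or.inr rfl)
  have ij : i ≠ j := fun h => C.airr i (by have := hj.2; rwa [← h] at this)
  have ik : i ≠ k := fun h => C.airr i (by have := hk.2; rwa [← h] at this)
  have : ({i, j, k} : Finset I).card = 3 := by simp [ij, ik, hjk]
  rw [← this]
  refine Finset.card_le_card ?_
  intro x hx
  simp only [mem_insert, mem_singleton] at hx
  rw [mem_K]
  rcases hx with rfl | rfl | rfl
  exacts [hi, hj.1, hk.1]

open scoped Classical in
/-- splitting the ordered pairs of a finset by adjacency -/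
theorem split {P : I → Prop} (S : Finset I) (hS : ∀ i, i ∈ S ↔ P i) :
    (univ.filter fun p : I × I => P p.1 ∧ P p.2 ∧ C.adj p.1 p.2).card +
    (univ.filter fun p : I × I => P p.1 ∧ P p.2 ∧ p.1 ≠ p.2 ∧ ¬ C.adj p.1 p.2).card + S.card = S.card * S.card := by
  have h := Finset.card_union_add_card_inter (univ.filter fun p : I × I => P p.1 ∧ P p.2 ∧ C.adj p.1 p.2) (univ.filter fun p : I × I => P p.1 ∧ P p.2 ∧ p.1 ≠ p.2 ∧ ¬ C.adj p.1 p.2)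
  have h0 : (univ.filter fun p : I × I => P p.1 ∧ P p.2 ∧ C.adj p.1 p.2) ∩ (univ.filter fun p : I × I => P p.1 ∧ P p.2 ∧ p.1 ≠ p.2 ∧ ¬ C.adj p.1 p.2) = ∅ := by
    ext ⟨i, j⟩; simp only [mem_inter, mem_filter, mem_univ, true_and, notMem_empty, iff_false]
    rintro ⟨⟨-, -, h⟩, -, -, -, h'⟩; exact h' h
  have h1 : (univ.filter fun p : I × I => P p.1 ∧ P p.2 ∧ C.adj p.1 p.2) ∪ (univ.filter fun p : I × I => P p.1 ∧ P p.2 ∧ p.1 ≠ p.2 ∧ ¬ C.adj p.1 p.2) = S.offDiag := by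
    ext ⟨i, j⟩; simp only [mem_union, mem_filter, mem_univ, true_and, mem_offDiag, hS]
    constructor
    · rintro (⟨h1, h2, h⟩ | ⟨h1, h2, h, -⟩)
      · exact ⟨h1, h2, fun e => C.airr i (by rw [← e] at h; exact h)⟩
      · exact ⟨h1, h2, h⟩
    · rintro ⟨h1, h2, h⟩
      by_cases ha : C.adj i j
      · exact Or.inl ⟨h1, h2, ha⟩
      · exact Or.inr ⟨h1, h2, h, ha⟩
  rw [h0, h1, card_empty, offDiag_card] at h
  have : S.card ≤ S.card * S.card := Nat.le_mul_self _
  omega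

open scoped Classical in
/-- ordered nonadjacent pairs -/
noncomputable def NA : Finset (I × I) := univ.filter fun p : I × I => p.1 ≠ p.2 ∧ ¬ C.adj p.1 p.2

open scoped Classical in
theorem NA_K (e : Ed) : (C.NA.filter fun p => C.ein e p.1 ∧ C.ein e p.2).card + 3 * (C.K e).card = (C.K e).card * (C.K e).card := by
  rw [← C.split (C.K e) (P := fun i => C.ein e i) (fun i => C.mem_K), adjK]
  have : (C.NA.filter fun p => C.ein e p.1 ∧ C.ein e p.2) = univ.filter fun p : I × I => C.ein e p.1 ∧ C.ein e p.2 ∧ p.1 ≠ p.2 ∧ ¬ C.adj p.1 p.2 := by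
    ext p; simp only [NA, mem_filter, mem_univ, true_and]
    constructor
    · rintro ⟨⟨h1, h2⟩, h3, h4⟩; exact ⟨h3, h4, h1, h2⟩
    · rintro ⟨h3, h4, h1, h2⟩; exact ⟨⟨h1, h2⟩, h3, h4⟩
  rw [this]; ring

open scoped Classical in
theorem NA_N (w : W) : (C.NA.filter fun p => C.vin w p.1 ∧ C.vin w p.2).card + C.r2 w + (C.N w).card = (C.N w).card * (C.N w).card := by
  rw [← C.split (C.N w) (P := fun i => C.vin w i) (fun i => C.mem_N)]
  have : (C.NA.filter fun p => C.vin w p.1 ∧ C.vin w p.2) = univ.filter fun p : I × I => C.vin w p.1 ∧ C.vin w p.2 ∧ p.1 ≠ p.2 ∧ ¬ C.adj p.1 p.2 := by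
    ext p; simp only [NA, mem_filter, mem_univ, true_and]
    constructor
    · rintro ⟨⟨h1, h2⟩, h3, h4⟩; exact ⟨h3, h4, h1, h2⟩
    · rintro ⟨h3, h4, h1, h2⟩; exact ⟨⟨h1, h2⟩, h3, h4⟩
  rw [this]; unfold r2; ring

theorem sum_NA_K : ∑ e, (C.K e).card * (C.K e).card ≤ 3 * ∑ e, (C.K e).card + C.NA.card := by
  classical
  have h : ∑ e, (C.NA.filter fun p => C.ein e p.1 ∧ C.ein e p.2).card ≤ C.NA.card := by
    have := Finset.sum_card_bipartiteAbove_eq_sum_card_bipartiteBelow (s := C.NA) (t := (univ : Finset Ed)) (fun p e => C.ein e p.1 ∧ C.ein e p.2)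
    simp only [bipartiteAbove, bipartiteBelow] at this
    rw [← this, Finset.card_eq_sum_ones]
    refine Finset.sum_le_sum fun p hp => ?_
    simp only [NA, mem_filter, mem_univ, true_and] at hp
    rw [Finset.card_le_one]
    intro e he f hf
    simp only [mem_filter, mem_univ, true_and] at he hf
    exact C.e2 e f p.1 p.2 hp.1 hp.2 he.1 he.2 hf.1 hf.2
  rw [Finset.sum_congr rfl fun e _ => (C.NA_K e).symm, Finset.sum_add_distrib, ← Finset.mul_sum]
  omega

theorem sum_NA_N : ∑ w, (C.N w).card * (C.N w).card + 3 * ∑ e, (C.K e).card ≤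
    ∑ w, C.r2 w + ∑ w, (C.N w).card + C.NA.card + ∑ e, (C.K e).card * (C.K e).card := by
  classical
  have h : ∑ w, (C.NA.filter fun p => C.vin w p.1 ∧ C.vin w p.2).card ≤ C.NA.card + ∑ e, (C.NA.filter fun p => C.ein e p.1 ∧ C.ein e p.2).card := by
    have h1 := Finset.sum_card_bipartiteAbove_eq_sum_card_bipartiteBelow (s := C.NA) (t := (univ : Finset Ed)) (fun p e => C.ein e p.1 ∧ C.ein e p.2)
    have h2 := Finset.sum_card_bipartiteAbove_eq_sum_card_bipartiteBelow (s := C.NA) (t := (univ : Finset W)) (fun p w => C.vin w p.1 ∧ C.vin w p.2)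
    simp only [bipartiteAbove, bipartiteBelow] at h1 h2
    rw [← h1, ← h2, Finset.card_eq_sum_ones, ← Finset.sum_add_distrib]
    refine Finset.sum_le_sum fun p hp => ?_
    simp only [NA, mem_filter, mem_univ, true_and] at hp
    by_cases hc : (univ.filter fun w => C.vin w p.1 ∧ C.vin w p.2).card ≤ 1
    · omega
    push Not at hc
    obtain ⟨w, hw, w', hw', hne⟩ := Finset.one_lt_card.mp hc
    simp only [mem_filter, mem_univ, true_and] at hw hw'
    obtain ⟨e, i1, i2, i3, i4⟩ := C.non w w' p.1 p.2 hne hp.1 hp.2 hw.1 hw.2 hw'.1 hw'.2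
    have a1 : (univ.filter fun w => C.vin w p.1 ∧ C.vin w p.2) ⊆ univ.filter fun w => C.inc w e := by
      intro u hu
      simp only [mem_filter, mem_univ, true_and] at hu ⊢
      by_cases huw : u = w
      · rw [huw]; exact i1
      · obtain ⟨f, j1, j2, j3, j4⟩ := C.non u w p.1 p.2 huw hp.1 hp.2 hu.1 hu.2 hw.1 hw.2
        rwa [C.e2 e f p.1 p.2 hp.1 hp.2 i3 i4 j3 j4]
    have a2 := Finset.card_le_card a1
    rw [card_two (C.ends e)] at a2
    have a3 : 0 < (univ.filter fun e => C.ein e p.1 ∧ C.ein e p.2).card := Finset.card_pos.mpr ⟨e, by simp [i3, i4]⟩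
    omega
  rw [Finset.sum_congr rfl fun e _ => (C.NA_K e).symm, Finset.sum_congr rfl fun w _ => (C.NA_N w).symm, Finset.sum_add_distrib, Finset.sum_add_distrib, Finset.sum_add_distrib, ← Finset.mul_sum]
  omega

theorem sum_zero_of {ι : Type} [Fintype ι] {f : ι → ℤ} (h0 : ∀ i, 0 ≤ f i) (h : ∑ i, f i ≤ 0) (i : ι) : f i = 0 := by
  have := Finset.single_le_sum (f := f) (fun i _ => h0 i) (Finset.mem_univ i)
  have := h0 i
  omega

structure Cnt : Prop where
  cW : Fintype.card W = 12
  cE : Fintype.card Ed = 35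
  cN : C.NA.card = 24

variable [FiniteDimensional ℝ E]
def CaseA : Prop := (∀ e, (C.K e).card = 3) ∧ (∀ w, C.r2 w + 12 = 6 * (C.N w).card) ∧
   ((∃ w4, (C.N w4).card = 4 ∧ ∀ w, w ≠ w4 → (C.N w).card = 5) ∨
    (∃ w6 w4 w4', w4 ≠ w4' ∧ (C.N w6).card = 6 ∧ (C.N w4).card = 4 ∧ (C.N w4').card = 4 ∧ ∀ w, w ≠ w6 → w ≠ w4 → w ≠ w4' → (C.N w).card = 5))
def CaseB : Prop := (∃ e0, (C.K e0).card = 4 ∧ (∀ e, e ≠ e0 → (C.K e).card = 3) ∧ (∀ w, (C.N w).card = 5) ∧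
    (∀ w, C.inc w e0 → C.r2 w = 16) ∧ (∀ w, ¬ C.inc w e0 → C.r2 w = 18))

theorem arith1 {ι : Type} [Fintype ι] (p : ι → ℤ) (h0 : ∀ i, 0 ≤ p i) (hD : ∑ i, (p i * p i + 3 * p i) ≤ 24)
    (hS : ∑ i, (5 * p i - p i * p i) ≤ 4) : (∀ i, p i = 0) ∨ (∃ i, p i = 1 ∧ ∀ j, j ≠ i → p j = 0) := by
  classical
  have b : ∀ i, p i ≤ 3 := by
    intro i
    have := Finset.single_le_sum (f := fun i => p i * p i + 3 * p i) (fun i _ => by have := h0 i; positivity) (Finset.mem_univ i)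
    by_contra hc; push Not at hc; nlinarith
  have g0 : ∀ i, 0 ≤ 5 * p i - p i * p i := fun i => by have := h0 i; have := b i; nlinarith
  by_cases h : ∀ i, p i = 0
  · exact Or.inl h
  push Not at h
  obtain ⟨i, hi⟩ := h
  refine Or.inr ⟨i, ?_, ?_⟩
  · have := Finset.single_le_sum (f := fun i => 5 * p i - p i * p i) (fun i _ => g0 i) (Finset.mem_univ i)
    have h1 := b i; have h2 := h0 i
    interval_cases h : p i <;> simp_all
    all_goals omega
  · intro j hj
    by_contra hj0
    have h1 : ∑ k ∈ ({i, j} : Finset ι), (5 * p k - p k * p k) ≤ ∑ k, (5 * p k - p k * p k) :=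
      Finset.sum_le_sum_of_subset_of_nonneg (Finset.subset_univ _) fun k _ _ => g0 k
    rw [Finset.sum_pair hj.symm] at h1
    have a1 := b i; have a2 := h0 i; have a3 := b j; have a4 := h0 j
    have c1 : 4 ≤ 5 * p i - p i * p i := by interval_cases h : p i <;> simp_all
    have c2 : 4 ≤ 5 * p j - p j * p j := by interval_cases h : p j <;> simp_all
    omega

theorem arith2 {ι : Type} [Fintype ι] (n : ι → ℤ) (hc : Fintype.card ι = 12) (hs : ∑ i, n i = 59)
    (h1 : ∑ i, (n i - 4) * (n i - 5) ≤ 2) (h2 : ∑ i, (n i - 5) * (n i - 6) ≤ 4) :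
    (∃ i, n i = 4 ∧ ∀ j, j ≠ i → n j = 5) ∨
    (∃ a b c, b ≠ c ∧ n a = 6 ∧ n b = 4 ∧ n c = 4 ∧ ∀ j, j ≠ a → j ≠ b → j ≠ c → n j = 5) := by
  classical
  have p1 : ∀ i, 0 ≤ (n i - 4) * (n i - 5) := fun i => by
    rcases le_or_gt (n i) 4 with h | h
    · nlinarith
    · exact mul_nonneg (by omega) (by omega)
  have p2 : ∀ i, 0 ≤ (n i - 5) * (n i - 6) := fun i => by
    rcases le_or_gt (n i) 5 with h | h
    · nlinarith
    · exact mul_nonneg (by omega) (by omega)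
  have v : ∀ i, n i = 4 ∨ n i = 5 ∨ n i = 6 := by
    intro i
    have q1 := Finset.single_le_sum (f := fun i => (n i - 4) * (n i - 5)) (fun i _ => p1 i) (Finset.mem_univ i)
    have q2 := Finset.single_le_sum (f := fun i => (n i - 5) * (n i - 6)) (fun i _ => p2 i) (Finset.mem_univ i)
    have a1 : n i ≤ 6 := by by_contra h; push Not at h; nlinarith
    have a2 : 4 ≤ n i := by by_contra h; push Not at h; nlinarith
    omega
  have e1 : ∑ i, (n i - 4) * (n i - 5) = 2 * ((univ.filter fun i => n i = 6).card : ℤ) := by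
    rw [Finset.card_filter]; push_cast; rw [Finset.mul_sum]
    refine Finset.sum_congr rfl fun i _ => ?_
    rcases v i with h | h | h <;> simp [h]
  have e2 : ∑ i, (n i - 5) * (n i - 6) = 2 * ((univ.filter fun i => n i = 4).card : ℤ) := by
    rw [Finset.card_filter]; push_cast; rw [Finset.mul_sum]
    refine Finset.sum_congr rfl fun i _ => ?_
    rcases v i with h | h | h <;> simp [h]
  have e3 : ∑ i, (n i - 5) = ((univ.filter fun i => n i = 6).card : ℤ) - ((univ.filter fun i => n i = 4).card : ℤ) := by
    rw [Finset.card_filter, Finset.card_filter]; push_cast; rw [← Finset.sum_sub_distrib]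
    refine Finset.sum_congr rfl fun i _ => ?_
    rcases v i with h | h | h <;> simp [h]
  rw [Finset.sum_sub_distrib, Finset.sum_const, Finset.card_univ, hc, hs] at e3
  norm_num at e3
  have c6 : (univ.filter fun i => n i = 6).card = 0 ∨ (univ.filter fun i => n i = 6).card = 1 := by omega
  rcases c6 with c6 | c6
  · have c4 : (univ.filter fun i => n i = 4).card = 1 := by omega
    obtain ⟨i, hi⟩ := Finset.card_eq_one.mp c4
    have m : ∀ j, n j = 4 ↔ j = i := fun j => by
      have := Finset.ext_iff.mp hi j; simpa using this
    have m6 : ∀ j, n j ≠ 6 := fun j => by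
      have := Finset.ext_iff.mp (Finset.card_eq_zero.mp c6) j; simpa using this
    refine Or.inl ⟨i, (m i).mpr rfl, fun j hj => ?_⟩
    rcases v j with h | h | h
    · exact absurd ((m j).mp h) hj
    · exact h
    · exact absurd h (m6 j)
  · have c4 : (univ.filter fun i => n i = 4).card = 2 := by omega
    obtain ⟨b, c, hbc, hi⟩ := Finset.card_eq_two.mp c4
    obtain ⟨a, ha⟩ := Finset.card_eq_one.mp c6
    have m : ∀ j, n j = 4 ↔ j = b ∨ j = c := fun j => by
      have := Finset.ext_iff.mp hi j; simpa using this
    have m6 : ∀ j, n j = 6 ↔ j = a := fun j => by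
      have := Finset.ext_iff.mp ha j; simpa using this
    refine Or.inr ⟨a, b, c, hbc, (m6 a).mpr rfl, (m b).mpr (Or.inl rfl), (m c).mpr (Or.inr rfl), fun j h1 h2 h3 => ?_⟩
    rcases v j with h | h | h
    · exact absurd ((m j).mp h) (by simp [h2, h3])
    · exact h
    · exact absurd ((m6 j).mp h) h1

theorem cases (hd : finrank ℝ E = 5) (h : C.Cnt) : C.CaseA ∨ C.CaseB := by
  classical
  obtain ⟨cW, cE, cN⟩ := h
  have t1 : ∑ w, (C.T w).card = 70 := by
    have := C.sum_T (fun _ => 1)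
    simp [cE] at this; omega
  have t2 : ∑ w, C.r2 w = 2 * ∑ e, (C.K e).card := by
    rw [← C.sum_T, Finset.sum_congr rfl fun w _ => C.r2_eq w]
  have t3 := C.sum_NA_K
  have t4 := C.sum_NA_N
  rw [cN] at t3 t4
  have eu : ∀ w, (0 : ℤ) ≤ 2 * (C.N w).card + 2 * (C.T w).card - C.r2 w - 4 := fun w => by
    have := C.euler hd w; omega
  have es : ∑ w, (2 * ((C.N w).card : ℤ) + 2 * (C.T w).card - C.r2 w - 4) = 2 * ∑ w, ((C.N w).card : ℤ) + 2 * ∑ w, ((C.T w).card : ℤ) - ∑ w, (C.r2 w : ℤ) - 48 := by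
    rw [Finset.sum_sub_distrib, Finset.sum_sub_distrib, Finset.sum_add_distrib, ← Finset.mul_sum, ← Finset.mul_sum]
    simp [cW]
  have t5 := Finset.sum_nonneg fun w (_ : w ∈ univ) => eu w
  rw [es] at t5
  zify at t1 t2 t3 t4
  set p : Ed → ℤ := fun e => (C.K e).card - 3 with hp
  have p0 : ∀ e, 0 ≤ p e := fun e => by have := C.K_ge e; simp only [hp]; omega
  have sp : ∑ e, p e = ∑ e, ((C.K e).card : ℤ) - 105 := by
    simp only [hp]; rw [Finset.sum_sub_distrib]; simp [cE]
  have sp2 : ∑ e, p e * p e = ∑ e, ((C.K e).card : ℤ) * (C.K e).card - 6 * ∑ e, ((C.K e).card : ℤ) + 315 := by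
    have : ∀ e, p e * p e = ((C.K e).card : ℤ) * (C.K e).card - 6 * (C.K e).card + 9 := fun e => by simp only [hp]; ring
    rw [Finset.sum_congr rfl fun e _ => this e, Finset.sum_add_distrib, Finset.sum_sub_distrib, ← Finset.mul_sum]
    simp [cE]
  have u1 : ∑ w, (((C.N w).card : ℤ) - 4) * ((C.N w).card - 5) = ∑ w, ((C.N w).card : ℤ) * (C.N w).card - 9 * ∑ w, ((C.N w).card : ℤ) + 240 := by
    have : ∀ w, (((C.N w).card : ℤ) - 4) * ((C.N w).card - 5) = ((C.N w).card : ℤ) * (C.N w).card - 9 * ((C.N w).card : ℤ) + 20 := fun e => by ring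
    rw [Finset.sum_congr rfl fun e _ => this e, Finset.sum_add_distrib, Finset.sum_sub_distrib, ← Finset.mul_sum]
    simp [cW]
  have u2 : ∑ w, (((C.N w).card : ℤ) - 5) * ((C.N w).card - 6) = ∑ w, ((C.N w).card : ℤ) * (C.N w).card - 11 * ∑ w, ((C.N w).card : ℤ) + 360 := by
    have : ∀ w, (((C.N w).card : ℤ) - 5) * ((C.N w).card - 6) = ((C.N w).card : ℤ) * (C.N w).card - 11 * ((C.N w).card : ℤ) + 30 := fun e => by ring
    rw [Finset.sum_congr rfl fun e _ => this e, Finset.sum_add_distrib, Finset.sum_sub_distrib, ← Finset.mul_sum]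
    simp [cW]
  have v1 : ∀ w, 0 ≤ (((C.N w).card : ℤ) - 4) * ((C.N w).card - 5) := fun w => by
    rcases le_or_gt ((C.N w).card : ℤ) 4 with h | h
    · nlinarith
    · exact mul_nonneg (by omega) (by omega)
  have v2 : ∀ w, 0 ≤ (((C.N w).card : ℤ) - 5) * ((C.N w).card - 6) := fun w => by
    rcases le_or_gt ((C.N w).card : ℤ) 5 with h | h
    · nlinarith
    · exact mul_nonneg (by omega) (by omega)
  have w1 := Finset.sum_nonneg fun w (_ : w ∈ univ) => v1 w
  have w2 := Finset.sum_nonneg fun w (_ : w ∈ univ) => v2 w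
  rw [u1] at w1
  rw [u2] at w2
  have A := arith1 p p0 (by rw [Finset.sum_add_distrib, ← Finset.mul_sum]; omega) (by rw [Finset.sum_sub_distrib, ← Finset.mul_sum]; omega)
  rcases A with A | ⟨e0, A1, A2⟩
  · left
    have z1 : ∑ e, p e = 0 := Finset.sum_eq_zero fun e _ => A e
    have z2 : ∑ e, p e * p e = 0 := Finset.sum_eq_zero fun e _ => by rw [A e]; rfl
    have k3 : ∀ e, (C.K e).card = 3 := fun e => by have := A e; simp only [hp] at this; omega
    have eq := sum_zero_of eu (by rw [es]; omega)
    refine ⟨k3, fun w => ?_, ?_⟩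
    · have h1 := eq w
      have h2 := C.r2_eq w
      rw [Finset.sum_const_nat (m := 3) (fun e _ => k3 e)] at h2
      omega
    · have := arith2 (fun w => ((C.N w).card : ℤ)) cW (by omega) (by omega) (by omega)
      exact_mod_cast this
  · right
    have z1 : ∑ e, p e = 1 := by rw [Finset.sum_eq_single e0 (fun b _ hb => A2 b hb) (by simp)]; exact A1
    have z2 : ∑ e, p e * p e = 1 := by rw [Finset.sum_eq_single e0 (fun b _ hb => by rw [A2 b hb]; rfl) (by simp), A1]; rfl
    have k4 : (C.K e0).card = 4 := by simp only [hp] at A1; omega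
    have k3 : ∀ e, e ≠ e0 → (C.K e).card = 3 := fun e he => by have := A2 e he; simp only [hp] at this; omega
    have eq := sum_zero_of eu (by rw [es]; omega)
    have n1 := sum_zero_of v1 (by rw [u1]; omega)
    have n2 := sum_zero_of v2 (by rw [u2]; omega)
    have n5 : ∀ w, (C.N w).card = 5 := fun w => by
      have h1 := n1 w; have h2 := n2 w
      have : (2 : ℤ) * (C.N w).card = 10 := by linarith
      omega
    have r3 : ∀ w, C.r2 w = 3 * (C.T w).card + (if C.inc w e0 then 1 else 0) := by
      intro w
      have h : ∀ e ∈ C.T w, (C.K e).card = 3 + if e = e0 then 1 else 0 := by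
        intro e _; by_cases he : e = e0
        · rw [he, k4]; simp
        · rw [k3 e he]; simp [he]
      rw [C.r2_eq w, Finset.sum_congr rfl h, Finset.sum_add_distrib, Finset.sum_const, Finset.sum_ite_eq', smul_eq_mul]
      simp only [mem_T]; ring
    refine ⟨e0, k4, k3, n5, fun w hw => ?_, fun w hw => ?_⟩
    · have := r3 w; rw [if_pos hw] at this
      have h1 := eq w; have := n5 w; omega
    · have := r3 w; rw [if_neg hw] at this
      have h1 := eq w; have := n5 w; omega
end Conf
end PS

namespace PS
set_option linter.unusedSectionVars false
open Module
namespace Conf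
open Finset
variable {E W Ed I : Type} [AddCommGroup E] [Module ℝ E] (C : Conf E W Ed I) [Fintype W] [Fintype Ed] [Fintype I] [DecidableEq I]

noncomputable def Bl : Finset (Finset I) := univ.image C.N

theorem N_inj : Function.Injective C.N := by
  intro w w' h
  by_contra hne
  obtain ⟨i, h1, h2⟩ := C.incomp w w' hne
  have : i ∈ C.N w := C.mem_N.mpr h1
  rw [h] at this
  exact h2 (C.mem_N.mp this)

theorem mem_Bl {b : Finset I} : b ∈ C.Bl ↔ ∃ w, C.N w = b := by simp [Bl]
theorem N_mem (w : W) : C.N w ∈ C.Bl := C.mem_Bl.mpr ⟨w, rfl⟩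
theorem card_Bl : C.Bl.card = Fintype.card W := by
  rw [Bl, card_image_of_injective _ C.N_inj, card_univ]

theorem N_sub {w w' : W} (h : C.N w ⊆ C.N w') : w = w' := by
  by_contra hne
  obtain ⟨i, h1, h2⟩ := C.incomp w w' hne
  exact h2 (C.mem_N.mp (h (C.mem_N.mpr h1)))

theorem excl_iff {f : Finset I} {w : W} (h : ∀ u, f ⊆ C.N u → u = w) : Excl C.Bl f (C.N w) := by
  intro c hc hf
  obtain ⟨u, rfl⟩ := C.mem_Bl.mp hc
  rw [h u hf]

/-- triples on an edge at `w` -/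
def g (w : W) (i j k : I) : Prop := i ≠ j ∧ i ≠ k ∧ j ≠ k ∧ ∃ e, C.inc w e ∧ (C.K e).card = 3 ∧ C.ein e i ∧ C.ein e j ∧ C.ein e k

theorem g_s1 {w : W} {i j k : I} (h : C.g w i j k) : C.g w j i k := by
  obtain ⟨h1, h2, h3, e, h4, h0, h5, h6, h7⟩ := h
  exact ⟨h1.symm, h3, h2, e, h4, h0, h6, h5, h7⟩
theorem g_s2 {w : W} {i j k : I} (h : C.g w i j k) : C.g w i k j := by
  obtain ⟨h1, h2, h3, e, h4, h0, h5, h6, h7⟩ := h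
  exact ⟨h2, h1, h3.symm, e, h4, h0, h5, h7, h6⟩

theorem K3_adj {e : Ed} (hK : (C.K e).card = 3) {i j : I} (hi : C.ein e i) (hj : C.ein e j) (hij : i ≠ j) : C.adj i j := by
  by_contra ha
  obtain ⟨k, l, hkl, hn⟩ := C.twoN e i hi
  have hk := (hn k).mpr (Or.inl rfl)
  have hl := (hn l).mpr (Or.inr rfl)
  have ik : i ≠ k := fun h => C.airr i (by have := hk.2; rwa [← h] at this)
  have il : i ≠ l := fun h => C.airr i (by have := hl.2; rwa [← h] at this)
  have jk : j ≠ k := fun h => ha (by rw [h]; exact hk.2)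
  have jl : j ≠ l := fun h => ha (by rw [h]; exact hl.2)
  have : ({i, j, k, l} : Finset I) ⊆ C.K e := by
    intro x hx
    simp only [mem_insert, mem_singleton] at hx
    rw [mem_K]
    rcases hx with rfl | rfl | rfl | rfl
    exacts [hi, hj, hk.1, hl.1]
  have := card_le_card this
  rw [hK] at this
  simp [hij, ik, il, jk, jl, hkl] at this

theorem K3_eq {e : Ed} (hK : (C.K e).card = 3) {i j k : I} (hi : C.ein e i) (hj : C.ein e j) (hk : C.ein e k) (h1 : i ≠ j) (h2 : i ≠ k) (h3 : j ≠ k) :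
    C.K e = {i, j, k} := by
  symm
  apply eq_of_subset_of_card_le
  · intro x hx
    simp only [mem_insert, mem_singleton] at hx
    rw [mem_K]
    rcases hx with rfl | rfl | rfl
    exacts [hi, hj, hk]
  · rw [hK]; simp [h1, h2, h3]

theorem g_adj {w : W} {i j k : I} (h : C.g w i j k) : C.adj i j := by
  obtain ⟨h1, h2, h3, e, h4, h0, h5, h6, h7⟩ := h
  exact C.K3_adj h0 h5 h6 h1
theorem g_vin {w : W} {i j k : I} (h : C.g w i j k) : C.vin w k := by
  obtain ⟨h1, h2, h3, e, h4, h0, h5, h6, h7⟩ := h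
  exact C.mono w e k h4 h7

theorem g_good {w : W} {i j k : I} (h : C.g w i j k) : Good C.Bl {i, j, k} (C.N w) := by
  obtain ⟨h1, h2, h3, e, h4, h0, h5, h6, h7⟩ := h
  obtain ⟨w', hw', hi'⟩ := C.other h4
  refine ⟨C.N w', C.N_mem w', fun h => hw' (C.N_inj h), ?_, ?_⟩
  · intro x hx
    rw [← C.K3_eq h0 h5 h6 h7 h1 h2 h3] at hx
    exact C.mem_N.mpr (C.mono w' e x hi' (C.mem_K.mp hx))
  · intro c hc hs
    obtain ⟨u, rfl⟩ := C.mem_Bl.mp hc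
    by_cases hu : u = w
    · left; rw [hu]
    right
    have m : ∀ x ∈ ({i, j, k} : Finset I), C.vin u x := fun x hx => C.mem_N.mp (hs hx)
    have : C.inc u e := C.inc_of hu h1 h2 h3 h4 h5 h6 h7 (m i (by simp)) (m j (by simp)) (m k (by simp))
    obtain ⟨p, q, hpq, hin⟩ := C.ends e
    have a1 := (hin u).mp this
    have a2 := (hin w).mp h4
    have a3 := (hin w').mp hi'
    congr 1
    rcases a1 with rfl | rfl <;> rcases a2 with rfl | rfl <;> rcases a3 with rfl | rfl <;> simp_all

def Simp (w : W) : Prop := ∀ e, C.inc w e → (C.K e).card = 3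

variable {C}
theorem g_excl {w : W} (hs : C.Simp w) {i j k : I} (h1 : i ≠ j) (h2 : i ≠ k) (h3 : j ≠ k) (vi : C.vin w i) (vj : C.vin w j) (vk : C.vin w k)
    (h : ¬ C.g w i j k) : Excl C.Bl {i, j, k} (C.N w) := by
  apply C.excl_iff
  intro u hu
  by_contra hne
  have m : ∀ x ∈ ({i, j, k} : Finset I), C.vin u x := fun x hx => C.mem_N.mp (hu hx)
  obtain ⟨e, q1, q2, q3, q4, q5⟩ := C.tri u w i j k hne h1 h2 h3 (m i (by simp)) (m j (by simp)) (m k (by simp)) vi vj vk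
  exact h ⟨h1, h2, h3, e, q2, hs e q2, q3, q4, q5⟩

theorem na_excl {w : W} (hs : C.Simp w) {i j : I} (h1 : i ≠ j) (vi : C.vin w i) (vj : C.vin w j) (h : ¬ C.adj i j) : Excl C.Bl {i, j} (C.N w) := by
  apply C.excl_iff
  intro u hu
  by_contra hne
  have m : ∀ x ∈ ({i, j} : Finset I), C.vin u x := fun x hx => C.mem_N.mp (hu hx)
  obtain ⟨e, q1, q2, q3, q4⟩ := C.non u w i j hne h1 h (m i (by simp)) (m j (by simp)) vi vj
  exact h (C.K3_adj (hs e q2) q3 q4 h1)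

theorem thirds {w : W} (hs : C.Simp w) {i j : I} (vi : C.vin w i) (vj : C.vin w j) (h : C.adj i j) :
    ∃ k l, k ≠ l ∧ ∀ m, C.g w i j m ↔ m = k ∨ m = l := by
  have hij : i ≠ j := fun e => C.airr i (by rw [← e] at h; exact h)
  obtain ⟨e, e', hne, he⟩ := C.twoE w i j h vi vj
  have h1 := (he e).mpr (Or.inl rfl)
  have h2 := (he e').mpr (Or.inr rfl)
  have ex : ∀ e, C.inc w e ∧ C.ein e i ∧ C.ein e j → ∃ k, i ≠ k ∧ j ≠ k ∧ C.ein e k := by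
    intro e h
    have : ∃ k ∈ C.K e, k ∉ ({i, j} : Finset I) := by
      apply exists_mem_notMem_of_card_lt_card
      rw [hs e h.1, card_pair hij]; norm_num
    obtain ⟨k, hk, hk'⟩ := this
    simp only [mem_insert, mem_singleton, not_or] at hk'
    exact ⟨k, Ne.symm hk'.1, Ne.symm hk'.2, C.mem_K.mp hk⟩
  obtain ⟨k, k1, k2, k3⟩ := ex e h1
  obtain ⟨l, l1, l2, l3⟩ := ex e' h2
  refine ⟨k, l, ?_, ?_⟩
  · rintro rfl
    exact hne (C.e3 e e' i j k hij k1 k2 h1.2.1 h1.2.2 k3 h2.2.1 h2.2.2 l3)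
  · intro m
    constructor
    · rintro ⟨-, m1, m2, f, f1, f0, f2, f3, f4⟩
      rcases (he f).mp ⟨f1, f2, f3⟩ with rfl | rfl
      · left
        rw [← mem_K, C.K3_eq f0 f2 f3 k3 hij k1 k2] at f4
        simp only [mem_insert, mem_singleton] at f4
        rcases f4 with rfl | rfl | rfl
        · exact absurd rfl m1
        · exact absurd rfl m2
        · rfl
      · right
        rw [← mem_K, C.K3_eq f0 f2 f3 l3 hij l1 l2] at f4
        simp only [mem_insert, mem_singleton] at f4
        rcases f4 with rfl | rfl | rfl
        · exact absurd rfl m1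
        · exact absurd rfl m2
        · rfl
    · rintro (rfl | rfl)
      · exact ⟨hij, k1, k2, e, h1.1, hs e h1.1, h1.2.1, h1.2.2, k3⟩
      · exact ⟨hij, l1, l2, e', h2.1, hs e' h2.1, h2.2.1, h2.2.2, l3⟩

theorem two_of {w : W} (hs : C.Simp w) {i j p q : I} (vi : C.vin w i) (vj : C.vin w j) (h : C.adj i j)
    (hpq : ∀ m, C.g w i j m → m = p ∨ m = q) : p ≠ q ∧ C.g w i j p ∧ C.g w i j q := by
  obtain ⟨k, l, hkl, hm⟩ := thirds hs vi vj h
  have hk := (hm k).mpr (Or.inl rfl)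
  have hl := (hm l).mpr (Or.inr rfl)
  rcases hpq k hk with rfl | rfl <;> rcases hpq l hl with rfl | rfl
  · exact absurd rfl hkl
  · exact ⟨hkl, hk, hl⟩
  · exact ⟨hkl.symm, hl, hk⟩
  · exact absurd rfl hkl

theorem three_no {w : W} (hs : C.Simp w) {i j p q r : I} (hp : C.g w i j p) (hq : C.g w i j q) (hr : C.g w i j r) (hpq : p ≠ q) (hpr : p ≠ r) (hqr : q ≠ r) : False := by
  obtain ⟨k, l, hkl, hm⟩ := thirds hs (C.g_vin (C.g_s1 (C.g_s2 (C.g_s1 hp)))) (C.g_vin (C.g_s2 hp)) (C.g_adj hp)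
  have h1 := (hm p).mp hp
  have h2 := (hm q).mp hq
  have h3 := (hm r).mp hr
  rcases h1 with rfl | rfl <;> rcases h2 with rfl | rfl <;> rcases h3 with rfl | rfl <;> simp_all
end Conf
end PS

namespace PS
set_option linter.unusedSectionVars false
open Module
theorem ms3 : ms 3 = {0, 1} := by decide
theorem ms_sub_ex {φ : ℕ → I} [DecidableEq I] {k m : ℕ} (hk : k ≤ 10) (hm : m < 2 ^ k) {T : Finset I} (hT : T ⊆ im φ m) : ∃ t < 2 ^ k, ms t ⊆ ms m ∧ im φ t = T := by
  induction T using Finset.induction_on with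
  | empty => exact ⟨0, by positivity, by simp [ms_zero], by simp [im, ms_zero]⟩
  | insert a s ha ih =>
    obtain ⟨t, h1, h2, h3⟩ := ih (fun x hx => hT (Finset.mem_insert_of_mem hx))
    obtain ⟨i, hi, rfl⟩ := Finset.mem_image.mp (hT (Finset.mem_insert_self _ _))
    have i10 := (mem_ms.mp hi).1
    refine ⟨Nat.lor (2 ^ i) t, lor_lt (Nat.pow_lt_pow_right (by norm_num) (ms_lt hm hi)) h1, ?_, ?_⟩
    · rw [ms_lor, ms_pow i10]
      intro x hx
      rcases Finset.mem_union.mp hx with h | h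
      · rw [Finset.mem_singleton.mp h]; exact hi
      · exact h2 h
    · rw [im_lor, im_pow φ i10, h3]; rfl

/-- three-element submasks -/
def tm (m : ℕ) : List ℕ := (List.range 64).filter fun t => Nat.beq (Nat.land t m) t && Nat.beq (ms t).card 3

theorem tm_of {φ : ℕ → I} [DecidableEq I] {k m : ℕ} (hk : k ≤ 6) (hφ : Set.InjOn φ {i | i < k}) (hm : m < 2 ^ k) {T : Finset I} (hT : T ⊆ im φ m)
   (h3 : T.card = 3) : ∃ t ∈ tm m, im φ t = T := by
  obtain ⟨t, h1, h2, h4⟩ := ms_sub_ex (by omega) hm hT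
  refine ⟨t, ?_, h4⟩
  have : (2:ℕ) ^ k ≤ 2 ^ 6 := Nat.pow_le_pow_right (by norm_num) hk
  have l := subb_of (by omega) h2
  rw [← h4, im_card hφ h1] at h3
  simp only [tm, List.mem_filter, List.mem_range, Bool.and_eq_true, Nat.beq_eq]
  exact ⟨by omega, by simpa [subb] using l, h3⟩

def mk6 (x0 x1 x2 x3 x4 x5 : I) : ℕ → I
  | 0 => x0
  | 1 => x1
  | 2 => x2
  | 3 => x3
  | 4 => x4
  | _ => x5

theorem im_three [DecidableEq I] (φ : ℕ → I) {t a b c : ℕ} (h : ms t = {a, b, c}) : im φ t = {φ a, φ b, φ c} := by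
  rw [im, h]; simp [Finset.image_insert]
theorem im_two [DecidableEq I] (φ : ℕ → I) {t a b : ℕ} (h : ms t = {a, b}) : im φ t = {φ a, φ b} := by
  rw [im, h]; simp [Finset.image_insert]

def Sym2S {I : Type} (S : Finset (I × I)) : Prop := (∀ i j, (i, j) ∈ S → (j, i) ∈ S) ∧ ∀ i, (i, i) ∉ S

theorem peel {I : Type} [DecidableEq I] {S : Finset (I × I)} (hS : Sym2S S) {n : ℕ} (hc : S.card = n + 2) {u v : I} (h : (u, v) ∈ S) :
    ∃ S' : Finset (I × I), Sym2S S' ∧ S'.card = n ∧ (∀ i j, (i, j) ∈ S ↔ (i = u ∧ j = v) ∨ (i = v ∧ j = u) ∨ (i, j) ∈ S') ∧ (u, v) ∉ S' ∧ (v, u) ∉ S' := by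
  have huv : u ≠ v := fun e => hS.2 u (by rw [← e] at h; exact h)
  refine ⟨(S.erase (u, v)).erase (v, u), ⟨?_, ?_⟩, ?_, ?_, ?_, ?_⟩
  · intro i j hij
    simp only [Finset.mem_erase, Prod.mk.injEq, ne_eq] at hij ⊢
    exact ⟨fun e => hij.2.1 ⟨e.2, e.1⟩, fun e => hij.1 ⟨e.2, e.1⟩, hS.1 _ _ hij.2.2⟩
  · intro i hi
    simp only [Finset.mem_erase] at hi
    exact hS.2 i hi.2.2
  · rw [Finset.card_erase_of_mem, Finset.card_erase_of_mem h, hc]; · omega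
    simp only [Finset.mem_erase, Prod.mk.injEq, ne_eq]
    exact ⟨fun e => huv e.2, hS.1 _ _ h⟩
  · intro i j
    have h' := hS.1 _ _ h
    simp only [Finset.mem_erase, Prod.mk.injEq, ne_eq]
    by_cases h1 : i = u ∧ j = v
    · simp [h1, h]
    by_cases h2 : i = v ∧ j = u
    · simp [h2, h']
    simp [h1, h2]
  · simp
  · simp

namespace Conf
open Finset
variable {E W Ed I : Type} [AddCommGroup E] [Module ℝ E] {C : Conf E W Ed I} [Fintype W] [Fintype Ed] [Fintype I] [DecidableEq I]

/-- non-adjacent pairs at a vertex -/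
noncomputable def D (C : Conf E W Ed I) (w : W) : Finset (I × I) := by
  classical exact C.NA.filter fun p => C.vin w p.1 ∧ C.vin w p.2

theorem mem_D {w : W} {i j : I} : (i, j) ∈ C.D w ↔ (i ≠ j ∧ ¬ C.adj i j) ∧ C.vin w i ∧ C.vin w j := by
  classical
  simp [D, NA]
theorem D_sym (w : W) : Sym2S (C.D w) := by
  constructor
  · intro i j h
    rw [mem_D] at h ⊢
    exact ⟨⟨h.1.1.symm, fun a => h.1.2 (C.asymm _ _ a)⟩, h.2.2, h.2.1⟩
  · intro i h
    rw [mem_D] at h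
    exact h.1.1 rfl
theorem D_card (w : W) : (C.D w).card + C.r2 w + (C.N w).card = (C.N w).card * (C.N w).card := by
  classical
  rw [← C.NA_N w, D]; 

theorem adj_of {w : W} {i j : I} (vi : C.vin w i) (vj : C.vin w j) (hij : i ≠ j) (h : (i, j) ∉ C.D w) : C.adj i j := by
  by_contra hc
  exact h (mem_D.mpr ⟨⟨hij, hc⟩, vi, vj⟩)

theorem D_empty {w : W} {S : Finset (I × I)} (h : S.card = 0) (i j : I) : (i, j) ∉ S := by
  rw [card_eq_zero] at h; simp [h]

theorem two_in {w : W} (hs : C.Simp w) {i j p q : I} (vi : C.vin w i) (vj : C.vin w j) (h : C.adj i j)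
    (hpq : ∀ m, C.vin w m → C.adj i m → C.adj j m → m = p ∨ m = q) : p ≠ q ∧ C.g w i j p ∧ C.g w i j q := by
  apply two_of hs vi vj h
  intro m hm
  exact hpq m (C.g_vin hm) (C.g_adj (C.g_s2 hm)) (C.g_adj (C.g_s2 (C.g_s1 hm)))

theorem isTet {w : W} (hs : C.Simp w) (h4 : (C.N w).card = 4) (hr : C.r2 w = 12) : IsTet C.Bl (C.N w) := by
  have hD := C.D_card w
  rw [h4, hr] at hD
  have hD0 : (C.D w).card = 0 := by omega
  refine ⟨h4, C.excl_iff fun u hu => (C.N_sub hu).symm, fun T hT h3 => ?_⟩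
  obtain ⟨i, j, k, hij, hik, hjk, rfl⟩ := card_eq_three.mp h3
  have vi : C.vin w i := C.mem_N.mp (hT (by simp))
  have vj : C.vin w j := C.mem_N.mp (hT (by simp))
  have hc : (C.N w \ {i, j, k}).card = 1 := by rw [card_sdiff_of_subset hT, h4, h3]
  obtain ⟨l, hl⟩ := card_eq_one.mp hc
  apply C.g_good
  refine (two_in hs vi vj (adj_of vi vj hij (D_empty (w := w) hD0 i j)) (p := k) (q := l) ?_).2.1
  intro m vm h1 h2
  by_contra hcon
  push Not at hcon
  have : m ∈ C.N w \ {i, j, k} := by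
    simp only [mem_sdiff, mem_insert, mem_singleton, not_or]
    refine ⟨C.mem_N.mpr vm, ?_, ?_, hcon.1⟩
    · rintro rfl; exact C.airr _ h1
    · rintro rfl; exact C.airr _ h2
  rw [hl] at this
  exact hcon.2 (by simpa using this)

theorem inj6 {x0 x1 x2 x3 x4 x5 : I} (h : ([x0, x1, x2, x3, x4, x5] : List I).Nodup) : Set.InjOn (mk6 x0 x1 x2 x3 x4 x5) {i | i < 6} := by
  intro i hi j hj e
  simp only [Set.mem_ofPred_eq] at hi hj
  have h' : ∀ k < 6, [x0, x1, x2, x3, x4, x5][k]? = some (mk6 x0 x1 x2 x3 x4 x5 k) := by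
    intro k hk; interval_cases k <;> rfl
  have h1 := h' i hi
  have h2 := h' j hj
  rw [e, ← h2] at h1
  exact (List.getElem?_inj (by simpa using hi) h).mp h1

/-- a bipyramid vertex -/
structure BipAt (C : Conf E W Ed I) (w : W) (u v a b c : I) : Prop where
  nd : ([u, v, a, b, c] : List I).Nodup
  N : C.N w = {u, v, a, b, c}
  uv : ¬ C.adj u v
  g1 : C.g w u a b
  g2 : C.g w u a c
  g3 : C.g w u b c
  g4 : C.g w v a b
  g5 : C.g w v a c
  g6 : C.g w v b c
  ng : ¬ C.g w a b c

theorem bipAt {w : W} (hs : C.Simp w) {u v a b c : I} (nd : ([u, v, a, b, c] : List I).Nodup) (hN : C.N w = {u, v, a, b, c})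
    (uv : ¬ C.adj u v) (hD : ∀ i j, (i, j) ∈ C.D w → (i = u ∧ j = v) ∨ (i = v ∧ j = u)) : BipAt C w u v a b c := by
  have vu : ¬ C.adj v u := fun h => uv (C.asymm _ _ h)
  have hv : ∀ m, C.vin w m ↔ m = u ∨ m = v ∨ m = a ∨ m = b ∨ m = c := by
    intro m; rw [← C.mem_N, hN]; simp
  have nd' := nd
  simp only [List.nodup_cons, List.mem_cons, not_or, List.not_mem_nil, List.nodup_nil, not_false_eq_true, and_true] at nd
  obtain ⟨⟨h1, h2, h3, h4⟩, ⟨h5, h6, h7⟩, ⟨h8, h9⟩, h10⟩ := nd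
  have ad : ∀ i j, C.vin w i → C.vin w j → i ≠ j → ¬ (i = u ∧ j = v) → ¬ (i = v ∧ j = u) → C.adj i j := by
    intro i j vi vj hij n1 n2
    exact adj_of vi vj hij fun h => (hD i j h).elim n1 n2
  have Vu : C.vin w u := (hv u).mpr (by simp)
  have Vv : C.vin w v := (hv v).mpr (by simp)
  have Va : C.vin w a := (hv a).mpr (by simp)
  have Vb : C.vin w b := (hv b).mpr (by simp)
  have Vc : C.vin w c := (hv c).mpr (by simp)
  have ir := C.airr
  have A := two_in hs Vu Va (ad u a Vu Va h2 (by simp [Ne.symm h5]) (by simp [h1])) (p := b) (q := c) (by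
    intro m vm k1 k2
    rcases (hv m).mp vm with rfl | rfl | rfl | rfl | rfl <;>
    first | exact Or.inl rfl | exact Or.inr rfl | exact absurd k1 (ir _) | exact absurd k2 (ir _) | exact absurd k1 uv)
  have B := two_in hs Vu Vb (ad u b Vu Vb h3 (by simp [Ne.symm h6]) (by simp [h1])) (p := a) (q := c) (by
    intro m vm k1 k2
    rcases (hv m).mp vm with rfl | rfl | rfl | rfl | rfl <;>
    first | exact Or.inl rfl | exact Or.inr rfl | exact absurd k1 (ir _) | exact absurd k2 (ir _) | exact absurd k1 uv)
  have A' := two_in hs Vv Va (ad v a Vv Va h5 (by simp [Ne.symm h1]) (by simp [Ne.symm h2])) (p := b) (q := c) (by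
    intro m vm k1 k2
    rcases (hv m).mp vm with rfl | rfl | rfl | rfl | rfl <;>
    first | exact Or.inl rfl | exact Or.inr rfl | exact absurd k1 (ir _) | exact absurd k2 (ir _) | exact absurd k1 vu)
  have B' := two_in hs Vv Vb (ad v b Vv Vb h6 (by simp [Ne.symm h1]) (by simp [Ne.symm h3])) (p := a) (q := c) (by
    intro m vm k1 k2
    rcases (hv m).mp vm with rfl | rfl | rfl | rfl | rfl <;>
    first | exact Or.inl rfl | exact Or.inr rfl | exact absurd k1 (ir _) | exact absurd k2 (ir _) | exact absurd k1 vu)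
  refine ⟨nd', hN, uv, A.2.1, A.2.2, B.2.2, A'.2.1, A'.2.2, B'.2.2, fun h => ?_⟩
  exact three_no hs h (C.g_s2 (C.g_s1 A.2.1)) (C.g_s2 (C.g_s1 A'.2.1)) (Ne.symm h4) (Ne.symm h7) h1

theorem tmE : tm 31 = [7, 11, 13, 14, 19, 21, 22, 25, 26, 28] := by decide +kernel

theorem BipAt.isBip {w : W} (hs : C.Simp w) {u v a b c : I} (h : BipAt C w u v a b c) : IsBip C.Bl (C.N w) := by
  have nd := h.nd
  simp only [List.nodup_cons, List.mem_cons, not_or, List.not_mem_nil, List.nodup_nil, not_false_eq_true, and_true] at nd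
  obtain ⟨⟨h1, h2, h3, h4⟩, ⟨h5, h6, h7⟩, ⟨h8, h9⟩, h10⟩ := nd
  have hv : ∀ m, C.vin w m ↔ m = u ∨ m = v ∨ m = a ∨ m = b ∨ m = c := by
    intro m; rw [← C.mem_N, h.N]; simp
  refine ⟨{u, v}, {a, b, c}, card_pair h1, by simp [h8, h9, h10], ?_, ?_, ?_, ?_, ?_⟩
  · simp [h2, h3, h4, h5, h6, h7]
    simp [Ne.symm h2, Ne.symm h3, Ne.symm h4, Ne.symm h5, Ne.symm h6, Ne.symm h7]
  · rw [h.N]; ext x; simp only [mem_insert, mem_union, mem_singleton, or_assoc]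
  · exact na_excl hs h1 ((hv u).mpr (by simp)) ((hv v).mpr (by simp)) h.uv
  · exact g_excl hs h8 h9 h10 ((hv a).mpr (by simp)) ((hv b).mpr (by simp)) ((hv c).mpr (by simp)) h.ng
  · intro T hT h3 hU hA
    have hi : Set.InjOn (mk6 u v a b c c) {i | i < 5} := by
      intro i hi j hj e
      simp only [Set.mem_ofPred_eq] at hi hj
      have h' : ∀ k < 5, [u, v, a, b, c][k]? = some (mk6 u v a b c c k) := by
        intro k hk; interval_cases k <;> rfl
      have h1 := h' i hi
      have h2 := h' j hj
      rw [e, ← h2] at h1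
      exact (List.getElem?_inj (by simpa using hi) h.nd).mp h1
    have hN : C.N w = im (mk6 u v a b c c) 31 := by
      rw [h.N, im, show ms 31 = {0, 1, 2, 3, 4} by decide]; simp [image_insert, mk6]
    rw [hN] at hT
    obtain ⟨t, ht, rfl⟩ := tm_of (by norm_num) hi (by norm_num) hT h3
    rw [tmE] at ht
    simp only [List.mem_cons, List.not_mem_nil, or_false] at ht
    rcases ht with rfl | rfl | rfl | rfl | rfl | rfl | rfl | rfl | rfl | rfl
    · rw [im_three _ (show ms 7 = {0, 1, 2} by decide)] at hU; simp [mk6] at hU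
    · rw [im_three _ (show ms 11 = {0, 1, 3} by decide)] at hU; simp [mk6] at hU
    · rw [im_three _ (show ms 13 = {0, 2, 3} by decide)]; exact C.g_good h.g1
    · rw [im_three _ (show ms 14 = {1, 2, 3} by decide)]; exact C.g_good h.g4
    · rw [im_three _ (show ms 19 = {0, 1, 4} by decide)] at hU; simp [mk6] at hU
    · rw [im_three _ (show ms 21 = {0, 2, 4} by decide)]; exact C.g_good h.g2
    · rw [im_three _ (show ms 22 = {1, 2, 4} by decide)]; exact C.g_good h.g5
    · rw [im_three _ (show ms 25 = {0, 3, 4} by decide)]; exact C.g_good h.g3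
    · rw [im_three _ (show ms 26 = {1, 3, 4} by decide)]; exact C.g_good h.g6
    · rw [im_three _ (show ms 28 = {2, 3, 4} by decide)] at hA; exact absurd rfl hA

theorem bip_ex {w : W} (hs : C.Simp w) (h5 : (C.N w).card = 5) (hr : C.r2 w = 18) : ∃ u v a b c, BipAt C w u v a b c := by
  have hD := C.D_card w
  rw [h5, hr] at hD
  have hD2 : (C.D w).card = 0 + 2 := by omega
  obtain ⟨⟨u, v⟩, huv⟩ : (C.D w).Nonempty := by rw [← card_pos]; omega
  obtain ⟨S, -, S0, hS, -, -⟩ := peel (C.D_sym w) hD2 huv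
  have m := mem_D.mp huv
  have hsub : ({u, v} : Finset I) ⊆ C.N w := by
    intro x hx
    simp only [mem_insert, mem_singleton] at hx
    rcases hx with rfl | rfl
    exacts [C.mem_N.mpr m.2.1, C.mem_N.mpr m.2.2]
  have hc : (C.N w \ {u, v}).card = 3 := by rw [card_sdiff_of_subset hsub, h5, card_pair m.1.1]
  obtain ⟨a, b, c, ab, ac, bc, e⟩ := card_eq_three.mp hc
  have o : ∀ x ∈ ({a, b, c} : Finset I), x ≠ u ∧ x ≠ v := by
    intro x hx; rw [← e] at hx; simpa using (mem_sdiff.mp hx).2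
  have oa := o a (by simp)
  have ob := o b (by simp)
  have oc := o c (by simp)
  refine ⟨u, v, a, b, c, bipAt hs ?_ ?_ m.1.2 ?_⟩
  · simp [m.1.1, ab, ac, bc, oa.1.symm, oa.2.symm, ob.1.symm, ob.2.symm, oc.1.symm, oc.2.symm]
  · rw [← union_sdiff_of_subset hsub, e]; ext x; simp only [mem_insert, mem_union, mem_singleton, or_assoc]
  · intro i j hij
    rcases (hS i j).mp hij with h | h | h
    · exact Or.inl h
    · exact Or.inr h
    · exact absurd h (D_empty (w := w) S0 i j)

theorem isBip {w : W} (hs : C.Simp w) (h5 : (C.N w).card = 5) (hr : C.r2 w = 18) : IsBip C.Bl (C.N w) := by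
  obtain ⟨u, v, a, b, c, h⟩ := bip_ex hs h5 hr
  exact h.isBip hs
end Conf
end PS

namespace PS
set_option linter.unusedSectionVars false
open Module
namespace Conf
open Finset
variable {E W Ed I : Type} [AddCommGroup E] [Module ℝ E] {C : Conf E W Ed I} [Fintype W] [Fintype Ed] [Fintype I] [DecidableEq I]

theorem init (h12 : C.Bl.card = 12) {φ : ℕ → I} {k : ℕ} (hk : k ≤ 6) (hφ : Set.InjOn φ {i | i < k}) {B F O : List ℕ} {r : ℕ}
    (hlt : ∀ m ∈ B ++ F ++ O, m < 2 ^ k) (hnd : B.Nodup)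
    (hB : ∀ m ∈ B, ∃ w, im φ m = C.N w)
    (hF : ∀ f ∈ F, ∀ w, im φ f ⊆ C.N w → ∃ m ∈ B, C.N w = im φ m)
    (O3 : ∀ t ∈ O, (ms t).card = 3)
    (hO : ∀ t ∈ O, ∃ m ∈ B, im φ t ⊆ im φ m ∧ ∃ b ∈ C.Bl, Out φ B b ∧ im φ t ⊆ b ∧ ∀ c ∈ C.Bl, im φ t ⊆ c → c = im φ m ∨ c = b)
    (hcov : ∀ m ∈ B, ∀ t ∈ tm m, t ∈ O ∨ ∃ f ∈ F, subb f t = true)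
    (hrem : Set.ncard {b | b ∈ C.Bl ∧ b.card = 4 ∧ Out φ B b} ≤ r)
    (hty : ∀ w, Out φ B (C.N w) → IsBip C.Bl (C.N w) ∨ IsTet C.Bl (C.N w)) : Sat C.Bl ⟨B, F, O, 2 ^ k, r⟩ := by
  have hBm : ∀ m ∈ B, im φ m ∈ C.Bl := fun m hm => by
    obtain ⟨w, h⟩ := hB m hm; rw [h]; exact C.N_mem w
  have Blt : ∀ m ∈ B, m < 2 ^ k := fun m hm => hlt m (by simp [hm])
  have Olt : ∀ m ∈ O, m < 2 ^ k := fun m hm => hlt m (by simp [hm])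
  refine ⟨φ, ⟨⟨k, by omega, rfl, hφ⟩, Blt, fun m hm => hlt m (by simp [List.mem_append, show m ∈ F from hm]), Olt, hBm, ?_, ?_, hO, hrem, ?_, ?_, ?_⟩⟩
  · intro f hf b hb hs ho
    obtain ⟨w, rfl⟩ := C.mem_Bl.mp hb
    obtain ⟨m, hm, e⟩ := hF f hf w hs
    exact ho m hm e
  · intro t ht
    rw [im_card hφ (Olt t ht)]; exact O3 t ht
  · intro b hb ho
    obtain ⟨w, rfl⟩ := C.mem_Bl.mp hb
    exact hty w ho
  · have e : {b | b ∈ C.Bl ∧ Out φ B b} = ((C.Bl \ (B.map (im φ)).toFinset : Finset (Finset I)) : Set (Finset I)) := by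
      ext b
      simp only [Set.mem_ofPred_eq, mem_coe, mem_sdiff, List.mem_toFinset, List.mem_map, not_exists, not_and, Out]
      constructor
      · rintro ⟨h, h2⟩; exact ⟨h, fun x hx e => h2 x hx e.symm⟩
      · rintro ⟨h, h2⟩; exact ⟨h, fun x hx e => h2 x hx e.symm⟩
    have hnd2 : (B.map (im φ)).Nodup := by
      apply List.Nodup.map_on _ hnd
      intro x hx y hy e
      exact im_inj (by omega) hφ (Blt x hx) (Blt y hy) e
    have hsub : (B.map (im φ)).toFinset ⊆ C.Bl := by
      intro x hx
      simp only [List.mem_toFinset, List.mem_map] at hx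
      obtain ⟨m, hm, rfl⟩ := hx
      exact hBm m hm
    show Set.ncard {b | b ∈ C.Bl ∧ Out φ B b} + B.length ≤ 12
    have hl := card_le_card hsub
    rw [e, Set.ncard_coe_finset, card_sdiff_of_subset hsub, h12]
    rw [List.toFinset_card_of_nodup hnd2, List.length_map] at hl ⊢
    omega
  · intro m hm b hb ho T hTb h3 hT
    obtain ⟨t, ht, rfl⟩ := tm_of hk hφ (Blt m hm) hT h3
    rcases hcov m hm t ht with h | ⟨f, hf, hft⟩
    · exact ⟨t, h, rfl⟩
    · exfalso
      obtain ⟨w, rfl⟩ := C.mem_Bl.mp hb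
      obtain ⟨m', hm', e⟩ := hF f hf w ((image_subset_image (subb_ms hft)).trans hTb)
      exact ho m' hm' e

/-- version with a single block -/
theorem init1 (h12 : C.Bl.card = 12) {φ : ℕ → I} {k : ℕ} (hk : k ≤ 6) (hφ : Set.InjOn φ {i | i < k}) {m : ℕ} {F O : List ℕ} {r : ℕ} {w : W}
    (hlt : ∀ x ∈ m :: (F ++ O), x < 2 ^ k) (hB : im φ m = C.N w)
    (hF : ∀ f ∈ F, Excl C.Bl (im φ f) (C.N w)) (O3 : ∀ t ∈ O, (ms t).card = 3)
    (hO : ∀ t ∈ O, im φ t ⊆ im φ m ∧ Good C.Bl (im φ t) (C.N w))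
    (hcov : ∀ t ∈ tm m, t ∈ O ∨ ∃ f ∈ F, subb f t = true)
    (hrem : Set.ncard {b | b ∈ C.Bl ∧ b.card = 4 ∧ b ≠ C.N w} ≤ r)
    (hty : ∀ u, u ≠ w → IsBip C.Bl (C.N u) ∨ IsTet C.Bl (C.N u)) : Sat C.Bl ⟨[m], F, O, 2 ^ k, r⟩ := by
  have ho : ∀ b, Out φ [m] b ↔ b ≠ C.N w := by
    intro b; simp [Out, hB]
  refine init h12 hk hφ (by simpa using hlt) (by simp) (fun x hx => ?_) ?_ O3 ?_ ?_ ?_ ?_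
  · rw [List.mem_singleton.mp hx]; exact ⟨w, hB⟩
  · intro f hf u hu
    exact ⟨m, by simp, by rw [hB]; exact hF f hf _ (C.N_mem u) hu⟩
  · intro t ht
    obtain ⟨h1, b, hb, hbw, hs, hc⟩ := hO t ht
    refine ⟨m, by simp, h1, b, hb, (ho b).mpr hbw, hs, ?_⟩
    rw [hB]; exact hc
  · intro x hx
    rw [List.mem_singleton.mp hx]; exact hcov
  · simp only [ho]; exact hrem
  · intro u hu
    exact hty u fun e => (ho _).mp hu (by rw [e])

theorem satA (h12 : C.Bl.card = 12) (hs : ∀ w, C.Simp w) (hr : ∀ w, C.r2 w + 12 = 6 * (C.N w).card) {w4 : W} (h4 : (C.N w4).card = 4)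
    (h5 : ∀ w, w ≠ w4 → (C.N w).card = 5) : Sat C.Bl sA := by
  have ht := isTet (hs w4) h4 (by have := hr w4; omega)
  obtain ⟨a, b, c, d, ab, ac, ad, bc, bd, cd, e⟩ := card_eq_four.mp h4
  have hi : Set.InjOn (mk6 a b c d d d) {i | i < 4} := by
    intro i hi j hj e
    simp only [Set.mem_ofPred_eq] at hi hj
    interval_cases i <;> interval_cases j <;> simp_all [mk6]
  have hB : im (mk6 a b c d d d) 15 = C.N w4 := by
    rw [e, im, show ms 15 = {0, 1, 2, 3} by decide]; simp [image_insert, mk6]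
  apply init1 (k := 4) h12 (by norm_num) hi (by decide) hB ?_ (by decide) ?_ (by decide +kernel) ?_ ?_
  · intro f hf
    rw [List.mem_singleton.mp hf, hB]; exact ht.2.1
  · intro t h
    have l : ∀ t ∈ [7, 11, 13, 14], t < 2 ^ 4 ∧ (ms t).card = 3 ∧ ms t ⊆ ms 15 := by decide
    obtain ⟨l1, l2, l3⟩ := l t h
    have : im (mk6 a b c d d d) t ⊆ im (mk6 a b c d d d) 15 := image_subset_image l3
    refine ⟨this, ht.2.2 _ (by rw [← hB]; exact this) ?_⟩
    rw [im_card hi l1, l2]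
  · rw [Nat.le_zero, Set.ncard_eq_zero]
    ext x
    simp only [Set.mem_ofPred_eq, Set.mem_empty_iff_false, iff_false, not_and, not_not]
    intro hx hc
    obtain ⟨u, rfl⟩ := C.mem_Bl.mp hx
    by_contra hne
    have := h5 u (fun e => hne (by rw [e])); omega
  · intro u hu
    exact Or.inl (isBip (hs u) (h5 u hu) (by have := hr u; have := h5 u hu; omega))

structure Six (C : Conf E W Ed I) (w6 w4 w4' : W) : Prop where
  hs : ∀ w, C.Simp w
  hr : ∀ w, C.r2 w + 12 = 6 * (C.N w).card
  n : w4 ≠ w4'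
  h6 : (C.N w6).card = 6
  h4 : (C.N w4).card = 4
  h4' : (C.N w4').card = 4
  h5 : ∀ w, w ≠ w6 → w ≠ w4 → w ≠ w4' → (C.N w).card = 5

theorem Six.rem {w6 w4 w4' : W} (h : Six C w6 w4 w4') : Set.ncard {b | b ∈ C.Bl ∧ b.card = 4 ∧ b ≠ C.N w6} ≤ 2 := by
  have : {b | b ∈ C.Bl ∧ b.card = 4 ∧ b ≠ C.N w6} ⊆ (({C.N w4, C.N w4'} : Finset (Finset I)) : Set (Finset I)) := by
    rintro b ⟨hb, hc, hn⟩
    obtain ⟨u, rfl⟩ := C.mem_Bl.mp hb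
    simp only [coe_insert, coe_singleton, Set.mem_insert_iff, Set.mem_singleton_iff]
    by_contra hcon
    push Not at hcon
    have := h.h5 u (fun e => hn (by rw [e])) (fun e => hcon.1 (by rw [e])) (fun e => hcon.2 (by rw [e]))
    omega
  refine (Set.ncard_le_ncard this (finite_toSet _)).trans ?_
  rw [Set.ncard_coe_finset]
  exact card_le_two

theorem Six.ty {w6 w4 w4' : W} (h : Six C w6 w4 w4') : ∀ u, u ≠ w6 → IsBip C.Bl (C.N u) ∨ IsTet C.Bl (C.N u) := by
  intro u hu
  have hr := h.hr u
  by_cases h1 : u = w4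
  · right; rw [h1] at hr ⊢; exact isTet (h.hs _) h.h4 (by have := h.h4; omega)
  by_cases h2 : u = w4'
  · right; rw [h2] at hr ⊢; exact isTet (h.hs _) h.h4' (by have := h.h4'; omega)
  have := h.h5 u hu h1 h2
  exact Or.inl (isBip (h.hs _) this (by omega))

theorem satO (h12 : C.Bl.card = 12) {w6 w4 w4' : W} (h : Six C w6 w4 w4') {x0 x1 x2 x3 x4 x5 : I} (nd : ([x0, x1, x2, x3, x4, x5] : List I).Nodup)
    (hN : C.N w6 = {x0, x1, x2, x3, x4, x5}) (n1 : ¬ C.adj x0 x1) (n2 : ¬ C.adj x2 x3) (n3 : ¬ C.adj x4 x5)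
    (hD : ∀ i j, C.vin w6 i → C.vin w6 j → i ≠ j → C.adj i j ∨ (i = x0 ∧ j = x1) ∨ (i = x1 ∧ j = x0) ∨ (i = x2 ∧ j = x3) ∨ (i = x3 ∧ j = x2) ∨ (i = x4 ∧ j = x5) ∨ (i = x5 ∧ j = x4)) : Sat C.Bl sO := by
  have hs := h.hs w6
  have hi := inj6 nd
  have hv : ∀ m, C.vin w6 m ↔ m = x0 ∨ m = x1 ∨ m = x2 ∨ m = x3 ∨ m = x4 ∨ m = x5 := by
    intro m; rw [← C.mem_N, hN]; simp
  have hB : im (mk6 x0 x1 x2 x3 x4 x5) 63 = C.N w6 := by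
    rw [hN, im, show ms 63 = {0, 1, 2, 3, 4, 5} by decide]; simp [image_insert, mk6]
  have n1' : ¬ C.adj x1 x0 := fun h => n1 (C.asymm _ _ h)
  have n2' : ¬ C.adj x3 x2 := fun h => n2 (C.asymm _ _ h)
  have n3' : ¬ C.adj x5 x4 := fun h => n3 (C.asymm _ _ h)
  have ir := C.airr
  simp only [List.nodup_cons, List.mem_cons, not_or, List.not_mem_nil, List.nodup_nil, not_false_eq_true, and_true] at nd
  obtain ⟨⟨h01, h02, h03, h04, h05⟩, ⟨h12', h13, h14, h15⟩, ⟨h23, h24, h25⟩, ⟨h34, h35⟩, h45⟩ := nd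
  have v0 : C.vin w6 x0 := (hv _).mpr (by simp)
  have v1 : C.vin w6 x1 := (hv _).mpr (by simp)
  have v2 : C.vin w6 x2 := (hv _).mpr (by simp)
  have v3 : C.vin w6 x3 := (hv _).mpr (by simp)
  have v4 : C.vin w6 x4 := (hv _).mpr (by simp)
  have v5 : C.vin w6 x5 := (hv _).mpr (by simp)
  have a02 : C.adj x0 x2 := (hD x0 x2 v0 v2 h02).resolve_right (by simp_all [eq_comm])
  have a03 : C.adj x0 x3 := (hD x0 x3 v0 v3 h03).resolve_right (by simp_all [eq_comm])
  have a12 : C.adj x1 x2 := (hD x1 x2 v1 v2 h12').resolve_right (by simp_all [eq_comm])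
  have a13 : C.adj x1 x3 := (hD x1 x3 v1 v3 h13).resolve_right (by simp_all [eq_comm])
  have g02 := two_in hs v0 v2 a02 (p := x4) (q := x5) (by
    intro m vm k1 k2
    rcases (hv m).mp vm with rfl | rfl | rfl | rfl | rfl | rfl <;>
    first | exact Or.inl rfl | exact Or.inr rfl | exact absurd k1 (ir _) | exact absurd k2 (ir _) | exact absurd k1 n1 | exact absurd k2 n2)
  have g03 := two_in hs v0 v3 a03 (p := x4) (q := x5) (by
    intro m vm k1 k2
    rcases (hv m).mp vm with rfl | rfl | rfl | rfl | rfl | rfl <;>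
    first | exact Or.inl rfl | exact Or.inr rfl | exact absurd k1 (ir _) | exact absurd k2 (ir _) | exact absurd k1 n1 | exact absurd k2 n2')
  have g12 := two_in hs v1 v2 a12 (p := x4) (q := x5) (by
    intro m vm k1 k2
    rcases (hv m).mp vm with rfl | rfl | rfl | rfl | rfl | rfl <;>
    first | exact Or.inl rfl | exact Or.inr rfl | exact absurd k1 (ir _) | exact absurd k2 (ir _) | exact absurd k1 n1' | exact absurd k2 n2)
  have g13 := two_in hs v1 v3 a13 (p := x4) (q := x5) (by
    intro m vm k1 k2
    rcases (hv m).mp vm with rfl | rfl | rfl | rfl | rfl | rfl <;>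
    first | exact Or.inl rfl | exact Or.inr rfl | exact absurd k1 (ir _) | exact absurd k2 (ir _) | exact absurd k1 n1' | exact absurd k2 n2')
  apply init1 (k := 6) h12 (by norm_num) hi (by decide) hB ?_ (by decide +kernel) ?_ (by decide +kernel) h.rem h.ty
  · intro f hf
    simp only [List.mem_cons, List.not_mem_nil, or_false] at hf
    rcases hf with rfl | rfl | rfl
    · rw [im_two _ (show ms 3 = {0, 1} by decide)]; exact na_excl hs h01 v0 v1 n1
    · rw [im_two _ (show ms 12 = {2, 3} by decide)]; exact na_excl hs h23 v2 v3 n2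
    · rw [im_two _ (show ms 48 = {4, 5} by decide)]; exact na_excl hs h45 v4 v5 n3
  · intro t ht
    have l : ∀ t ∈ [21, 37, 25, 41, 22, 38, 26, 42], ms t ⊆ ms 63 := by decide +kernel
    refine ⟨image_subset_image (l t ht), ?_⟩
    simp only [List.mem_cons, List.not_mem_nil, or_false] at ht
    rcases ht with rfl | rfl | rfl | rfl | rfl | rfl | rfl | rfl
    · rw [im_three _ (show ms 21 = {0, 2, 4} by decide)]; exact C.g_good g02.2.1
    · rw [im_three _ (show ms 37 = {0, 2, 5} by decide)]; exact C.g_good g02.2.2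
    · rw [im_three _ (show ms 25 = {0, 3, 4} by decide)]; exact C.g_good g03.2.1
    · rw [im_three _ (show ms 41 = {0, 3, 5} by decide)]; exact C.g_good g03.2.2
    · rw [im_three _ (show ms 22 = {1, 2, 4} by decide)]; exact C.g_good g12.2.1
    · rw [im_three _ (show ms 38 = {1, 2, 5} by decide)]; exact C.g_good g12.2.2
    · rw [im_three _ (show ms 26 = {1, 3, 4} by decide)]; exact C.g_good g13.2.1
    · rw [im_three _ (show ms 42 = {1, 3, 5} by decide)]; exact C.g_good g13.2.2

theorem satP (h12 : C.Bl.card = 12) {w6 w4 w4' : W} (h : Six C w6 w4 w4') {x0 x1 x2 x3 x4 x5 : I} (nd : ([x0, x1, x2, x3, x4, x5] : List I).Nodup)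
    (hN : C.N w6 = {x0, x1, x2, x3, x4, x5}) (n1 : ¬ C.adj x0 x1) (n2 : ¬ C.adj x1 x2) (n3 : ¬ C.adj x2 x3)
    (hD : ∀ i j, C.vin w6 i → C.vin w6 j → i ≠ j → C.adj i j ∨ (i = x0 ∧ j = x1) ∨ (i = x1 ∧ j = x0) ∨ (i = x1 ∧ j = x2) ∨ (i = x2 ∧ j = x1) ∨ (i = x2 ∧ j = x3) ∨ (i = x3 ∧ j = x2)) : Sat C.Bl sP := by
  have hs := h.hs w6
  have hi := inj6 nd
  have hv : ∀ m, C.vin w6 m ↔ m = x0 ∨ m = x1 ∨ m = x2 ∨ m = x3 ∨ m = x4 ∨ m = x5 := by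
    intro m; rw [← C.mem_N, hN]; simp
  have hB : im (mk6 x0 x1 x2 x3 x4 x5) 63 = C.N w6 := by
    rw [hN, im, show ms 63 = {0, 1, 2, 3, 4, 5} by decide]; simp [image_insert, mk6]
  have n1' : ¬ C.adj x1 x0 := fun h => n1 (C.asymm _ _ h)
  have n2' : ¬ C.adj x2 x1 := fun h => n2 (C.asymm _ _ h)
  have n3' : ¬ C.adj x3 x2 := fun h => n3 (C.asymm _ _ h)
  have ir := C.airr
  simp only [List.nodup_cons, List.mem_cons, not_or, List.not_mem_nil, List.nodup_nil, not_false_eq_true, and_true] at nd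
  obtain ⟨⟨h01, h02, h03, h04, h05⟩, ⟨h12', h13, h14, h15⟩, ⟨h23, h24, h25⟩, ⟨h34, h35⟩, h45⟩ := nd
  have v0 : C.vin w6 x0 := (hv _).mpr (by simp)
  have v1 : C.vin w6 x1 := (hv _).mpr (by simp)
  have v2 : C.vin w6 x2 := (hv _).mpr (by simp)
  have v3 : C.vin w6 x3 := (hv _).mpr (by simp)
  have v4 : C.vin w6 x4 := (hv _).mpr (by simp)
  have v5 : C.vin w6 x5 := (hv _).mpr (by simp)
  have a13 : C.adj x1 x3 := (hD x1 x3 v1 v3 h13).resolve_right (by simp_all [eq_comm])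
  have a14 : C.adj x1 x4 := (hD x1 x4 v1 v4 h14).resolve_right (by simp_all [eq_comm])
  have a02 : C.adj x0 x2 := (hD x0 x2 v0 v2 h02).resolve_right (by simp_all [eq_comm])
  have a03 : C.adj x0 x3 := (hD x0 x3 v0 v3 h03).resolve_right (by simp_all [eq_comm])
  have a24 : C.adj x2 x4 := (hD x2 x4 v2 v4 h24).resolve_right (by simp_all [eq_comm])
  have g13 := two_in hs v1 v3 a13 (p := x4) (q := x5) (by
    intro m vm k1 k2
    rcases (hv m).mp vm with rfl | rfl | rfl | rfl | rfl | rfl <;>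
    first | exact Or.inl rfl | exact Or.inr rfl | exact absurd k1 (ir _) | exact absurd k2 (ir _) | exact absurd k1 n1' | exact absurd k1 n2)
  have g14 := two_in hs v1 v4 a14 (p := x3) (q := x5) (by
    intro m vm k1 k2
    rcases (hv m).mp vm with rfl | rfl | rfl | rfl | rfl | rfl <;>
    first | exact Or.inl rfl | exact Or.inr rfl | exact absurd k1 (ir _) | exact absurd k2 (ir _) | exact absurd k1 n1' | exact absurd k1 n2)
  have g02 := two_in hs v0 v2 a02 (p := x4) (q := x5) (by
    intro m vm k1 k2
    rcases (hv m).mp vm with rfl | rfl | rfl | rfl | rfl | rfl <;>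
    first | exact Or.inl rfl | exact Or.inr rfl | exact absurd k1 (ir _) | exact absurd k2 (ir _) | exact absurd k1 n1 | exact absurd k2 n3)
  have g24 := two_in hs v2 v4 a24 (p := x0) (q := x5) (by
    intro m vm k1 k2
    rcases (hv m).mp vm with rfl | rfl | rfl | rfl | rfl | rfl <;>
    first | exact Or.inl rfl | exact Or.inr rfl | exact absurd k1 (ir _) | exact absurd k2 (ir _) | exact absurd k1 n2' | exact absurd k1 n3)
  have g03 := two_in hs v0 v3 a03 (p := x4) (q := x5) (by
    intro m vm k1 k2
    rcases (hv m).mp vm with rfl | rfl | rfl | rfl | rfl | rfl <;>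
    first | exact Or.inl rfl | exact Or.inr rfl | exact absurd k1 (ir _) | exact absurd k2 (ir _) | exact absurd k1 n1 | exact absurd k2 n3')
  have q1 : C.g w6 x4 x5 x1 := C.g_s2 (C.g_s1 g14.2.2)
  have q2 : C.g w6 x4 x5 x2 := C.g_s2 (C.g_s1 g24.2.2)
  apply init1 (k := 6) h12 (by norm_num) hi (by decide) hB ?_ (by decide +kernel) ?_ (by decide +kernel) h.rem h.ty
  · intro f hf
    simp only [List.mem_cons, List.not_mem_nil, or_false] at hf
    rcases hf with rfl | rfl | rfl | rfl | rfl
    · rw [im_two _ (show ms 3 = {0, 1} by decide)]; exact na_excl hs h01 v0 v1 n1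
    · rw [im_two _ (show ms 6 = {1, 2} by decide)]; exact na_excl hs h12' v1 v2 n2
    · rw [im_two _ (show ms 12 = {2, 3} by decide)]; exact na_excl hs h23 v2 v3 n3
    · rw [im_three _ (show ms 49 = {0, 4, 5} by decide)]
      exact g_excl hs h04 h05 h45 v0 v4 v5 fun hg => three_no hs q1 q2 (C.g_s2 (C.g_s1 hg)) h12' (Ne.symm h01) (Ne.symm h02)
    · rw [im_three _ (show ms 56 = {3, 4, 5} by decide)]
      exact g_excl hs h34 h35 h45 v3 v4 v5 fun hg => three_no hs q1 q2 (C.g_s2 (C.g_s1 hg)) h12' h13 h23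
  · intro t ht
    have l : ∀ t ∈ [21, 37, 52, 25, 41, 26, 42, 50], ms t ⊆ ms 63 := by decide +kernel
    refine ⟨image_subset_image (l t ht), ?_⟩
    simp only [List.mem_cons, List.not_mem_nil, or_false] at ht
    rcases ht with rfl | rfl | rfl | rfl | rfl | rfl | rfl | rfl
    · rw [im_three _ (show ms 21 = {0, 2, 4} by decide)]; exact C.g_good g02.2.1
    · rw [im_three _ (show ms 37 = {0, 2, 5} by decide)]; exact C.g_good g02.2.2
    · rw [im_three _ (show ms 52 = {2, 4, 5} by decide)]; exact C.g_good g24.2.2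
    · rw [im_three _ (show ms 25 = {0, 3, 4} by decide)]; exact C.g_good g03.2.1
    · rw [im_three _ (show ms 41 = {0, 3, 5} by decide)]; exact C.g_good g03.2.2
    · rw [im_three _ (show ms 26 = {1, 3, 4} by decide)]; exact C.g_good g13.2.1
    · rw [im_three _ (show ms 42 = {1, 3, 5} by decide)]; exact C.g_good g13.2.2
    · rw [im_three _ (show ms 50 = {1, 4, 5} by decide)]; exact C.g_good g14.2.2
end Conf
end PS

namespace PS
set_option linter.unusedSectionVars false
open Module
namespace Conf
open Finset
variable {E W Ed I : Type} [AddCommGroup E] [Module ℝ E] {C : Conf E W Ed I} [Fintype W] [Fintype Ed] [Fintype I] [DecidableEq I]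

theorem vin_iff {w : W} {S : Finset I} (hN : C.N w = S) (m : I) : C.vin w m ↔ m ∈ S := by rw [← C.mem_N, hN]

theorem six_path (h12 : C.Bl.card = 12) {w6 w4 w4' : W} (h : Six C w6 w4 w4') {x y z : I} (hxz : x ≠ z)
    (hyx : (y, x) ∈ C.D w6) (hyz : (y, z) ∈ C.D w6) : Sat C.Bl sP := by
  have hs := h.hs w6
  have hD := C.D_card w6
  have h6 := h.h6
  have hr := h.hr w6
  rw [h6] at hD hr
  have hD6 : (C.D w6).card = 4 + 2 := by omega
  obtain ⟨S, sS, cS, iS, u1, u2⟩ := peel (C.D_sym w6) hD6 hyx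
  have mx := mem_D.mp hyx
  have mz := mem_D.mp hyz
  have hyz' : (y, z) ∈ S := by
    rcases (iS y z).mp hyz with e | e | e
    · exact absurd e.2.symm hxz
    · exact absurd e.1 mx.1.1
    · exact e
  obtain ⟨S', sS', cS', iS', u3, u4⟩ := peel sS (n := 2) cS hyz'
  obtain ⟨⟨e, f⟩, hef⟩ : S'.Nonempty := by rw [← card_pos]; omega
  obtain ⟨S'', -, c0, iS'', -, -⟩ := peel sS' (n := 0) cS' hef
  have hD' : ∀ i j, C.vin w6 i → C.vin w6 j → i ≠ j → C.adj i j ∨ (i = y ∧ j = x) ∨ (i = x ∧ j = y) ∨ (i = y ∧ j = z) ∨ (i = z ∧ j = y) ∨ (i = e ∧ j = f) ∨ (i = f ∧ j = e) := by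
    intro i j vi vj hij
    by_cases ha : C.adj i j
    · exact Or.inl ha
    right
    rcases (iS i j).mp (mem_D.mpr ⟨⟨hij, ha⟩, vi, vj⟩) with e | e | e
    · simp [e]
    · simp [e]
    rcases (iS' i j).mp e with e | e | e
    · simp [e]
    · simp [e]
    rcases (iS'' i j).mp e with e | e | e
    · simp [e]
    · simp [e]
    exact absurd e (D_empty (w := w6) c0 i j)
  have f1 : ¬ (e = y ∧ f = x) := by
    rintro ⟨rfl, rfl⟩; exact u1 ((iS' _ _).mpr (Or.inr (Or.inr hef)))
  have f2 : ¬ (e = x ∧ f = y) := by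
    rintro ⟨rfl, rfl⟩; exact u2 ((iS' _ _).mpr (Or.inr (Or.inr hef)))
  have f3 : ¬ (e = y ∧ f = z) := by
    rintro ⟨rfl, rfl⟩; exact u3 hef
  have f4 : ¬ (e = z ∧ f = y) := by
    rintro ⟨rfl, rfl⟩; exact u4 hef
  have hefD : (e, f) ∈ C.D w6 := (iS e f).mpr (Or.inr (Or.inr ((iS' e f).mpr (Or.inr (Or.inr hef)))))
  have mef := mem_D.mp hefD
  have hsub : ({y, x, z} : Finset I) ⊆ C.N w6 := by
    intro m hm
    simp only [mem_insert, mem_singleton] at hm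
    rcases hm with rfl | rfl | rfl
    exacts [C.mem_N.mpr mx.2.1, C.mem_N.mpr mx.2.2, C.mem_N.mpr mz.2.2]
  have hc3 : ({y, x, z} : Finset I).card = 3 := by simp [mx.1.1, mz.1.1, hxz]
  have hc : (C.N w6 \ {y, x, z}).card = 3 := by rw [card_sdiff_of_subset hsub, h6, hc3]
  obtain ⟨p, q, r, pq, pr, qr, ee⟩ := card_eq_three.mp hc
  have hN : C.N w6 = {y, x, z, p, q, r} := by
    rw [← union_sdiff_of_subset hsub, ee]; ext x; simp only [mem_insert, mem_union, mem_singleton, or_assoc]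
  have o : ∀ m ∈ ({p, q, r} : Finset I), m ≠ y ∧ m ≠ x ∧ m ≠ z := by
    intro m hm; rw [← ee] at hm; simpa using (mem_sdiff.mp hm).2
  have op := o p (by simp)
  have oq := o q (by simp)
  have or' := o r (by simp)
  have hv : ∀ m, C.vin w6 m ↔ m = y ∨ m = x ∨ m = z ∨ m = p ∨ m = q ∨ m = r := by
    intro m; rw [← C.mem_N, hN]; simp
  have vx := mx.2.2
  have vy := mx.2.1
  have vz := mz.2.2
  have vp : C.vin w6 p := (hv _).mpr (by simp)
  have vq : C.vin w6 q := (hv _).mpr (by simp)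
  have vr : C.vin w6 r := (hv _).mpr (by simp)
  have ir := C.airr
  have nyx := mx.1.2
  have nyz := mz.1.2
  have nxy : ¬ C.adj x y := fun h => nyx (C.asymm _ _ h)
  have nzy : ¬ C.adj z y := fun h => nyz (C.asymm _ _ h)
  -- neighbours of y
  obtain ⟨m, vm, am⟩ : ∃ m, C.vin w6 m ∧ C.adj y m := by
    by_contra hcon
    push Not at hcon
    have k1 := (hD' y p vy vp op.1.symm).resolve_left (hcon p vp)
    have k2 := (hD' y q vy vq oq.1.symm).resolve_left (hcon q vq)
    grind
  have inpqr : ∀ m, C.vin w6 m → C.adj y m → m = p ∨ m = q ∨ m = r := by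
    intro m vm am
    rcases (hv m).mp vm with rfl | rfl | rfl | rfl | rfl | rfl
    · exact absurd am (ir _)
    · exact absurd am nyx
    · exact absurd am nyz
    · simp
    · simp
    · simp
  obtain ⟨k, l, hkl, hg⟩ := thirds hs vy vm am
  have gk := (hg k).mpr (Or.inl rfl)
  have gl := (hg l).mpr (Or.inr rfl)
  have ak := C.g_adj (C.g_s2 gk)
  have al := C.g_adj (C.g_s2 gl)
  have mk := gk.2.2.1
  have ml := gl.2.2.1
  have i1 := inpqr m vm am
  have i2 := inpqr k (C.g_vin gk) ak
  have i3 := inpqr l (C.g_vin gl) al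
  have ayp : C.adj y p := by grind
  have ayq : C.adj y q := by grind
  clear i1 i2 i3 ak al mk ml gk gl hg hkl am vm
  have g1 := two_in hs vy vp ayp (p := q) (q := r) (by
    intro m vm k1 k2
    rcases inpqr m vm k1 with rfl | rfl | rfl
    · exact absurd k2 (ir _)
    · simp
    · simp)
  have g2 := two_in hs vy vq ayq (p := p) (q := r) (by
    intro m vm k1 k2
    rcases inpqr m vm k1 with rfl | rfl | rfl
    · simp
    · exact absurd k2 (ir _)
    · simp)
  have apq : C.adj p q := C.g_adj (C.g_s2 (C.g_s1 g1.2.1))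
  have apr : C.adj p r := by
    have := g1.2.2; exact C.g_adj (C.g_s2 (C.g_s1 this))
  have aqr : C.adj q r := by
    have := g2.2.2; exact C.g_adj (C.g_s2 (C.g_s1 this))
  have ayr : C.adj y r := C.g_adj (C.g_s2 g1.2.2)
  have key : ∀ X Z P Q R : I, (X = x ∧ Z = z ∨ X = z ∧ Z = x) → (P = p ∧ Q = q ∧ R = r ∨ P = q ∧ Q = p ∧ R = r ∨ P = r ∧ Q = p ∧ R = q) →
      (e = X ∧ f = P ∨ e = P ∧ f = X) → Sat C.Bl sP := by
    intro X Z P Q R h1 h2 h3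
    have hN' : C.N w6 = {Z, y, X, P, Q, R} := by
      rw [hN]; ext t; simp only [mem_insert, mem_singleton]; clear hD'; grind
    have nZ : ¬ C.adj Z y := by rcases h1 with h1 | h1 <;> rw [h1.2] <;> assumption
    have nX : ¬ C.adj y X := by rcases h1 with h1 | h1 <;> rw [h1.1] <;> assumption
    have nP : ¬ C.adj X P := by
      intro hh
      rcases h3 with ⟨rfl, rfl⟩ | ⟨rfl, rfl⟩
      · exact mef.1.2 hh
      · exact mef.1.2 (C.asymm _ _ hh)
    have yx := mx.1.1
    have yz := mz.1.1
    have nd' : ([Z, y, X, P, Q, R] : List I).Nodup := by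
      simp only [List.nodup_cons, List.mem_cons, not_or, List.not_mem_nil, List.nodup_nil, not_false_eq_true, and_true]
      clear hD'
      rcases h1 with ⟨rfl, rfl⟩ | ⟨rfl, rfl⟩ <;> rcases h2 with ⟨rfl, rfl, rfl⟩ | ⟨rfl, rfl, rfl⟩ | ⟨rfl, rfl, rfl⟩ <;> grind
    refine satP h12 h nd' hN' nZ nX nP fun i j vi vj hij => ?_
    rcases hD' i j vi vj hij with t | t | t | t | t | t | t
    · exact Or.inl t
    all_goals right
    all_goals rcases h1 with ⟨rfl, rfl⟩ | ⟨rfl, rfl⟩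
    all_goals first
      | (simp [t]; done)
      | (rcases h3 with ⟨rfl, rfl⟩ | ⟨rfl, rfl⟩ <;> simp [t])
  have nxz : ¬ (e = x ∧ f = z ∨ e = z ∧ f = x) := by
    intro hxz'
    have hD2 : ∀ i j, C.vin w6 i → C.vin w6 j → i ≠ j → (i = x ∨ i = z) → (j = p ∨ j = q ∨ j = r) → C.adj i j := by
      intro i j vi vj hij h1 h2
      rcases hD' i j vi vj hij with t | t
      · exact t
      · clear hD'; grind
    have nn : ¬ C.adj x z ∧ ¬ C.adj z x := by
      rcases hxz' with ⟨rfl, rfl⟩ | ⟨rfl, rfl⟩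
      · exact ⟨mef.1.2, fun hh => mef.1.2 (C.asymm _ _ hh)⟩
      · exact ⟨fun hh => mef.1.2 (C.asymm _ _ hh), mef.1.2⟩
    have k1 := two_in hs vx vp (hD2 x p vx vp op.2.1.symm (Or.inl rfl) (Or.inl rfl)) (p := q) (q := r) (by
      intro m vm k1 k2
      rcases (hv m).mp vm with rfl | rfl | rfl | rfl | rfl | rfl <;>
      first | exact Or.inl rfl | exact Or.inr rfl | exact absurd k1 (ir _) | exact absurd k2 (ir _) | exact absurd k1 nxy | exact absurd k1 nn.1)
    have k2 := two_in hs vz vp (hD2 z p vz vp op.2.2.symm (Or.inr rfl) (Or.inl rfl)) (p := q) (q := r) (by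
      intro m vm t1 t2
      rcases (hv m).mp vm with rfl | rfl | rfl | rfl | rfl | rfl <;>
      first | exact Or.inl rfl | exact Or.inr rfl | exact absurd t1 (ir _) | exact absurd t2 (ir _) | exact absurd t1 nzy | exact absurd t1 nn.2)
    exact three_no hs (C.g_s2 (C.g_s1 g1.2.1)) (C.g_s2 (C.g_s1 k1.2.1)) (C.g_s2 (C.g_s1 k2.2.1)) mx.1.1 mz.1.1 hxz
  have na := mef.1.2
  have na' : ¬ C.adj f e := fun hh => na (C.asymm _ _ hh)
  have ne := mef.1.1
  have ve := (hv e).mp mef.2.1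
  have vf := (hv f).mp mef.2.2
  clear hD' iS iS' iS'' sS sS' hef hefD
  have ey : e ≠ y := by
    rintro rfl
    rcases vf with rfl | rfl | rfl | rfl | rfl | rfl <;> first | exact ne rfl | exact f1 ⟨rfl, rfl⟩ | exact f3 ⟨rfl, rfl⟩ | exact na (by assumption)
  have fy : f ≠ y := by
    rintro rfl
    rcases ve with rfl | rfl | rfl | rfl | rfl | rfl <;> first | exact ne rfl | exact f2 ⟨rfl, rfl⟩ | exact f4 ⟨rfl, rfl⟩ | exact na' (by assumption)
  have hpqr : ¬ ((e = p ∨ e = q ∨ e = r) ∧ (f = p ∨ f = q ∨ f = r)) := by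
    rintro ⟨h1, h2⟩
    rcases h1 with rfl | rfl | rfl <;> rcases h2 with rfl | rfl | rfl <;> first | exact ne rfl | exact na (by assumption) | exact na' (by assumption)
  have hfin : ((e = x ∨ e = z) ∧ (f = p ∨ f = q ∨ f = r)) ∨ ((f = x ∨ f = z) ∧ (e = p ∨ e = q ∨ e = r)) := by
    have ve' := ve.resolve_left ey
    have vf' := vf.resolve_left fy
    clear key
    grind
  rcases hfin with ⟨h1, h2⟩ | ⟨h1, h2⟩
  · rcases h1 with h1 | h1 <;> rcases h2 with h2 | h2 | h2
    · exact key x z p q r (by simp) (by simp) (Or.inl ⟨h1, h2⟩)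
    · exact key x z q p r (by simp) (by simp) (Or.inl ⟨h1, h2⟩)
    · exact key x z r p q (by simp) (by simp) (Or.inl ⟨h1, h2⟩)
    · exact key z x p q r (by simp) (by simp) (Or.inl ⟨h1, h2⟩)
    · exact key z x q p r (by simp) (by simp) (Or.inl ⟨h1, h2⟩)
    · exact key z x r p q (by simp) (by simp) (Or.inl ⟨h1, h2⟩)
  · rcases h1 with h1 | h1 <;> rcases h2 with h2 | h2 | h2
    · exact key x z p q r (by simp) (by simp) (Or.inr ⟨h2, h1⟩)
    · exact key x z q p r (by simp) (by simp) (Or.inr ⟨h2, h1⟩)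
    · exact key x z r p q (by simp) (by simp) (Or.inr ⟨h2, h1⟩)
    · exact key z x p q r (by simp) (by simp) (Or.inr ⟨h2, h1⟩)
    · exact key z x q p r (by simp) (by simp) (Or.inr ⟨h2, h1⟩)
    · exact key z x r p q (by simp) (by simp) (Or.inr ⟨h2, h1⟩)

theorem six_cases (h12 : C.Bl.card = 12) {w6 w4 w4' : W} (h : Six C w6 w4 w4') : Sat C.Bl sP ∨ Sat C.Bl sO := by
  by_cases hp : ∃ x y z, x ≠ z ∧ (y, x) ∈ C.D w6 ∧ (y, z) ∈ C.D w6
  · obtain ⟨x, y, z, h1, h2, h3⟩ := hp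
    exact Or.inl (six_path h12 h h1 h2 h3)
  right
  have un : ∀ x y z, (y, x) ∈ C.D w6 → (y, z) ∈ C.D w6 → x = z := by
    intro x y z h1 h2
    by_contra hc
    exact hp ⟨x, y, z, hc, h1, h2⟩
  have sD := C.D_sym w6
  have hD := C.D_card w6
  have h6 := h.h6
  have hr := h.hr w6
  rw [h6] at hD hr
  have hD6 : (C.D w6).card = 4 + 2 := by omega
  obtain ⟨⟨a, b⟩, hab⟩ : (C.D w6).Nonempty := by rw [← card_pos]; omega
  obtain ⟨S, sS, cS, iS, u1, u2⟩ := peel sD hD6 hab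
  obtain ⟨⟨c, d⟩, hcd⟩ : S.Nonempty := by rw [← card_pos]; omega
  obtain ⟨S', sS', cS', iS', u3, u4⟩ := peel sS (n := 2) cS hcd
  obtain ⟨⟨e, f⟩, hef⟩ : S'.Nonempty := by rw [← card_pos]; omega
  obtain ⟨S'', -, c0, iS'', u5, u6⟩ := peel sS' (n := 0) cS' hef
  have cd : (c, d) ∈ C.D w6 := (iS _ _).mpr (Or.inr (Or.inr hcd))
  have efS : (e, f) ∈ S := (iS' _ _).mpr (Or.inr (Or.inr hef))
  have ef : (e, f) ∈ C.D w6 := (iS _ _).mpr (Or.inr (Or.inr efS))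
  have ba := sD.1 _ _ hab
  have dc := sD.1 _ _ cd
  have fe := sD.1 _ _ ef
  have m1 := mem_D.mp hab
  have m2 := mem_D.mp cd
  have m3 := mem_D.mp ef
  have ac : a ≠ c := by rintro rfl; have := un _ _ _ hab cd; subst this; exact u1 hcd
  have ad : a ≠ d := by rintro rfl; have := un _ _ _ hab dc; subst this; exact u2 hcd
  have bc : b ≠ c := by rintro rfl; have := un _ _ _ ba cd; subst this; exact u2 hcd
  have bd : b ≠ d := by rintro rfl; have := un _ _ _ ba dc; subst this; exact u1 hcd
  have ae : a ≠ e := by rintro rfl; have := un _ _ _ hab ef; subst this; exact u1 efS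
  have af : a ≠ f := by rintro rfl; have := un _ _ _ hab fe; subst this; exact u2 efS
  have be : b ≠ e := by rintro rfl; have := un _ _ _ ba ef; subst this; exact u2 efS
  have bf : b ≠ f := by rintro rfl; have := un _ _ _ ba fe; subst this; exact u1 efS
  have ce : c ≠ e := by rintro rfl; have := un _ _ _ cd ef; subst this; exact u3 hef
  have cf : c ≠ f := by rintro rfl; have := un _ _ _ cd fe; subst this; exact u4 hef
  have de : d ≠ e := by rintro rfl; have := un _ _ _ dc ef; subst this; exact u4 hef
  have df : d ≠ f := by rintro rfl; have := un _ _ _ dc fe; subst this; exact u3 hef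
  have hN : C.N w6 = {a, b, c, d, e, f} := by
    symm
    apply eq_of_subset_of_card_le
    · intro x hx
      simp only [mem_insert, mem_singleton] at hx
      rw [mem_N]
      rcases hx with rfl | rfl | rfl | rfl | rfl | rfl
      exacts [m1.2.1, m1.2.2, m2.2.1, m2.2.2, m3.2.1, m3.2.2]
    · rw [h6]; simp [m1.1.1, m2.1.1, m3.1.1, *]
  refine satO h12 h (by simp [m1.1.1, m2.1.1, m3.1.1, *]) hN m1.1.2 m2.1.2 m3.1.2 ?_
  intro i j vi vj hij
  by_cases ha : C.adj i j
  · exact Or.inl ha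
  right
  rcases (iS i j).mp (mem_D.mpr ⟨⟨hij, ha⟩, vi, vj⟩) with e | e | e
  · simp [e]
  · simp [e]
  rcases (iS' i j).mp e with e | e | e
  · simp [e]
  · simp [e]
  rcases (iS'' i j).mp e with e | e | e
  · simp [e]
  · simp [e]
  exact absurd e (D_empty (w := w6) c0 i j)
end Conf
end PS

namespace PS
set_option linter.unusedSectionVars false
open Module
namespace Conf
open Finset
variable {E W Ed I : Type} [AddCommGroup E] [Module ℝ E] {C : Conf E W Ed I} [Fintype W] [Fintype Ed] [Fintype I] [DecidableEq I]

theorem gB {e0 : Ed} (h3 : ∀ e, e ≠ e0 → (C.K e).card = 3) {w : W} (hw : C.inc w e0) {p q z : I} (hp : C.ein e0 p) (hq : C.ein e0 q)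
    (ha : C.adj p q) (hz : ∀ m, C.vin w m → C.adj p m → C.adj q m → m = z) : C.g w p q z := by
  have hpq : p ≠ q := fun e => C.airr p (by rw [← e] at ha; exact ha)
  obtain ⟨f, f', hne, hf⟩ := C.twoE w p q ha (C.mono _ _ _ hw hp) (C.mono _ _ _ hw hq)
  obtain ⟨g, hg, hge⟩ : ∃ g, (C.inc w g ∧ C.ein g p ∧ C.ein g q) ∧ g ≠ e0 := by
    by_cases h : f = e0
    · exact ⟨f', (hf f').mpr (Or.inr rfl), fun h' => hne (h.trans h'.symm)⟩
    · exact ⟨f, (hf f).mpr (Or.inl rfl), h⟩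
  have hK := h3 g hge
  obtain ⟨k, hk, hk'⟩ : ∃ k ∈ C.K g, k ∉ ({p, q} : Finset I) := by
    apply exists_mem_notMem_of_card_lt_card
    rw [hK, card_pair hpq]; norm_num
  simp only [mem_insert, mem_singleton, not_or] at hk'
  rw [mem_K] at hk
  have := hz k (C.mono _ _ _ hg.1 hk) (C.K3_adj hK hg.2.1 hk (Ne.symm hk'.1)) (C.K3_adj hK hg.2.2 hk (Ne.symm hk'.2))
  subst this
  exact ⟨hpq, Ne.symm hk'.1, Ne.symm hk'.2, g, hg.1, hK, hg.2.1, hg.2.2, hk⟩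

theorem cyc {e0 : Ed} (h4 : (C.K e0).card = 4) : ∃ x0 x1 x2 x3 : I, ([x0, x1, x2, x3] : List I).Nodup ∧ C.K e0 = {x0, x1, x2, x3} ∧
    C.adj x0 x1 ∧ C.adj x1 x2 ∧ C.adj x2 x3 ∧ C.adj x0 x3 ∧ ¬ C.adj x0 x2 ∧ ¬ C.adj x1 x3 := by
  obtain ⟨x0, e0i⟩ := C.ene e0
  obtain ⟨x1, x3, h13, hn⟩ := C.twoN e0 x0 e0i
  have n1 := (hn x1).mpr (Or.inl rfl)
  have n3 := (hn x3).mpr (Or.inr rfl)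
  have ne : ∀ {i j}, C.adj i j → i ≠ j := fun {i j} h e => C.airr i (by rw [← e] at h; exact h)
  have h01 := ne n1.2
  have h03 := ne n3.2
  obtain ⟨x2, hx, hx'⟩ : ∃ k ∈ C.K e0, k ∉ ({x0, x1, x3} : Finset I) := by
    apply exists_mem_notMem_of_card_lt_card
    rw [h4]; exact lt_of_le_of_lt card_le_three (by norm_num)
  simp only [mem_insert, mem_singleton, not_or] at hx'
  obtain ⟨h20, h21, h23⟩ := hx'
  have hK : C.K e0 = {x0, x1, x2, x3} := by
    symm
    apply eq_of_subset_of_card_le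
    · intro x h
      simp only [mem_insert, mem_singleton] at h
      rcases h with rfl | rfl | rfl | rfl
      exacts [C.mem_K.mpr e0i, C.mem_K.mpr n1.1, hx, C.mem_K.mpr n3.1]
    · rw [h4]; simp [h01, h03, h13, Ne.symm h20, Ne.symm h21, h23]
  have mk : ∀ m, C.ein e0 m → m = x0 ∨ m = x1 ∨ m = x2 ∨ m = x3 := by
    intro m hm; rw [← mem_K, hK] at hm; simpa using hm
  have n02 : ¬ C.adj x0 x2 := by
    intro h
    rcases (hn x2).mp ⟨C.mem_K.mp hx, h⟩ with h | h
    exacts [h21 h, h23 h]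
  have n20 : ¬ C.adj x2 x0 := fun h => n02 (C.asymm _ _ h)
  obtain ⟨a, b, hab, hn2⟩ := C.twoN e0 x2 (C.mem_K.mp hx)
  have na := (hn2 a).mpr (Or.inl rfl)
  have nb := (hn2 b).mpr (Or.inr rfl)
  have aux : ∀ m, C.ein e0 m ∧ C.adj x2 m → m = x1 ∨ m = x3 := by
    rintro m ⟨h1, h2⟩
    rcases mk m h1 with rfl | rfl | rfl | rfl
    · exact absurd h2 n20
    · simp
    · exact absurd h2 (C.airr _)
    · simp
  have a21 : C.adj x2 x1 ∧ C.adj x2 x3 := by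
    rcases aux a na with rfl | rfl <;> rcases aux b nb with rfl | rfl
    · exact absurd rfl hab
    · exact ⟨na.2, nb.2⟩
    · exact ⟨nb.2, na.2⟩
    · exact absurd rfl hab
  refine ⟨x0, x1, x2, x3, by simp [h01, h03, h13, Ne.symm h20, Ne.symm h21, h23], hK, n1.2, C.asymm _ _ a21.1, a21.2, n3.2, n02, ?_⟩
  intro h
  obtain ⟨c, d, hcd, hn3⟩ := C.twoN e0 x1 n1.1
  have t0 := (hn3 x0).mp ⟨e0i, C.asymm _ _ n1.2⟩
  have t2 := (hn3 x2).mp ⟨C.mem_K.mp hx, C.asymm _ _ a21.1⟩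
  have t3 := (hn3 x3).mp ⟨n3.1, h⟩
  grind

theorem satB (h12 : C.Bl.card = 12) (hc : C.CaseB) : Sat C.Bl sB := by
  obtain ⟨e0, h4, h3, h5, hr1, hr2⟩ := hc
  obtain ⟨x0, x1, x2, x3, nd, hK, a01, a12, a23, a03, n02, n13⟩ := cyc h4
  obtain ⟨w, w', hww, hends⟩ := C.ends e0
  have iw : C.inc w e0 := (hends w).mpr (Or.inl rfl)
  have iw' : C.inc w' e0 := (hends w').mpr (Or.inr rfl)
  have K0 : C.ein e0 x0 := by rw [← mem_K, hK]; simp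
  have K1 : C.ein e0 x1 := by rw [← mem_K, hK]; simp
  have K2 : C.ein e0 x2 := by rw [← mem_K, hK]; simp
  have K3 : C.ein e0 x3 := by rw [← mem_K, hK]; simp
  have n20 : ¬ C.adj x2 x0 := fun h => n02 (C.asymm _ _ h)
  have n31 : ¬ C.adj x3 x1 := fun h => n13 (C.asymm _ _ h)
  have nd4 := nd
  simp only [List.nodup_cons, List.mem_cons, not_or, List.not_mem_nil, List.nodup_nil, not_false_eq_true, and_true] at nd
  obtain ⟨⟨h01, h02, h03⟩, ⟨h12', h13⟩, h23⟩ := nd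
  have loc : ∀ v, C.inc v e0 → ∃ x4, x4 ∉ C.K e0 ∧ C.N v = {x0, x1, x2, x3, x4} ∧ C.g v x0 x1 x4 ∧ C.g v x1 x2 x4 ∧ C.g v x2 x3 x4 ∧ C.g v x0 x3 x4 := by
    intro v hv
    have hsub : C.K e0 ⊆ C.N v := fun m hm => C.mem_N.mpr (C.mono v e0 m hv (C.mem_K.mp hm))
    have c1 : (C.N v \ C.K e0).card = 1 := by rw [card_sdiff_of_subset hsub, h5, h4]
    obtain ⟨x4, e4⟩ := card_eq_one.mp c1
    have hx4 : x4 ∈ C.N v \ C.K e0 := by rw [e4]; simp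
    have hN : C.N v = {x0, x1, x2, x3, x4} := by
      rw [← union_sdiff_of_subset hsub, e4, hK]; ext x; simp only [mem_insert, mem_union, mem_singleton, or_assoc]
    have hv' : ∀ m, C.vin v m ↔ m = x0 ∨ m = x1 ∨ m = x2 ∨ m = x3 ∨ m = x4 := by
      intro m; rw [← C.mem_N, hN]; simp
    have ir := C.airr
    refine ⟨x4, (mem_sdiff.mp hx4).2, hN, ?_, ?_, ?_, ?_⟩
    · apply gB h3 hv K0 K1 a01
      intro m vm k1 k2
      rcases (hv' m).mp vm with rfl | rfl | rfl | rfl | rfl <;> first | rfl | exact absurd k1 (ir _) | exact absurd k2 (ir _) | exact absurd k1 (by assumption) | exact absurd k2 (by assumption)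
    · apply gB h3 hv K1 K2 a12
      intro m vm k1 k2
      rcases (hv' m).mp vm with rfl | rfl | rfl | rfl | rfl <;> first | rfl | exact absurd k1 (ir _) | exact absurd k2 (ir _) | exact absurd k1 (by assumption) | exact absurd k2 (by assumption)
    · apply gB h3 hv K2 K3 a23
      intro m vm k1 k2
      rcases (hv' m).mp vm with rfl | rfl | rfl | rfl | rfl <;> first | rfl | exact absurd k1 (ir _) | exact absurd k2 (ir _) | exact absurd k1 (by assumption) | exact absurd k2 (by assumption)
    · apply gB h3 hv K0 K3 a03
      intro m vm k1 k2
      rcases (hv' m).mp vm with rfl | rfl | rfl | rfl | rfl <;> first | rfl | exact absurd k1 (ir _) | exact absurd k2 (ir _) | exact absurd k1 (by assumption) | exact absurd k2 (by assumption)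
  obtain ⟨x4, k4, N4, ga, gb, gc, gd⟩ := loc w iw
  obtain ⟨x5, k5, N5, ga', gb', gc', gd'⟩ := loc w' iw'
  have h45 : x4 ≠ x5 := by
    rintro rfl; exact hww (C.N_inj (by rw [N4, N5]))
  rw [hK] at k4 k5
  simp only [mem_insert, mem_singleton, not_or] at k4 k5
  obtain ⟨k40, k41, k42, k43⟩ := k4
  obtain ⟨k50, k51, k52, k53⟩ := k5
  have hi : Set.InjOn (mk6 x0 x1 x2 x3 x4 x5) {i | i < 6} := inj6 (by
    simp [h01, h02, h03, h12', h13, h23, h45, Ne.symm k40, Ne.symm k41, Ne.symm k42, Ne.symm k43, Ne.symm k50, Ne.symm k51, Ne.symm k52, Ne.symm k53])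
  have B1 : im (mk6 x0 x1 x2 x3 x4 x5) 31 = C.N w := by
    rw [N4, im, show ms 31 = {0, 1, 2, 3, 4} by decide]; simp [image_insert, mk6]
  have B2 : im (mk6 x0 x1 x2 x3 x4 x5) 47 = C.N w' := by
    rw [N5, im, show ms 47 = {0, 1, 2, 3, 5} by decide]; simp [image_insert, mk6]
  have u4 : x4 ∉ C.N w' := by rw [N5]; simp [k40, k41, k42, k43, h45]
  have u5 : x5 ∉ C.N w := by rw [N4]; simp [k50, k51, k52, k53, Ne.symm h45]
  have ho : ∀ b, Out (mk6 x0 x1 x2 x3 x4 x5) [31, 47] b ↔ b ≠ C.N w ∧ b ≠ C.N w' := by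
    intro b; simp [Out, B1, B2]
  have pr : ∀ i j, C.ein e0 i → C.ein e0 j → i ≠ j → ¬ C.adj i j → ∀ u, ({i, j} : Finset I) ⊆ C.N u → ∃ m ∈ [31, 47], C.N u = im (mk6 x0 x1 x2 x3 x4 x5) m := by
    intro i j hi hj hij ha u hu
    have : C.inc u e0 := by
      by_cases huw : u = w
      · rw [huw]; exact iw
      obtain ⟨e, q1, q2, q3, q4⟩ := C.non u w i j huw hij ha (C.mem_N.mp (hu (by simp))) (C.mem_N.mp (hu (by simp))) (C.mono _ _ _ iw hi) (C.mono _ _ _ iw hj)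
      rw [← C.e2 e e0 i j hij ha q3 q4 hi hj]; exact q1
    rcases (hends u).mp this with rfl | rfl
    · exact ⟨31, by simp, B1.symm⟩
    · exact ⟨47, by simp, B2.symm⟩
  have ex1 : ∀ i j, C.g w i j x4 → ∀ t, ms t ⊆ ms 31 → im (mk6 x0 x1 x2 x3 x4 x5) t = {i, j, x4} → ∃ m ∈ [31, 47], im (mk6 x0 x1 x2 x3 x4 x5) t ⊆ im (mk6 x0 x1 x2 x3 x4 x5) m ∧ ∃ b ∈ C.Bl, Out (mk6 x0 x1 x2 x3 x4 x5) [31, 47] b ∧ im (mk6 x0 x1 x2 x3 x4 x5) t ⊆ b ∧ ∀ c ∈ C.Bl, im (mk6 x0 x1 x2 x3 x4 x5) t ⊆ c → c = im (mk6 x0 x1 x2 x3 x4 x5) m ∨ c = b := by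
    intro i j hg t ht e
    obtain ⟨b, hb, hbn, hsb, hc⟩ := C.g_good hg
    refine ⟨31, by simp, image_subset_image ht, b, hb, (ho b).mpr ⟨hbn, ?_⟩, by rw [e]; exact hsb, by rw [e, B1]; exact hc⟩
    rintro rfl; exact u4 (hsb (by simp))
  have ex2 : ∀ i j, C.g w' i j x5 → ∀ t, ms t ⊆ ms 47 → im (mk6 x0 x1 x2 x3 x4 x5) t = {i, j, x5} → ∃ m ∈ [31, 47], im (mk6 x0 x1 x2 x3 x4 x5) t ⊆ im (mk6 x0 x1 x2 x3 x4 x5) m ∧ ∃ b ∈ C.Bl, Out (mk6 x0 x1 x2 x3 x4 x5) [31, 47] b ∧ im (mk6 x0 x1 x2 x3 x4 x5) t ⊆ b ∧ ∀ c ∈ C.Bl, im (mk6 x0 x1 x2 x3 x4 x5) t ⊆ c → c = im (mk6 x0 x1 x2 x3 x4 x5) m ∨ c = b := by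
    intro i j hg t ht e
    obtain ⟨b, hb, hbn, hsb, hc⟩ := C.g_good hg
    refine ⟨47, by simp, image_subset_image ht, b, hb, (ho b).mpr ⟨?_, hbn⟩, by rw [e]; exact hsb, by rw [e, B2]; exact hc⟩
    rintro rfl; exact u5 (hsb (by simp))
  refine init (k := 6) h12 (by norm_num) hi (by decide) (by decide) ?_ ?_ (by decide +kernel) ?_ (by decide +kernel) ?_ ?_
  · intro m hm
    simp only [List.mem_cons, List.not_mem_nil, or_false] at hm
    rcases hm with rfl | rfl
    exacts [⟨w, B1⟩, ⟨w', B2⟩]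
  · intro f hf u hu
    simp only [List.mem_cons, List.not_mem_nil, or_false] at hf
    rcases hf with rfl | rfl
    · rw [im_two _ (show ms 5 = {0, 2} by decide)] at hu; exact pr x0 x2 K0 K2 h02 n02 u hu
    · rw [im_two _ (show ms 10 = {1, 3} by decide)] at hu; exact pr x1 x3 K1 K3 h13 n13 u hu
  · intro t ht
    simp only [List.mem_cons, List.not_mem_nil, or_false] at ht
    rcases ht with rfl | rfl | rfl | rfl | rfl | rfl | rfl | rfl
    · exact ex1 _ _ ga _ (by decide) (im_three _ (show ms 19 = {0, 1, 4} by decide))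
    · exact ex1 _ _ gb _ (by decide) (im_three _ (show ms 22 = {1, 2, 4} by decide))
    · exact ex1 _ _ gc _ (by decide) (im_three _ (show ms 28 = {2, 3, 4} by decide))
    · exact ex1 _ _ gd _ (by decide) (im_three _ (show ms 25 = {0, 3, 4} by decide))
    · exact ex2 _ _ ga' _ (by decide) (im_three _ (show ms 35 = {0, 1, 5} by decide))
    · exact ex2 _ _ gb' _ (by decide) (im_three _ (show ms 38 = {1, 2, 5} by decide))
    · exact ex2 _ _ gc' _ (by decide) (im_three _ (show ms 44 = {2, 3, 5} by decide))
    · exact ex2 _ _ gd' _ (by decide) (im_three _ (show ms 41 = {0, 3, 5} by decide))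
  · rw [Nat.le_zero, Set.ncard_eq_zero]
    ext x
    simp only [Set.mem_ofPred_eq, Set.mem_empty_iff_false, iff_false, not_and]
    intro hx hc
    obtain ⟨u, rfl⟩ := C.mem_Bl.mp hx
    have := h5 u; omega
  · intro u hu
    have hu' := (ho _).mp hu
    have hni : ¬ C.inc u e0 := by
      intro hh
      rcases (hends u).mp hh with rfl | rfl
      exacts [hu'.1 rfl, hu'.2 rfl]
    refine Or.inl (isBip (fun e he => h3 e ?_) (h5 u) (hr2 u hni))
    rintro rfl; exact hni he

theorem sat_some (h12 : C.Bl.card = 12) (h : C.CaseA ∨ C.CaseB) :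
    Sat C.Bl sA ∨ Sat C.Bl sB ∨ Sat C.Bl sP ∨ ((∀ e, (C.K e).card = 3) ∧ (∀ w, C.r2 w + 12 = 6 * (C.N w).card) ∧ Sat C.Bl sO) := by
  rcases h with ⟨h3, hr, h⟩ | h
  · have hs : ∀ w, C.Simp w := fun w e _ => h3 e
    rcases h with ⟨w4, h4, h5⟩ | ⟨w6, w4, w4', hn, h6, h4, h4', h5⟩
    · exact Or.inl (satA h12 hs hr h4 h5)
    · rcases six_cases h12 ⟨hs, hr, hn, h6, h4, h4', h5⟩ with h | h
      · exact Or.inr (Or.inr (Or.inl h))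
      · exact Or.inr (Or.inr (Or.inr ⟨h3, hr, h⟩))
  · exact Or.inr (Or.inl (satB h12 h))
end Conf
end PS

namespace PS
set_option linter.unusedSectionVars false
open Module
theorem dep5 {E : Type} [AddCommGroup E] [Module ℝ E] [FiniteDimensional ℝ E] (hd : finrank ℝ E = 5) (f0 f1 f2 f3 f4 : Dual ℝ E)
    (x : E) (h0 : f0 x = 0) (h1 : f1 x = 0) (h2 : f2 x = 0) (h3 : f3 x = 0) (h4 : f4 x = 0) (h : Dual ℝ E) (hx : h x ≠ 0) :
    ∃ c0 c1 c2 c3 c4 : ℝ, (∀ y : E, c0 * f0 y + c1 * f1 y + c2 * f2 y + c3 * f3 y + c4 * f4 y = 0) ∧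
      ¬ (c0 = 0 ∧ c1 = 0 ∧ c2 = 0 ∧ c3 = 0 ∧ c4 = 0) := by
  have hn : ¬ LinearIndependent ℝ ![f0, f1, f2, f3, f4, h] := by
    intro h
    have := h.fintype_card_le_finrank
    rw [Subspace.dual_finrank_eq, hd] at this
    simp at this
  rw [Fintype.not_linearIndependent_iff] at hn
  obtain ⟨g, hg, i, hi⟩ := hn
  have ev : ∀ y : E, g 0 * f0 y + g 1 * f1 y + g 2 * f2 y + g 3 * f3 y + g 4 * f4 y + g 5 * h y = 0 := by
    intro y
    have := congrArg (fun f : Dual ℝ E => f y) hg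
    simpa [Fin.sum_univ_succ, Fin.sum_univ_zero, ← add_assoc] using this
  have g5 : g 5 = 0 := by
    have := ev x
    rw [h0, h1, h2, h3, h4] at this
    simp at this
    exact this.resolve_right hx
  refine ⟨g 0, g 1, g 2, g 3, g 4, fun y => ?_, ?_⟩
  · have := ev y
    rw [g5] at this; linarith
  · rintro ⟨h0, h1, h2, h3, h4⟩
    fin_cases i <;> simp_all

theorem opp {p q A B : ℝ} (hA : 0 < A) (hB : 0 < B) (h : p * A + q * B = 0) : (p = 0 → q = 0) ∧ (0 < p → q < 0) ∧ (p < 0 → 0 < q) := by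
  refine ⟨fun e => ?_, fun e => ?_, fun e => ?_⟩
  · subst e; simp at h; exact h.resolve_right hB.ne'
  · by_contra hq; push Not at hq
    have : 0 < p * A := mul_pos e hA
    have : 0 ≤ q * B := mul_nonneg hq hB.le
    linarith
  · by_contra hq; push Not at hq
    have : p * A < 0 := mul_neg_of_neg_of_pos e hA
    have : q * B ≤ 0 := mul_nonpos_of_nonpos_of_nonneg hq hB.le
    linarith

namespace Conf
open Finset
variable {E W Ed I : Type} [AddCommGroup E] [Module ℝ E] {C : Conf E W Ed I} [Fintype W] [Fintype Ed] [Fintype I] [DecidableEq I]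

theorem g_ev {w : W} {i j k u v : I} {c0 c1 c2 c3 c4 : ℝ} (h : C.g w i j k)
    (hu : ∀ w', w' ≠ w → C.vin w' i → C.vin w' j → C.vin w' k → ¬ C.vin w' u)
    (hv : ∀ w', w' ≠ w → C.vin w' i → C.vin w' j → C.vin w' k → ¬ C.vin w' v)
    (ev : ∀ y : E, c0 * C.a i y + c1 * C.a j y + c2 * C.a k y + c3 * C.a u y + c4 * C.a v y = 0) :
    ∃ A B : ℝ, 0 < A ∧ 0 < B ∧ c3 * A + c4 * B = 0 := by
  obtain ⟨h1, h2, h3, e, h4, h0, h5, h6, h7⟩ := h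
  obtain ⟨w', hw', hi'⟩ := C.other h4
  have vi := C.mono w' e i hi' h5
  have vj := C.mono w' e j hi' h6
  have vk := C.mono w' e k hi' h7
  refine ⟨C.a u (C.pt w'), C.a v (C.pt w'), C.anz (hu w' hw' vi vj vk), C.anz (hv w' hw' vi vj vk), ?_⟩
  have := ev (C.pt w')
  rw [vi, vj, vk] at this
  linarith

theorem BipAt.rel [FiniteDimensional ℝ E] (hd : finrank ℝ E = 5) {w : W} (hs : C.Simp w) {u v a b c : I} (h : BipAt C w u v a b c) :
    ∃ l m p q r : ℝ, 0 < l ∧ 0 < m ∧ 0 < p ∧ 0 < q ∧ 0 < r ∧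
      ∀ y : E, l * C.a u y + m * C.a v y = p * C.a a y + q * C.a b y + r * C.a c y := by
  have hv : ∀ m, C.vin w m ↔ m = u ∨ m = v ∨ m = a ∨ m = b ∨ m = c := by
    intro m; rw [← C.mem_N, h.N]; simp
  have nd := h.nd
  simp only [List.nodup_cons, List.mem_cons, List.not_mem_nil, or_false, not_or, List.nodup_nil, and_true] at nd
  obtain ⟨⟨uv, ua, ub, uc⟩, ⟨va, vb, vc⟩, ⟨ab, ac⟩, bc, -⟩ := nd
  have wu : C.vin w u := by rw [hv]; simp
  have wv : C.vin w v := by rw [hv]; simp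
  have wa : C.vin w a := by rw [hv]; simp
  have wb : C.vin w b := by rw [hv]; simp
  have wc : C.vin w c := by rw [hv]; simp
  have x2 : ∀ w', w' ≠ w → C.vin w' u → C.vin w' v → False := by
    intro w' hne h1 h2
    apply hne
    apply C.N_inj
    apply na_excl hs uv wu wv h.uv _ (C.N_mem w')
    intro x hx
    simp only [mem_insert, mem_singleton] at hx
    rcases hx with rfl | rfl
    exacts [C.mem_N.mpr h1, C.mem_N.mpr h2]
  have x3 : ∀ w', w' ≠ w → C.vin w' a → C.vin w' b → C.vin w' c → False := by
    intro w' hne h1 h2 h3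
    apply hne
    apply C.N_inj
    apply g_excl hs ab ac bc wa wb wc h.ng _ (C.N_mem w')
    intro x hx
    simp only [mem_insert, mem_singleton] at hx
    rcases hx with rfl | rfl | rfl
    exacts [C.mem_N.mpr h1, C.mem_N.mpr h2, C.mem_N.mpr h3]
  obtain ⟨h', hw'⟩ : ∃ i, C.a i (C.pt w) ≠ 0 := by
    obtain ⟨-, -, -, e, h4, -⟩ := h.g1
    obtain ⟨w', hw', -⟩ := C.other h4
    obtain ⟨i, -, hi⟩ := C.incomp w' w hw'
    exact ⟨i, hi⟩
  obtain ⟨c0, c1, c2, c3, c4, ev, nz⟩ := dep5 hd (C.a u) (C.a v) (C.a a) (C.a b) (C.a c) (C.pt w) wu wv wa wb wc _ hw'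
  obtain ⟨A1, B1, A1p, B1p, E1⟩ := g_ev (u := v) (v := c) (c0 := c0) (c1 := c2) (c2 := c3) (c3 := c1) (c4 := c4) h.g1
    (fun w' n p q r s => x2 w' n p s) (fun w' n p q r s => x3 w' n q r s) (fun y => by linarith [ev y])
  obtain ⟨A2, B2, A2p, B2p, E2⟩ := g_ev (u := v) (v := b) (c0 := c0) (c1 := c2) (c2 := c4) (c3 := c1) (c4 := c3) h.g2
    (fun w' n p q r s => x2 w' n p s) (fun w' n p q r s => x3 w' n q s r) (fun y => by linarith [ev y])
  obtain ⟨A3, B3, A3p, B3p, E3⟩ := g_ev (u := v) (v := a) (c0 := c0) (c1 := c3) (c2 := c4) (c3 := c1) (c4 := c2) h.g3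
    (fun w' n p q r s => x2 w' n p s) (fun w' n p q r s => x3 w' n s q r) (fun y => by linarith [ev y])
  obtain ⟨A4, B4, A4p, B4p, E4⟩ := g_ev (u := c) (v := u) (c0 := c1) (c1 := c2) (c2 := c3) (c3 := c4) (c4 := c0) h.g4
    (fun w' n p q r s => x3 w' n q r s) (fun w' n p q r s => x2 w' n s p) (fun y => by linarith [ev y])
  have o1 := opp A1p B1p E1
  have o2 := opp A2p B2p E2
  have o3 := opp A3p B3p E3
  have o4 := opp A4p B4p E4
  rcases lt_trichotomy c1 0 with hc | hc | hc
  · have := o1.2.2 hc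
    have := o2.2.2 hc
    have := o3.2.2 hc
    have := o4.2.1 (o1.2.2 hc)
    exact ⟨-c0, -c1, c2, c3, c4, by linarith, by linarith, by linarith, by linarith, by linarith, fun y => by linarith [ev y]⟩
  · exact absurd ⟨o4.1 (o1.1 hc), hc, o3.1 hc, o2.1 hc, o1.1 hc⟩ nz
  · have := o1.2.1 hc
    have := o2.2.1 hc
    have := o3.2.1 hc
    have := o4.2.2 (o1.2.1 hc)
    exact ⟨c0, c1, -c2, -c3, -c4, by linarith, by linarith, by linarith, by linarith, by linarith, fun y => by linarith [ev y]⟩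

/-- combination of two bipyramid relations at an octahedron vertex -/
theorem comb [FiniteDimensional ℝ E] (hd : finrank ℝ E = 5) {w w1 w2 : W} (h1 : C.Simp w1) (h2 : C.Simp w2) {p q x y z r s : I}
    (b1 : BipAt C w1 r y p x z) (b2 : BipAt C w2 s z q x y)
    (wp : C.vin w p) (wq : C.vin w q) (wx : C.vin w x) (wr : C.vin w r) (ws : C.vin w s) (wy : ¬ C.vin w y) (wz : ¬ C.vin w z) :
    ∃ l m c d e : ℝ, 0 < l ∧ 0 < m ∧ 0 < c ∧ 0 < d ∧ 0 < e ∧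
      ∀ t : E, c * C.a p t + d * C.a q t + e * C.a x t = l * C.a r t + m * C.a s t := by
  obtain ⟨l, m, a1, a2, a3, lp, mp, p1, p2, p3, ev⟩ := b1.rel hd h1
  obtain ⟨l', m', a1', a2', a3', lp', mp', p1', p2', p3', ev'⟩ := b2.rel hd h2
  have e1 := ev (C.pt w)
  have e2 := ev' (C.pt w)
  rw [wr, wp, wx] at e1
  rw [ws, wq, wx] at e2
  have Y := C.anz wy
  have Z := C.anz wz
  -- m y = a3 z and m' z = a3' y
  have key : m * m' = a3 * a3' := by
    have : (m * m' - a3 * a3') * (C.a y (C.pt w) * C.a z (C.pt w)) = 0 := by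
      linear_combination m' * C.a z (C.pt w) * e1 + a3 * C.a z (C.pt w) * e2
    rcases mul_eq_zero.mp this with h | h
    · linarith
    · exact absurd h (mul_pos Y Z).ne'
  refine ⟨a3' * l, m * l', a3' * a1, m * a1', a3' * a2 + m * a2', by positivity, by positivity, by positivity, by positivity, by positivity, fun t => ?_⟩
  linear_combination -a3' * ev t - m * ev' t + key * C.a z t

def gL : List ℕ := [992,464,848,794,598,230,618,409,809,421,213,63]

theorem geoBip (hK : ∀ e, (C.K e).card = 3) (hr : ∀ w, C.r2 w + 12 = 6 * (C.N w).card) {φ : ℕ → I} (hφ : Set.InjOn φ {i | i < 10})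
    (hB : ∀ b, b ∈ C.Bl ↔ ∃ m ∈ gL, im φ m = b) (m u v a b c : ℕ) (hm : m ∈ gL) (hL : ∀ m ∈ gL, m < 2 ^ 10)
    (nd : ([u, v, a, b, c] : List ℕ).Nodup) (hms : ms m = {u, v, a, b, c})
    (hu : ∀ m' ∈ gL, u ∈ ms m' → v ∈ ms m' → m' = m) :
    ∃ w, C.N w = im φ m ∧ BipAt C w (φ u) (φ v) (φ a) (φ b) (φ c) := by
  obtain ⟨w, hw⟩ := C.mem_Bl.mp ((hB _).mpr ⟨m, hm, rfl⟩)
  have hs : C.Simp w := fun e _ => hK e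
  have lt : ∀ x ∈ [u, v, a, b, c], x < 10 := by
    intro x hx
    apply ms_lt (hL m hm)
    rw [hms]; simpa using hx
  have hN : C.N w = {φ u, φ v, φ a, φ b, φ c} := by
    rw [hw, im, hms]; simp [image_insert]
  have nd' : ([φ u, φ v, φ a, φ b, φ c] : List I).Nodup := by
    have := List.Nodup.map_on (f := φ) (l := [u, v, a, b, c]) (fun x hx y hy e => hφ (lt x hx) (lt y hy) e) nd
    simpa using this
  have h5 : (C.N w).card = 5 := by
    rw [hw, im_card hφ (hL m hm), hms]
    have := List.toFinset_card_of_nodup nd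
    simpa using this
  have hr2 : C.r2 w = 18 := by have := hr w; omega
  have vu : C.vin w (φ u) := by rw [← C.mem_N, hN]; simp
  have vv : C.vin w (φ v) := by rw [← C.mem_N, hN]; simp
  have uvne : φ u ≠ φ v := by
    intro e
    rw [List.nodup_cons] at nd'
    exact nd'.1 (by simp [e])
  have uv : ¬ C.adj (φ u) (φ v) := by
    intro had
    obtain ⟨k, l, -, hkl⟩ := thirds hs vu vv had
    obtain ⟨b', hb', hne, hsub, -⟩ := C.g_good ((hkl k).mpr (Or.inl rfl))
    obtain ⟨m', hm', rfl⟩ := (hB b').mp hb'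
    apply hne
    rw [hw]
    congr 1
    have back : ∀ x, x < 10 → φ x ∈ im φ m' → x ∈ ms m' := by
      intro x hx hi
      obtain ⟨y, hy, e⟩ := mem_image.mp hi
      have := hφ (ms_lt (hL m' hm') hy) hx e
      rwa [← this]
    exact hu m' hm' (back u (lt u (by simp)) (hsub (by simp))) (back v (lt v (by simp)) (hsub (by simp)))
  refine ⟨w, hw, bipAt hs nd' hN uv ?_⟩
  have hD := C.D_card w
  rw [h5, hr2] at hD
  have hD2 : (C.D w).card = 0 + 2 := by omega
  obtain ⟨S, -, S0, hS, -, -⟩ := peel (C.D_sym w) hD2 (mem_D.mpr ⟨⟨uvne, uv⟩, vu, vv⟩)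
  intro i j hij
  rcases (hS i j).mp hij with h | h | h
  · exact Or.inl h
  · exact Or.inr h
  · exact absurd h (D_empty (w := w) S0 i j)

theorem geo [FiniteDimensional ℝ E] (hd : finrank ℝ E = 5) (h12 : C.Bl.card = 12) (hK : ∀ e, (C.K e).card = 3)
    (hr : ∀ w, C.r2 w + 12 = 6 * (C.N w).card) : ¬ Sat C.Bl ⟨gL, [], [], 1024, 0⟩ := by
  rintro ⟨φ, h⟩
  obtain ⟨k, hk, hk2, hφ⟩ := h.nb
  have : k = 10 := by
    have : (2:ℕ) ^ 10 = 2 ^ k := by rw [← hk2]; norm_num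
    exact (Nat.pow_right_injective (le_refl 2) this).symm
  subst this
  have hL : ∀ m ∈ gL, m < 2 ^ 10 := by decide
  have hnd : gL.Nodup := by decide
  have hB : ∀ b, b ∈ C.Bl ↔ ∃ m ∈ gL, im φ m = b := by
    have hsub : gL.toFinset.image (im φ) ⊆ C.Bl := by
      intro b hb
      obtain ⟨m, hm, rfl⟩ := mem_image.mp hb
      exact h.hB m (List.mem_toFinset.mp hm)
    have hc : (gL.toFinset.image (im φ)).card = 12 := by
      rw [card_image_of_injOn, List.toFinset_card_of_nodup hnd]
      · rfl
      · intro a ha b hb e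
        exact im_inj (le_refl 10) hφ (hL a (List.mem_toFinset.mp ha)) (hL b (List.mem_toFinset.mp hb)) e
    have := eq_of_subset_of_card_le hsub (by omega)
    intro b
    rw [← this]
    simp
  have hs : ∀ w, C.Simp w := fun w e _ => hK e
  have vin : ∀ {w : W} {m : ℕ} (hw : C.N w = im φ m) (hm : m ∈ gL) {i : ℕ} (hi : i < 10), C.vin w (φ i) ↔ i ∈ ms m := by
    intro w m hw hm i hi
    rw [← C.mem_N, hw]
    constructor
    · intro hx
      obtain ⟨y, hy, e⟩ := mem_image.mp hx
      have := hφ (ms_lt (hL m hm) hy) hi e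
      rwa [← this]
    · intro hx; exact mem_image_of_mem φ hx
  obtain ⟨w, hw⟩ := C.mem_Bl.mp ((hB _).mpr ⟨63, by decide, rfl⟩)
  have bip := geoBip hK hr hφ hB
  obtain ⟨w1, n1, b1⟩ := bip 213 0 6 4 2 7 (by decide) hL (by decide) (by decide) (by decide)
  obtain ⟨w2, n2, b2⟩ := bip 230 1 7 5 2 6 (by decide) hL (by decide) (by decide) (by decide)
  obtain ⟨w3, n3, b3⟩ := bip 794 1 8 4 3 9 (by decide) hL (by decide) (by decide) (by decide)
  obtain ⟨w4, n4, b4⟩ := bip 809 0 9 5 3 8 (by decide) hL (by decide) (by decide) (by decide)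
  obtain ⟨w5, n5, b5⟩ := bip 409 3 7 4 0 8 (by decide) hL (by decide) (by decide) (by decide)
  obtain ⟨w6, n6, b6⟩ := bip 421 2 8 5 0 7 (by decide) hL (by decide) (by decide) (by decide)
  have V : ∀ i, i ∈ ms 63 → C.vin w (φ i) := fun i hi => (vin hw (by decide) (ms_lt (hL 63 (by decide)) hi)).mpr hi
  have V' : ∀ i, i < 10 → i ∉ ms 63 → ¬ C.vin w (φ i) := fun i hi hn h => hn ((vin hw (by decide) hi).mp h)
  have v0 := V 0 (by decide)
  have v1 := V 1 (by decide)
  have v2 := V 2 (by decide)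
  have v3 := V 3 (by decide)
  have v4 := V 4 (by decide)
  have v5 := V 5 (by decide)
  have v6 := V' 6 (by decide) (by decide)
  have v7 := V' 7 (by decide) (by decide)
  have v8 := V' 8 (by decide) (by decide)
  have v9 := V' 9 (by decide) (by decide)
  obtain ⟨l1, m1, c1, d1, e1, l1p, m1p, c1p, d1p, e1p, R1⟩ := comb hd (hs w1) (hs w2) b1 b2 v4 v5 v2 v0 v1 v6 v7
  obtain ⟨l4, m4, c4, d4, e4, l4p, m4p, c4p, d4p, e4p, R4⟩ := comb hd (hs w3) (hs w4) b3 b4 v4 v5 v3 v1 v0 v8 v9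
  obtain ⟨l2, m2, c2, d2, e2, l2p, m2p, c2p, d2p, e2p, R2⟩ := comb hd (hs w5) (hs w6) b5 b6 v4 v5 v0 v3 v2 v7 v8
  -- R1: c1 4 + d1 5 + e1 2 = l1 0 + m1 1 ; R4: c4 4 + d4 5 + e4 3 = l4 1 + m4 0 ; R2: c2 4 + d2 5 + e2 0 = l2 3 + m2 2
  obtain ⟨k4, k5, k0, k2, k2p, R⟩ : ∃ k4 k5 k0 k2 : ℝ, 0 < k2 ∧ ∀ t, k4 * C.a (φ 4) t + k5 * C.a (φ 5) t + k0 * C.a (φ 0) t + k2 * C.a (φ 2) t = 0 :=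
    ⟨l2 * (l4 * c1 - m1 * c4) - m1 * e4 * c2, l2 * (l4 * d1 - m1 * d4) - m1 * e4 * d2, l2 * (m1 * m4 - l4 * l1) - m1 * e4 * e2,
      l2 * l4 * e1 + m1 * e4 * m2, by positivity, fun t => by
      linear_combination l2 * l4 * R1 t - l2 * m1 * R4 t - m1 * e4 * R2 t⟩
  have z : ∀ {w : W} {m : ℕ} (hw : C.N w = im φ m) (hm : m ∈ gL) (i : ℕ) (hi : i ∈ ms m), C.a (φ i) (C.pt w) = 0 :=
    fun hw hm i hi => (vin hw hm (ms_lt (hL _ hm) hi)).mpr hi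
  have nz : ∀ {w : W} {m : ℕ} (hw : C.N w = im φ m) (hm : m ∈ gL) (i : ℕ) (hi : i < 10) (hn : i ∉ ms m), C.a (φ i) (C.pt w) ≠ 0 :=
    fun hw hm i hi hn h => hn ((vin hw hm hi).mp h)
  have s5 := R (C.pt w1)
  rw [z n1 (by decide) 4 (by decide), z n1 (by decide) 0 (by decide), z n1 (by decide) 2 (by decide)] at s5
  have k5z : k5 = 0 := (mul_eq_zero.mp (by linarith)).resolve_right (nz n1 (by decide) 5 (by decide) (by decide))
  have s4 := R (C.pt w6)
  rw [z n6 (by decide) 5 (by decide), z n6 (by decide) 0 (by decide), z n6 (by decide) 2 (by decide)] at s4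
  have k4z : k4 = 0 := (mul_eq_zero.mp (by linarith)).resolve_right (nz n6 (by decide) 4 (by decide) (by decide))
  have s2 := R (C.pt w5)
  rw [k5z, k4z, z n5 (by decide) 0 (by decide)] at s2
  have k2z : k2 = 0 := (mul_eq_zero.mp (by linarith)).resolve_right (nz n5 (by decide) 2 (by decide) (by decide))
  linarith
end Conf
end PS

namespace PS
set_option linter.unusedSectionVars false
open Module
section cone
variable {E : Type} [AddCommGroup E] [Module ℝ E] [FiniteDimensional ℝ E]

structure Cone (X : Set E) : Prop where
  fin : X.Finite
  dim : finrank ℝ E = 5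
  top : Submodule.span ℝ X = ⊤
  pos : ∃ h : Dual ℝ E, ∀ x ∈ X, 0 < h x

abbrev Fc (X : Set E) (k : ℕ) : Type := {A : Set E // IsF X A ∧ rk A = k}

namespace Cone
variable {X : Set E} (hX : Cone X)
include hX
theorem emp : IsF X ∅ := by
  obtain ⟨h, hp⟩ := hX.pos
  refine ⟨h, fun x hx => (hp x hx).le, ?_⟩
  ext x; simp only [Set.mem_empty_iff_false, Set.mem_ofPred_eq, false_iff]
  rintro ⟨h1, h2⟩; exact absurd h2 (hp x h1).ne'
theorem rkX : rk X = 5 := by rw [rk, hX.top, finrank_top, hX.dim]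
theorem rk0 : rk (∅ : Set E) = 0 := by simp [rk]

theorem fcFinite (k : ℕ) : Finite (Fc X k) :=
  Set.Finite.to_subtype ((faces_finite hX.fin).subset (fun A (h : IsF X A ∧ rk A = k) => h.1))

theorem nonempty {A : Set E} (h : 0 < rk A) : A.Nonempty := by
  by_contra hc
  rw [Set.not_nonempty_iff_eq_empty] at hc
  subst hc
  rw [hX.rk0] at h; omega

/-- a vertex face is contained in a face as soon as it meets it -/
theorem vert {w : Fc X 1} {x : E} (hx : x ∈ w.1) {g : Dual ℝ E} (hg : g x = 0) : ∀ y ∈ w.1, g y = 0 := by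
  obtain ⟨h, hp⟩ := hX.pos
  have x0 : x ≠ 0 := by
    rintro rfl
    have := hp _ (w.2.1.sub hx)
    simp at this
  have hle : Submodule.span ℝ {x} ≤ Submodule.span ℝ w.1 := Submodule.span_mono (by simpa using hx)
  have he : Submodule.span ℝ {x} = Submodule.span ℝ w.1 := by
    apply Submodule.eq_of_le_of_finrank_eq hle
    rw [finrank_span_singleton x0]; exact w.2.2.symm
  intro y hy
  have : y ∈ Submodule.span ℝ {x} := he ▸ Submodule.subset_span hy
  obtain ⟨c, rfl⟩ := Submodule.mem_span_singleton.mp this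
  simp [hg]

theorem vsub {w : Fc X 1} {x : E} (hx : x ∈ w.1) {A : Set E} (hA : IsF X A) (hxA : x ∈ A) : w.1 ⊆ A := by
  obtain ⟨g, -, rfl⟩ := hA
  exact fun y hy => ⟨w.2.1.sub hy, hX.vert hx hxA.2 y hy⟩

theorem two_le {w w' : Fc X 1} (hne : w ≠ w') {A : Set E} (hA : IsF X A) (h : w.1 ⊆ A) (h' : w'.1 ⊆ A) : 2 ≤ rk A := by
  have : w.1 ≠ A := by
    rintro rfl
    exact hne (Subtype.ext (eq_of_rk w'.2.1 w.2.1 h' (by rw [w.2.2, w'.2.2])).symm)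
  have := rk_lt w.2.1 hA h this
  rw [w.2.2] at this; omega

theorem le3 {i j : Fc X 4} (hne : i ≠ j) : rk (i.1 ∩ j.1) ≤ 3 := by
  have : i.1 ∩ j.1 ≠ i.1 := by
    intro e
    exact hne (Subtype.ext (eq_of_rk i.2.1 j.2.1 (Set.inter_eq_left.mp e) (by rw [i.2.2, j.2.2])))
  have := rk_lt (i.2.1.inter j.2.1) i.2.1 Set.inter_subset_left this
  rw [i.2.2] at this; omega

/-- the two facets through a ridge -/
theorem ridge {R : Set E} (hR : IsF X R) (h3 : rk R = 3) : ∃ i j : Fc X 4, i ≠ j ∧ R ⊆ i.1 ∧ R ⊆ j.1 ∧ ∀ l : Fc X 4, R ⊆ l.1 → l = i ∨ l = j := by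
  obtain ⟨C, D, hne, ⟨c1, c2, c3, -⟩, ⟨d1, d2, d3, -⟩, hu⟩ := diamond hX.fin hR (isF_univ X) hR.sub (by rw [hX.rkX, h3])
  rw [h3] at c2 d2
  refine ⟨⟨C, c1, c2⟩, ⟨D, d1, d2⟩, fun e => hne (congrArg Subtype.val e), c3, d3, fun l hl => ?_⟩
  rcases hu l.1 l.2.1 (by rw [l.2.2, h3]) hl l.2.1.sub with h | h
  · left; exact Subtype.ext h
  · right; exact Subtype.ext h

theorem ridge_eq {R : Set E} (hR : IsF X R) (h3 : rk R = 3) {i j : Fc X 4} (hne : i ≠ j) (hi : R ⊆ i.1) (hj : R ⊆ j.1) : i.1 ∩ j.1 = R :=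
  (eq_of_rk hR (i.2.1.inter j.2.1) (Set.subset_inter hi hj) (by rw [h3]; exact hX.le3 hne)).symm

theorem ridge_of {R : Set E} (hR : IsF X R) (h3 : rk R = 3) {i : Fc X 4} (hi : R ⊆ i.1) : ∃ j : Fc X 4, i ≠ j ∧ R ⊆ j.1 ∧ ∀ l : Fc X 4, i ≠ l → R ⊆ l.1 → l = j := by
  obtain ⟨p, q, hne, hp, hq, hu⟩ := hX.ridge hR h3
  rcases hu i hi with rfl | rfl
  · refine ⟨q, hne, hq, fun l hl hR => ?_⟩
    rcases hu l hR with h | h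
    · exact absurd h.symm hl
    · exact h
  · refine ⟨p, hne.symm, hp, fun l hl hR => ?_⟩
    rcases hu l hR with h | h
    · exact h
    · exact absurd h.symm hl

theorem le2 {i j k : Fc X 4} (h1 : i ≠ j) (h2 : i ≠ k) (h3 : j ≠ k) : rk (i.1 ∩ j.1 ∩ k.1) ≤ 2 := by
  by_contra hc
  have hF := (i.2.1.inter j.2.1).inter k.2.1
  have h : rk (i.1 ∩ j.1 ∩ k.1) ≤ rk (i.1 ∩ j.1) := rk_mono Set.inter_subset_left
  have := hX.le3 h1
  have h3' : rk (i.1 ∩ j.1 ∩ k.1) = 3 := by omega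
  obtain ⟨l, -, -, hl⟩ := hX.ridge_of hF h3' (i := i) (fun x hx => hx.1.1)
  exact h3 ((hl j h1 fun x hx => hx.1.2).trans (hl k h2 fun x hx => hx.2).symm)

theorem func (F : Fc X 4) : ∃ g : Dual ℝ E, (∀ x ∈ X, 0 ≤ g x) ∧ F.1 = {x | x ∈ X ∧ g x = 0} ∧ g (∑ x ∈ hX.fin.toFinset, x) = 1 := by
  obtain ⟨g, hg, e⟩ := F.2.1
  have hs : 0 < g (∑ x ∈ hX.fin.toFinset, x) := by
    rw [map_sum]
    have hnn : ∀ x ∈ hX.fin.toFinset, 0 ≤ g x := fun x hx => hg x (hX.fin.mem_toFinset.mp hx)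
    refine lt_of_le_of_ne (Finset.sum_nonneg hnn) fun h0 => ?_
    have hz := (Finset.sum_eq_zero_iff_of_nonneg hnn).mp h0.symm
    have : F.1 = X := by
      rw [e]; ext x
      exact ⟨fun h => h.1, fun h => ⟨h, hz x (hX.fin.mem_toFinset.mpr h)⟩⟩
    have h4 := F.2.2
    rw [this, hX.rkX] at h4; omega
  set s := g (∑ x ∈ hX.fin.toFinset, x)
  refine ⟨s⁻¹ • g, fun x hx => ?_, ?_, ?_⟩
  · simp only [LinearMap.smul_apply, smul_eq_mul]
    exact mul_nonneg (inv_pos.mpr hs).le (hg x hx)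
  · rw [e]; ext x; simp [hs.ne']
  · simp only [LinearMap.smul_apply, smul_eq_mul]
    exact inv_mul_cancel₀ hs.ne'

theorem conf : ∃ C : Conf E (Fc X 1) (Fc X 2) (Fc X 4), C.adj = fun i j => i ≠ j ∧ rk (i.1 ∩ j.1) = 3 := by
  have hp : ∀ w : Fc X 1, ∃ x, x ∈ w.1 := fun w => hX.nonempty (by rw [w.2.2]; norm_num)
  choose pt hpt using hp
  choose a ann aeq aone using hX.func
  have mem : ∀ w i, a i (pt w) = 0 ↔ w.1 ⊆ i.1 := by
    intro w i
    constructor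
    · intro h
      exact hX.vsub (hpt w) i.2.1 (by rw [aeq i]; exact ⟨w.2.1.sub (hpt w), h⟩)
    · intro h
      have := h (hpt w)
      rw [aeq i] at this
      exact this.2
  have hco : ∀ {A : Set E} (hA : IsF X A) {x : E} (hx : x ∈ X) (hxA : x ∉ A), ∃ i : Fc X 4, A ⊆ i.1 ∧ x ∉ i.1 := by
    intro A hA x hx hxA
    obtain ⟨F, f1, f2, f3, f4⟩ := coatom (d := 4) hX.fin hX.top hX.dim hA hx hxA
    exact ⟨⟨F, f1, f2⟩, f3, f4⟩
  have ne_of : ∀ {A : Set E}, IsF X A → rk A < 5 → ∃ x ∈ X, x ∉ A := by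
    intro A hA h
    by_contra hc
    push Not at hc
    have : A = X := Set.Subset.antisymm hA.sub hc
    rw [this, hX.rkX] at h; omega
  refine ⟨{
    pt := pt
    a := a
    o := ∑ x ∈ hX.fin.toFinset, x
    ein := fun e i => e.1 ⊆ i.1
    inc := fun w e => w.1 ⊆ e.1
    adj := fun i j => i ≠ j ∧ rk (i.1 ∩ j.1) = 3
    nn := fun i w => ann i _ (w.2.1.sub (hpt w))
    ao := aone
    ainj := fun i j h => Subtype.ext (by rw [aeq i, aeq j, h])
    asymm := fun i j h => ⟨h.1.symm, by rw [Set.inter_comm]; exact h.2⟩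
    airr := fun i h => h.1 rfl
    mono := fun w e i h1 h2 => (mem w i).mpr (h1.trans h2)
    ends := ?_
    twoE := ?_
    twoN := ?_
    tri := ?_
    e3 := ?_
    non := ?_
    e2 := ?_
    einj := ?_
    incomp := ?_
    ene := ?_
    vtwo := ?_ }, rfl⟩
  · intro e
    obtain ⟨C, D, hne, ⟨c1, c2, -, c4⟩, ⟨d1, d2, -, d4⟩, hu⟩ := diamond hX.fin hX.emp e.2.1 (Set.empty_subset _) (by rw [hX.rk0, e.2.2])
    rw [hX.rk0] at c2 d2
    refine ⟨⟨C, c1, c2⟩, ⟨D, d1, d2⟩, fun e => hne (congrArg Subtype.val e), fun u => ⟨fun h => ?_, ?_⟩⟩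
    · rcases hu u.1 u.2.1 (by rw [u.2.2, hX.rk0]) (Set.empty_subset _) h with h | h
      · left; exact Subtype.ext h
      · right; exact Subtype.ext h
    · rintro (rfl | rfl)
      exacts [c4, d4]
  · intro w i j hij wi wj
    rw [mem] at wi wj
    obtain ⟨C, D, hne, ⟨c1, c2, c3, c4⟩, ⟨d1, d2, d3, d4⟩, hu⟩ := diamond hX.fin w.2.1 (i.2.1.inter j.2.1) (Set.subset_inter wi wj) (by rw [w.2.2, hij.2])
    rw [w.2.2] at c2 d2
    refine ⟨⟨C, c1, c2⟩, ⟨D, d1, d2⟩, fun e => hne (congrArg Subtype.val e), fun u => ⟨fun h => ?_, ?_⟩⟩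
    · rcases hu u.1 u.2.1 (by rw [u.2.2, w.2.2]) h.1 (Set.subset_inter h.2.1 h.2.2) with h | h
      · left; exact Subtype.ext h
      · right; exact Subtype.ext h
    · rintro (rfl | rfl)
      · exact ⟨c3, fun x hx => (c4 hx).1, fun x hx => (c4 hx).2⟩
      · exact ⟨d3, fun x hx => (d4 hx).1, fun x hx => (d4 hx).2⟩
  · intro e i hei
    obtain ⟨C, D, hne, ⟨c1, c2, c3, c4⟩, ⟨d1, d2, d3, d4⟩, hu⟩ := diamond hX.fin e.2.1 i.2.1 hei (by rw [e.2.2, i.2.2])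
    rw [e.2.2] at c2 d2
    obtain ⟨j, ij, Cj, ju⟩ := hX.ridge_of c1 c2 c4
    obtain ⟨k, ik, Dk, ku⟩ := hX.ridge_of d1 d2 d4
    have eC := hX.ridge_eq c1 c2 ij c4 Cj
    have eD := hX.ridge_eq d1 d2 ik d4 Dk
    refine ⟨j, k, ?_, fun l => ⟨fun h => ?_, ?_⟩⟩
    · rintro rfl
      exact hne (eC.symm.trans eD)
    · rcases hu (i.1 ∩ l.1) (i.2.1.inter l.2.1) (by rw [h.2.2, e.2.2]) (Set.subset_inter hei h.1) Set.inter_subset_left with h' | h'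
      · left; exact ju l h.2.1 (h' ▸ Set.inter_subset_right)
      · right; exact ku l h.2.1 (h' ▸ Set.inter_subset_right)
    · rintro (rfl | rfl)
      · exact ⟨c3.trans Cj, ij, by rw [eC, c2]⟩
      · exact ⟨d3.trans Dk, ik, by rw [eD, d2]⟩
  · intro w w' i j k hw ij ik jk
    simp only [mem]
    intro h1 h2 h3 h1' h2' h3'
    have hF := (i.2.1.inter j.2.1).inter k.2.1
    have s := Set.subset_inter (Set.subset_inter h1 h2) h3
    have s' := Set.subset_inter (Set.subset_inter h1' h2') h3'
    have l1 := hX.two_le hw hF s s'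
    have l2 := hX.le2 ij ik jk
    exact ⟨⟨_, hF, by omega⟩, s, s', fun x hx => hx.1.1, fun x hx => hx.1.2, fun x hx => hx.2⟩
  · intro e f i j k ij ik jk a1 a2 a3 b1 b2 b3
    have hF := (i.2.1.inter j.2.1).inter k.2.1
    have l2 := hX.le2 ij ik jk
    have s := eq_of_rk e.2.1 hF (Set.subset_inter (Set.subset_inter a1 a2) a3) (by rw [e.2.2]; exact l2)
    have s' := eq_of_rk f.2.1 hF (Set.subset_inter (Set.subset_inter b1 b2) b3) (by rw [f.2.2]; exact l2)
    exact Subtype.ext (s.trans s'.symm)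
  · intro w w' i j hw ij na
    simp only [mem]
    intro h1 h2 h1' h2'
    have hF := i.2.1.inter j.2.1
    have s := Set.subset_inter h1 h2
    have s' := Set.subset_inter h1' h2'
    have l1 := hX.two_le hw hF s s'
    have l2 := hX.le3 ij
    have l3 : rk (i.1 ∩ j.1) ≠ 3 := fun h => na ⟨ij, h⟩
    exact ⟨⟨_, hF, by omega⟩, s, s', fun x hx => hx.1, fun x hx => hx.2⟩
  · intro e f i j ij na a1 a2 b1 b2
    have hF := i.2.1.inter j.2.1
    have l2 := hX.le3 ij
    have l3 : rk (i.1 ∩ j.1) ≠ 3 := fun h => na ⟨ij, h⟩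
    have s := eq_of_rk e.2.1 hF (Set.subset_inter a1 a2) (by rw [e.2.2]; omega)
    have s' := eq_of_rk f.2.1 hF (Set.subset_inter b1 b2) (by rw [f.2.2]; omega)
    exact Subtype.ext (s.trans s'.symm)
  · intro e f w w' hw a1 a2 b1 b2
    have hF := e.2.1.inter f.2.1
    have l := hX.two_le hw hF (Set.subset_inter a1 b1) (Set.subset_inter a2 b2)
    have s := eq_of_rk hF e.2.1 Set.inter_subset_left (by rw [e.2.2]; exact l)
    have s' := eq_of_rk hF f.2.1 Set.inter_subset_right (by rw [f.2.2]; exact l)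
    exact Subtype.ext (s.symm.trans s')
  · intro w w' hw
    have : pt w' ∉ w.1 := by
      intro h
      have := hX.vsub (hpt w') w.2.1 h
      exact hw (Subtype.ext (eq_of_rk w'.2.1 w.2.1 this (by rw [w.2.2, w'.2.2])).symm)
    obtain ⟨i, h1, h2⟩ := hco w.2.1 (w'.2.1.sub (hpt w')) this
    exact ⟨i, (mem w i).mpr h1, fun h => h2 ((mem w' i).mp h (hpt w'))⟩
  · intro e
    obtain ⟨x, hx, hxe⟩ := ne_of e.2.1 (by rw [e.2.2]; norm_num)
    obtain ⟨i, h, -⟩ := hco e.2.1 hx hxe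
    exact ⟨i, h⟩
  · intro w
    obtain ⟨x, hx, hxw⟩ := ne_of w.2.1 (by rw [w.2.2]; norm_num)
    obtain ⟨i, h, -⟩ := hco w.2.1 hx hxw
    have hne : w.1 ≠ i.1 := by
      intro e
      have h1 := w.2.2
      rw [e, i.2.2] at h1; omega
    obtain ⟨y, hy, hyw⟩ := Set.exists_of_ssubset (h.ssubset_of_ne hne)
    obtain ⟨j, hj, hyj⟩ := hco w.2.1 (i.2.1.sub hy) hyw
    exact ⟨i, j, fun e => hyj (e ▸ hy), (mem w i).mpr h, (mem w j).mpr hj⟩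

open scoped Classical in
theorem adj_card [Fintype (Fc X 4)] [Fintype (Fc X 3)] :
    ((Finset.univ : Finset (Fc X 4 × Fc X 4)).filter fun p => p.1 ≠ p.2 ∧ rk (p.1.1 ∩ p.2.1) = 3).card = 2 * Fintype.card (Fc X 3) := by
  let f : Fc X 4 × Fc X 4 → Option (Fc X 3) := fun p => if h : rk (p.1.1 ∩ p.2.1) = 3 then some ⟨_, p.1.2.1.inter p.2.2.1, h⟩ else none
  have := Finset.card_eq_sum_card_fiberwise (f := f) (s := (Finset.univ : Finset (Fc X 4 × Fc X 4)).filter fun p => p.1 ≠ p.2 ∧ rk (p.1.1 ∩ p.2.1) = 3)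
    (t := (Finset.univ : Finset (Fc X 3)).map ⟨some, Option.some_injective _⟩) (by
      intro p hp
      simp only [Finset.coe_filter, Finset.mem_univ, true_and, Set.mem_ofPred_eq] at hp
      simp only [Finset.coe_map, Function.Embedding.coeFn_mk, Finset.coe_univ, Set.image_univ, Set.mem_range]
      exact ⟨⟨_, p.1.2.1.inter p.2.2.1, hp.2⟩, by simp only [f]; rw [dif_pos hp.2]⟩)
  rw [this, Finset.sum_map, Finset.sum_const_nat (m := 2), Finset.card_univ, mul_comm]
  intro R _
  obtain ⟨i, j, hij, hi, hj, hu⟩ := hX.ridge R.2.1 R.2.2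
  have e1 := hX.ridge_eq R.2.1 R.2.2 hij hi hj
  have e2 := hX.ridge_eq R.2.1 R.2.2 hij.symm hj hi
  have : (((Finset.univ : Finset (Fc X 4 × Fc X 4)).filter fun p => p.1 ≠ p.2 ∧ rk (p.1.1 ∩ p.2.1) = 3).filter fun p => f p = some R) = {(i, j), (j, i)} := by
    ext ⟨p, q⟩
    simp only [Finset.mem_filter, Finset.mem_univ, true_and, Finset.mem_insert, Finset.mem_singleton, Prod.mk.injEq]
    constructor
    · rintro ⟨⟨h1, h2⟩, h3⟩
      simp only [f] at h3
      rw [dif_pos h2] at h3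
      replace h3 := Option.some_injective _ h3
      have h4 : p.1 ∩ q.1 = R.1 := congrArg Subtype.val h3
      have hp := hu p (h4 ▸ Set.inter_subset_left)
      have hq := hu q (h4 ▸ Set.inter_subset_right)
      rcases hp with rfl | rfl <;> rcases hq with rfl | rfl
      · exact absurd rfl h1
      · exact Or.inl ⟨rfl, rfl⟩
      · exact Or.inr ⟨rfl, rfl⟩
      · exact absurd rfl h1
    · rintro (⟨rfl, rfl⟩ | ⟨rfl, rfl⟩)
      · have h3 : rk (p.1 ∩ q.1) = 3 := by rw [e1, R.2.2]
        refine ⟨⟨hij, h3⟩, ?_⟩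
        simp only [f]; rw [dif_pos h3]; exact congrArg some (Subtype.ext e1)
      · have h3 : rk (p.1 ∩ q.1) = 3 := by rw [e2, R.2.2]
        refine ⟨⟨hij.symm, h3⟩, ?_⟩
        simp only [f]; rw [dif_pos h3]; exact congrArg some (Subtype.ext e2)
  rw [show (⟨some, Option.some_injective _⟩ : Fc X 3 ↪ Option (Fc X 3)) R = some R from rfl, this]
  rw [Finset.card_pair]
  intro e
  exact hij (congrArg Prod.fst e)

theorem cnt (h1 : Nat.card (Fc X 1) = 12) (h2 : Nat.card (Fc X 2) = 35) (h3 : Nat.card (Fc X 3) = 33) (h4 : Nat.card (Fc X 4) = 10)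
    [Fintype (Fc X 1)] [Fintype (Fc X 2)] [Fintype (Fc X 4)] (C : Conf E (Fc X 1) (Fc X 2) (Fc X 4)) (hC : C.adj = fun i j => i ≠ j ∧ rk (i.1 ∩ j.1) = 3) :
    C.Cnt := by
  classical
  haveI : Finite (Fc X 3) := hX.fcFinite 3
  haveI : Fintype (Fc X 3) := Fintype.ofFinite _
  rw [Nat.card_eq_fintype_card] at h1 h2 h3 h4
  refine ⟨h1, h2, ?_⟩
  have ha := hX.adj_card
  rw [h3] at ha
  have hs : C.NA = (Finset.univ.offDiag : Finset (Fc X 4 × Fc X 4)) \ (Finset.univ.filter fun p => p.1 ≠ p.2 ∧ rk (p.1.1 ∩ p.2.1) = 3) := by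
    ext ⟨p, q⟩
    simp only [Conf.NA, Finset.mem_filter, Finset.mem_univ, true_and, Finset.mem_sdiff, Finset.mem_offDiag, hC]
  rw [hs, Finset.card_sdiff_of_subset, Finset.offDiag_card, Finset.card_univ, h4]
  · convert (show 10 * 10 - 10 - 2 * 33 = 24 by norm_num) using 2
    
  · intro p hp
    simp only [Finset.mem_filter, Finset.mem_univ, true_and, Finset.mem_offDiag] at hp ⊢
    exact hp.1
end Cone
end cone
end PS

namespace PS
set_option linter.unusedSectionVars false
open Module
abbrev E4 := EuclideanSpace ℝ (Fin 4)
def hat (v : E4) : ℝ × E4 := (1, v)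
theorem hat_inj : Function.Injective hat := fun a b h => congrArg Prod.snd h

theorem hat_aff (g : Dual ℝ (ℝ × E4)) (x y : E4) {a b : ℝ} (h : a + b = 1) : g (hat (a • x + b • y)) = a * g (hat x) + b * g (hat y) := by
  have : hat (a • x + b • y) = a • hat x + b • hat y := by
    simp [hat, h]
  rw [this]; simp

/-- the face of the hull cut out by a functional -/
theorem hull_face {V : Set E4} {g : Dual ℝ (ℝ × E4)} (hg : ∀ v ∈ V, 0 ≤ g (hat v)) :
    (∀ y ∈ convexHull ℝ V, 0 ≤ g (hat y)) ∧
    {y | y ∈ convexHull ℝ V ∧ g (hat y) = 0} = convexHull ℝ {v | v ∈ V ∧ g (hat v) = 0} := by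
  have h1 : ∀ y ∈ convexHull ℝ V, 0 ≤ g (hat y) := by
    apply convexHull_min (t := {y | 0 ≤ g (hat y)}) hg
    intro x hx y hy a b ha hb hab
    rw [Set.mem_ofPred_eq] at hx hy ⊢
    rw [hat_aff g x y hab]; positivity
  refine ⟨h1, ?_⟩
  set B := {v | v ∈ V ∧ g (hat v) = 0}
  have h2 : ∀ y ∈ convexHull ℝ B, g (hat y) = 0 := by
    apply convexHull_min (t := {y | g (hat y) = 0}) (fun v hv => hv.2)
    intro x hx y hy a b ha hb hab
    rw [Set.mem_ofPred_eq] at hx hy ⊢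
    rw [hat_aff g x y hab, hx, hy]; simp
  have h3 : convexHull ℝ V ⊆ {y | 0 < g (hat y) ∨ y ∈ convexHull ℝ B} := by
    apply convexHull_min
    · intro v hv
      rcases (hg v hv).lt_or_eq with h | h
      · exact Or.inl h
      · exact Or.inr (subset_convexHull ℝ B ⟨hv, h.symm⟩)
    · intro x hx y hy a b ha hb hab
      rw [Set.mem_ofPred_eq] at hx hy ⊢
      rw [hat_aff g x y hab]
      rcases ha.eq_or_lt with rfl | ha
      · have : b = 1 := by linarith
        subst this; simpa using hy
      rcases hb.eq_or_lt with rfl | hb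
      · have : a = 1 := by linarith
        subst this; simpa using hx
      rcases hx with hx | hx
      · left
        have : 0 ≤ g (hat y) := by
          rcases hy with hy | hy
          · exact hy.le
          · exact (h2 y hy).ge
        have : 0 < a * g (hat x) := mul_pos ha hx
        positivity
      · rcases hy with hy | hy
        · left
          rw [h2 x hx]
          have : 0 < b * g (hat y) := mul_pos hb hy
          linarith
        · right; exact convex_convexHull ℝ B hx hy ha.le hb.le hab
  ext y
  constructor
  · rintro ⟨hy, h0⟩
    rcases h3 hy with h | h
    · exact absurd h0 h.ne'
    · exact h
  · intro hy
    exact ⟨convexHull_mono (fun v hv => hv.1) hy, h2 y hy⟩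

theorem rk_hat {B : Set E4} (hB : B.Nonempty) : rk (hat '' B) = finrank ℝ (vectorSpan ℝ (convexHull ℝ B)) + 1 := by
  obtain ⟨p, hp⟩ := hB
  have e1 : vectorSpan ℝ (convexHull ℝ B) = vectorSpan ℝ B := by
    rw [← direction_affineSpan, affineSpan_convexHull, direction_affineSpan]
  have e2 : Submodule.span ℝ (hat '' B) = Submodule.span ℝ {hat p} ⊔ (vectorSpan ℝ B).map (LinearMap.inr ℝ ℝ E4) := by
    rw [vectorSpan_eq_span_vsub_set_right ℝ hp]
    apply le_antisymm
    · rw [Submodule.span_le]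
      rintro _ ⟨v, hv, rfl⟩
      have : hat v = hat p + LinearMap.inr ℝ ℝ E4 (v - p) := by simp [hat]
      rw [this]
      exact add_mem (Submodule.mem_sup_left (Submodule.mem_span_singleton_self _))
        (Submodule.mem_sup_right (Submodule.mem_map_of_mem (Submodule.subset_span ⟨v, hv, rfl⟩)))
    · apply sup_le
      · exact Submodule.span_mono (by simpa using ⟨p, hp, rfl⟩)
      · rw [Submodule.map_span, Submodule.span_le]
        rintro _ ⟨_, ⟨v, hv, rfl⟩, rfl⟩
        have : LinearMap.inr ℝ ℝ E4 (v -ᵥ p) = hat v - hat p := by simp [hat]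
        show LinearMap.inr ℝ ℝ E4 (v -ᵥ p) ∈ _
        rw [this]
        exact sub_mem (Submodule.subset_span ⟨v, hv, rfl⟩) (Submodule.subset_span ⟨p, hp, rfl⟩)
  have e3 : Submodule.span ℝ {hat p} ⊓ (vectorSpan ℝ B).map (LinearMap.inr ℝ ℝ E4) = ⊥ := by
    rw [eq_bot_iff]
    rintro x ⟨h1, h2⟩
    obtain ⟨c, rfl⟩ := Submodule.mem_span_singleton.mp h1
    obtain ⟨v, -, hv⟩ := h2
    have := congrArg Prod.fst hv
    simp [hat] at this
    simp [← this]
  have := Submodule.finrank_sup_add_finrank_inf_eq (Submodule.span ℝ {hat p}) ((vectorSpan ℝ B).map (LinearMap.inr ℝ ℝ E4))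
  rw [e3, finrank_bot, finrank_span_singleton (by simp [hat]), ← e2] at this
  have e4 : finrank ℝ ((vectorSpan ℝ B).map (LinearMap.inr ℝ ℝ E4)) = finrank ℝ (vectorSpan ℝ B) :=
    (LinearEquiv.finrank_eq (Submodule.equivMapOfInjective _ LinearMap.inr_injective _)).symm
  rw [rk, e1]; omega

/-- hull of a set of lifted points -/
def hul (A : Set (ℝ × E4)) : Set E4 := convexHull ℝ (hat ⁻¹' A)

theorem hul_spec {V : Set E4} {A : Set (ℝ × E4)} (hA : IsF (hat '' V) A) (hne : A.Nonempty) :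
    (hul A).Nonempty ∧ IsExposed ℝ (convexHull ℝ V) (hul A) ∧ rk A = finrank ℝ (vectorSpan ℝ (hul A)) + 1 ∧ A = hat '' (hul A ∩ V) := by
  obtain ⟨g, hg, rfl⟩ := hA
  have hB : hat ⁻¹' {x | x ∈ hat '' V ∧ g x = 0} = {v | v ∈ V ∧ g (hat v) = 0} := by
    ext v; simp [hat_inj.eq_iff]
  have hA : {x | x ∈ hat '' V ∧ g x = 0} = hat '' {v | v ∈ V ∧ g (hat v) = 0} := by
    ext x; constructor
    · rintro ⟨⟨v, hv, rfl⟩, h⟩; exact ⟨v, ⟨hv, h⟩, rfl⟩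
    · rintro ⟨v, ⟨hv, h⟩, rfl⟩; exact ⟨⟨v, hv, rfl⟩, h⟩
  have hBne : {v | v ∈ V ∧ g (hat v) = 0}.Nonempty := by
    rw [hA] at hne; exact Set.image_nonempty.mp hne
  have hf := hull_face (V := V) (g := g) (fun v hv => hg _ ⟨v, hv, rfl⟩)
  have hh : hul {x | x ∈ hat '' V ∧ g x = 0} = {y | y ∈ convexHull ℝ V ∧ g (hat y) = 0} := by
    rw [hul, hB, hf.2]
  refine ⟨?_, ?_, ?_, ?_⟩
  · rw [hul, hB]; exact hBne.convexHull
  · intro hn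
    rw [hh] at hn ⊢
    obtain ⟨y0, hy0, hz⟩ := hn
    let l : E4 →ₗ[ℝ] ℝ := - (g ∘ₗ LinearMap.inr ℝ ℝ E4)
    have hl : ∀ y, g (hat y) = g (1, 0) - l y := by
      intro y
      have : hat y = ((1 : ℝ), (0 : E4)) + LinearMap.inr ℝ ℝ E4 y := by simp [hat]
      rw [this, map_add]; simp [l]
    refine ⟨LinearMap.toContinuousLinearMap l, ?_⟩
    ext y
    simp only [Set.mem_ofPred_eq, LinearMap.coe_toContinuousLinearMap']
    constructor
    · rintro ⟨h1, h2⟩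
      refine ⟨h1, fun z hz => ?_⟩
      have := hf.1 z hz
      rw [hl] at this h2; linarith
    · rintro ⟨h1, h2⟩
      refine ⟨h1, ?_⟩
      have a1 := h2 y0 hy0
      have a2 := hf.1 y h1
      rw [hl] at hz a2 ⊢; linarith
  · rw [hul, hB, hA, rk_hat hBne]
  · rw [hh, hA]
    congr 1
    ext v; constructor
    · rintro ⟨h1, h2⟩; exact ⟨⟨subset_convexHull ℝ V h1, h2⟩, h1⟩
    · rintro ⟨⟨h1, h2⟩, h3⟩; exact ⟨h3, h2⟩

theorem exists_lift {V F : Set E4} (hF : IsExposed ℝ (convexHull ℝ V) F) (hne : F.Nonempty) :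
    ∃ A, IsF (hat '' V) A ∧ A.Nonempty ∧ hul A = F := by
  obtain ⟨l, hl⟩ := hF hne
  obtain ⟨y0, hy0⟩ := hne
  rw [hl] at hy0
  let g : Dual ℝ (ℝ × E4) := (l y0) • LinearMap.fst ℝ ℝ E4 - (l : E4 →ₗ[ℝ] ℝ) ∘ₗ LinearMap.snd ℝ ℝ E4
  have hgl : ∀ y, g (hat y) = l y0 - l y := by intro y; simp [g, hat]
  have hg : ∀ v ∈ V, 0 ≤ g (hat v) := by
    intro v hv
    rw [hgl]
    have := hy0.2 v (subset_convexHull ℝ V hv)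
    linarith
  have hf := hull_face hg
  have hB : hat ⁻¹' {x | x ∈ hat '' V ∧ g x = 0} = {v | v ∈ V ∧ g (hat v) = 0} := by
    ext v; simp [hat_inj.eq_iff]
  have hh : hul {x | x ∈ hat '' V ∧ g x = 0} = F := by
    rw [hul, hB, ← hf.2, hl]
    ext y
    simp only [Set.mem_ofPred_eq, hgl]
    constructor
    · rintro ⟨h1, h2⟩
      refine ⟨h1, fun z hz => ?_⟩
      have := hy0.2 z hz; linarith
    · rintro ⟨h1, h2⟩
      refine ⟨h1, ?_⟩
      have := h2 y0 hy0.1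
      have := hy0.2 y h1; linarith
  refine ⟨_, ⟨g, ?_, rfl⟩, ?_, hh⟩
  · rintro _ ⟨v, hv, rfl⟩; exact hg v hv
  · have : F.Nonempty := ⟨y0, by rw [hl]; exact hy0⟩
    rw [← hh, hul, convexHull_nonempty_iff] at this
    obtain ⟨v, hv⟩ := this
    exact ⟨hat v, hv⟩

theorem fin5 : finrank ℝ (ℝ × E4) = 5 := by simp

theorem cone_of {V : Set E4} (hV : V.Finite)
    (h : ∃ F : Set E4, F ≠ ∅ ∧ F ≠ convexHull ℝ V ∧ IsExposed ℝ (convexHull ℝ V) F ∧ finrank ℝ (vectorSpan ℝ F) = 3) : Cone (hat '' V) := by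
  obtain ⟨F, h1, h2, h3, h4⟩ := h
  obtain ⟨A, hA, hne, rfl⟩ := exists_lift h3 (Set.nonempty_iff_ne_empty.mpr h1)
  obtain ⟨-, -, hr, -⟩ := hul_spec hA hne
  rw [h4] at hr
  have : A ≠ hat '' V := by
    rintro rfl
    apply h2
    rw [hul, Set.preimage_image_eq _ hat_inj]
  have := rk_lt hA (isF_univ _) hA.sub this
  have h5 : rk (hat '' V) ≤ 5 := by rw [← fin5]; exact Submodule.finrank_le _
  refine ⟨hV.image _, fin5, ?_, LinearMap.fst ℝ ℝ E4, ?_⟩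
  · apply Submodule.eq_top_of_finrank_eq
    rw [fin5]; unfold rk at *; omega
  · rintro _ ⟨v, -, rfl⟩; simp [hat]

theorem card_eq {V : Set E4} (hX : Cone (hat '' V)) (k : ℕ) (hk : k < 4) : Nat.card (Fc (hat '' V) (k + 1)) =
    {F : Set E4 | F ≠ ∅ ∧ F ≠ convexHull ℝ V ∧ IsExposed ℝ (convexHull ℝ V) F ∧ finrank ℝ (vectorSpan ℝ F) = k}.ncard := by
  have : {F : Set E4 | F ≠ ∅ ∧ F ≠ convexHull ℝ V ∧ IsExposed ℝ (convexHull ℝ V) F ∧ finrank ℝ (vectorSpan ℝ F) = k} =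
      hul '' {A | IsF (hat '' V) A ∧ rk A = k + 1} := by
    ext F
    constructor
    · rintro ⟨h1, h2, h3, h4⟩
      obtain ⟨A, hA, hne, rfl⟩ := exists_lift h3 (Set.nonempty_iff_ne_empty.mpr h1)
      exact ⟨A, ⟨hA, by rw [(hul_spec hA hne).2.2.1, h4]⟩, rfl⟩
    · rintro ⟨A, ⟨hA, hr⟩, rfl⟩
      obtain ⟨s1, s2, s3, s4⟩ := hul_spec hA (hX.nonempty (by omega))
      refine ⟨s1.ne_empty, ?_, s2, by omega⟩
      intro e
      rw [e, Set.inter_eq_self_of_subset_right (subset_convexHull ℝ V)] at s4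
      rw [s4, hX.rkX] at hr; omega
  rw [this, Set.ncard_image_of_injOn]
  · rfl
  · intro A hA A' hA' e
    have s := (hul_spec hA.1 (hX.nonempty (by rw [hA.2]; omega))).2.2.2
    have s' := (hul_spec hA'.1 (hX.nonempty (by rw [hA'.2]; omega))).2.2.2
    rw [s, s', e]
end PS

namespace PS
set_option maxRecDepth 100000 in
theorem tA1 : check 13 0x3fffd50c40803fffffaa1900807f04080b43caa1890007f02040010000000020000100086810214001001000202041090220001160408500101831a2400408101800010000000400402040010200080000000202040010000001000c18000040410008001021400100100020c2c001000c000062c58502100000004022bb448918007f02040010200080000400002040433caa189008ff020400101e8b0ce240603fd15e5a084c023fa2bcb4109808ff0000002000008100040020000081080800008000850201a1e550c48013fb43caa189006ff00081020400100040a002008ad0f224601bfc000020418202019e2550c4801bfb3c4aa189007ff0000100020008000000850c0008000042820404386000408202002800000000020008000040000210001080800108000840201da2550c48027fbb44aa1890097f000000001f0cea8624027fc000040008100040010004001040400000000010a00004000c18406000010004080020000100040010200003041c080020410204041000004080000400002040010200200f4567823010afe0000102021da550c48037f810200080f45876120301fe8ad2f0426009fd15a5e084c037f80456879123014fe0000000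04080020440102000020408002000810004019525e00c841bfc002000010200000020408102001020408002000810004019525e00c840bfc000930eac406213fd261d5880c403f8049875620310cfe930eac406207fc0ca43ab1018837f94875620310ffe000800003d95d2008c447f80000a04102000000200005000030000000050c040440206041000408102000000000006000000002040001200104090c0841a1040104000000200000000008a02040450a040841c14081083a000001004082040000004000000000002040000a000000000082182008100022010302080040438000000001000000000008002041000000081880410200106000010000040800008300471832380011000101e8acf0462001fc08004080001430103000c0000a000041238301021818104242000000709000400102000810000000000000106000030800001120008a0414001000408300000000004484040800900140810604004000000102000898a0115a1e448c007f8000000800004080000008000040c000000c00130cea8624001fe619d50c4805ff82000800004000c1896754312005ff12cea8624019fc10102040010330e8ac462001fe61d1588c4007f81010a04c3a2b1188007f01045800200000000c003000261d1588c4003fc00c08080897456231002ff12e8ac462013fc08101f0e8ac462015fc2820402619d50c48003f82000457c3a2b118801ff04041440004005896754312006fe06259d50c48043f829512cea8624023fc00100060cc33aa1890007f840261915c4c804ffc4ba2b1188007f897456231001fe040438d20044ba2b1188027f01f0e8ac46201ffc2808312cea8624011fc002000404c322b8990067f040408000060c4b3aa189005ff0004081000608103f0cea8624009fc000020008100021020200101800008102040010330e8ac462001fe61d1588c4007f80850261d1588c4003f80800c000000400002060010b020810004002000400003064850000000000228a020608004080011512cea8624001fc0000200000831e20202000050002000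 [] sA (fun _ _ => true) = true := by decide +kernel
set_option maxRecDepth 100000 in
theorem tB : check 13 0x408080001000108000020004180001000000042000204000080004c3b2a1180807ff76845230102ff03dda114c84007f8200000810004080000410102000343caa0918017f697845210305fe0010204000020008100040225d950840c37f8000040830404033c4aa091801ff698745210309fe00002000400100182820418000000000100040000200081020000304000840c040820201da255048c013fbcc322908186ff000000001f0cea8246023fc000ff7654230100ffffeca8460227fc1008204034c3aa108183ff02040410000080020008002000840604000020400302001020610085000420d0a000031b00000880004102000000200043b4aa0190807f876954032101ff02043b4aa0190807f800000c0200000010ed2a8064205fc0c3b4aa019081ff04000040204041000000100000c102182820404580900408004001010806680003450a8c0000000040020210003000000102180010800002032cf08a642003fe59e114c84003fc0000008000000009604300000008400040cb3c229908007f010450004040020000000000000000003040c0a59e114c84003f80020418000020010c000040c0408601080000103e1d914c84003f8002000010202000020004c33aa0918007f04040010006044b3a2891802ff896754123005fe0a61d914c84003f80020400000000400008080040404c3b229908007f000008002020000930ce8a246001fc38100283410130ce8a246001fc00209003800212259d1448c01bfc4b3aa0918037f000a61d914c84003ffc3b229908017ff87645321005ff2a00100040cc33aa0918007f0402619d5048c007f80010400002084000000005001620188000408002000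 [] sB (fun _ _ => true) = true := by decide +kernel
set_option maxRecDepth 100000 in
theorem tP : check 13 0x200001810200081020808004180800204081040400102083820004082000000102081000004080041808000ed30a8024637fc00100040800004081080d9e2550048c03f80040c000020400704000010200001082000000001010e08080060400106040800010081020800002080810004000000400800180000e0400000000020200001000225d914c840e7f80030ed28a64200dfc00104200890024000121c08000000000000000000008108000010404081000c001040008002080810a0800104141020020000101008102000800200080020000102000800204000020418104040800404081000000b000400b00041860418002021008000041880e0810800080800000580022400102140070000004020000104080810000081040030c032ed08a642007fc00c000000100306020204000000010112040800000080000808200000010400088020000002000010204101002400002041010204005000c70d04080000204001020028206040000000133cc2a009191ff0000000002400000080800000005060000000040800004083120c0010000280080000100001000200000020400d0004081020000100000000800081000408002040000000000020000180140031c0030200000810008080000000100040010208033c4aa0091967f00040000000180000c00002001010200080000028200080820408002023c008000c000020c0800208000000048000004810024180000400000001000200082041000300000800000043b4a29908157f0400083040000004000000000002000000002000800000000000038100000000e000000c0800002041040004180041018004002000208001020c10100040080208081020c08202040020204000041088208000831410007080008200000880400081020c0800208033c4aa009180ff0204100020008102000000000080040008204001000204001020400006000800112ec8a64206ffc0018769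45321004fe000810014100876945321027fe0000002041040c00000000000302000000008001080400102044800800001020000000000000004000020000000040010200003000010000040cbc32280918e7f0000200060808100000cb3c2a0091807f00000800200043b4a29908147f02001808404001060800002041010200100020c0800200183000c001000225d914c840d7f80030ed28a642005fc00100042800a00000120010006040000000002000c08000000810200002000400100000810004001020000104040830406001020800200000010004043b4a29908137f00140020000001000408100d2f08a642065fc1060c0000006202890010001001c081020008d00000870200080020800002040880414001080028002000820004001022818210000010704000022408600040000000080000400a020030600346800c000851a180000634000000c0010a14000000c00104000800200005140c14c04000440200009013008000081001a1058002001070200102100030010104000004200000430400059e2514c840cff80967845321000fe0818c022e14b3c229908007f0218004001018c1218582123018a104838900083011230000160010a0600081040008100000800204085020c001020000318048800000102001c38d0e2c08702001000004080140400802203c4967845321000ff2cf08a642003fc103022c180022e0000e0c0000200088040000102000011c0430002000010c0000004043010c08000000400b0200401000000902041040d2659e114c84003f870e0408016382801a38181160c0011600102062800300040010f0259e114c84013f8200000000028004112cf08a642001fc20c840844b3c22990803ff052cf08a642009fc04b3c229908007f0830041042259e114c84007f81967845321000fe040000000049012c008967845321005fe0264c0004002967845321001fe0404b3c229908007f0200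0000802143001a0400010080012cf08a642013fc102000008100080820408000967845321000fe000450000000020400200000020200080000000102000820400000000000000040010200081001659e114c84003f84121860006321820b2cf08a64201bfc14b3c22990800ff0000000032cf08a642001fc1050100083000000000000800004081000000100040030202000000408100040800b2cf08a642015fc04b3c229908037f012cf08a642001fc20901060820b2cf08a642005fc0cb3c229908007f020010400001410004382000600a000000314280000108005967845321007fe024c90004001012cf08a642003fc080020404b3c229908007f02001840008100060400104060000002100060218007060400004033c4a299080c7f01ecf08a64200bfc681000000c0c040010400301060008000059e2514c84003f810c040840804602060808118000000214281021c084000400a860000067894532100afe03d9e114c84073f80ff6745321016fe01a5e114c8403bf82020800000000000100080020408000000070404002000408202040020204000000008000000070c00005020800100200000004000001808104040800404080000000100041040604280020800100000010800001000c4810800001000c500002400000000010000001000400000001800c0408400041020a0e2810000000000000b040008100000800000000010000002001010204000000420002041800c00001000000100180000000001001c0011200280000010000002810000080000400000003800a040810a040070000080000808000040800a14081000000002000000204200000008200000000000048060000000040010000181000408000000010000180000018167894532100ffe001060010201021000102001030014000120418600000800000101060010012082820414080020038300000000a0408104040010400281060000000003000200480080410500000060220005020010300140010000081000c3000c0010100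0000100143000000000000010002000010e0c0000000102000018002040010008185000008000040801a0400d0a001008e0c003000c040678945321012fe0259e114c84007f80012cf08a642001fc001967845321002fe00000020008088040050414180880000a0200001001c00204000810004000022c3001004400000410000000021400000000400802041080620001021000011100000200001032cf08a642001fc00100000020000200030400200001000008001000020100040840204302040000310000810d099e2514c84007f81678945321000fe040010204080020408002040c3080c181020420202063000003d9e114c84043f80ff674532100efe00002000010102000810004000021c383020000606240811a000010e100008004008000028000043000600001000400000040800004000000008002040050408300000008002040010202000020c180080008000040000000000000c001000c001020008006000000000000020400102000020200002000800200040820200000000400002040000008002040410010240000000081020008300080800208001000008000000000000100020030000101c60406301001a3010000580080000002000000000000002848100042050a0008006000000004000020000002001010004000020008000000800800000000400002041800200081040400000000000004083040400102080800200004001c3830200083060020000041020000001000830204000000204080041808100040000200080000008400080030000002040800604040810e18000000418100000010200080080c00080100010200084000408000100000004300000438006000010000000020400100000820204000080800100000810000000020028206000040200080000008504000010204001020200000040800200080f67845321001fe04000020000000040010200080020259e114c84003f800202001060000306040810004000000000102000000604042000008102000810000000000000000000000004106041020904001820e04080000c201021408300045010600106060008000001000a0c00102180800008501020408702040810a0408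2020008008082020800080040050102001030000104000000100000010800080040c0000214082020800100040800004084020008302042030604000020000000002040824003000410002000810404001021c2041200081040008000000010004000062c08114007020a08002000000000040000000203020408502000021404081021c08102042000208000000008b08000840044106001000102042820008081022000008000810234100020408016000010804101040008002040000204201000410000040810004100020000106100810200001000010006040800008080000028202040000c1850306242851400102000018002000810200089020028002000810404001000000100000000000080020c0000000080022400100100010a0400100001000204001020408100040000204080020400100040010000280020008100040000400081000000000000810000100040010002000010008100001800600000860004004060400002000010204002000018006000000500002000010100041800200083020008402002040002000020c080020c08006001808000080020259e114c84007f810004080967845321000fe0400000000000208080011408002040810e00000001c04300000010200100040010000000000000480000410104044800600080000408000001000400009000000304000000e000800024081000000000000000e0000010000020000080020400f060400002000810810000021c000041800102000000200080000408002000800004081000850004040031600001041408600000030000100000000c001068b1c000010410281000438002000000a1c20b1400508082018a1200102020018b0c000050c142810214505000000a0a000811000000062c28000102850000280020008908000000a080000200001020000a0200000002c000060018000000000000001020000000000000200081020008000040800e02002000408000040020200081020008006000800204001060048002080830008080001400100081060020006081800102140010218181000408304040010208180010000100040010404108020000002040010200002000800300003010004004081408000180800c001808000001000008100000060608000000008000081020004000000000000040010130ec8a642001fc0000004300860014c3b229908007ff87645321001ff00080040c10006040020208001020800104000000000080000c0c00204000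 [] sP (fun _ _ => true) = true := by decide +kernel
set_option maxRecDepth 100000 in
theorem tO : check 13 0xff7632105400fffeeca8206401fda5e114c84043f8200006000004001020000067892310543dfe0625d8c9504027fc4bb192a08007f00000010000087796832014557fe004b43c91aa0808ff0014033c491882a1fff0312ec64a8200ffc001062000002040c6000000100059e248d144027f810200001897632541005fe0000002000020004001020400014000cb3c228811917f0004000967845231026fe0a59e1148c40a7f8096784523102afe0c001012cf08a462059fc043b480aa11a1ff032cf08a462065fe59e1148c40d7f80000407c3b00992a1b7f0a00080002c1000530ec64a82003fc04c3b192a08007f000600101080890a006801330ec64a82001fe61d8c9504007f8080080000204080000c00a011c6800130ec64a82001fe000f87601543216fe16619c8d50411ff8067984523105bfe0004100d2f08a4620ddfc033cc2291883a7f0000133c4a288191aff000400100000800400000678923105439fe0625d8c9504007f800024000786954012356fe1804100000010000043b491aa0090ff020261d80550c897f81967810453204fe0261d80550c89bf8168792354100afe0028067892310543afe0661d80550c8a7fc7876954013203fe0800000000000114000000400167890145230cfe003851f30ec64a82001fc083020800067890145230cff1e1da405508ce3f810006143b480aa192f7f0130ec02a8642bfc3cc3b00aa190cff1a0a0860208001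000261d80550c86bf8b04d30ea8204601fe259d14c805c3f80810ed2a8026401fe61d950c841bff808001da608d500577f80678901542363fe000010130ec02a86435fc00402000020208000987601453262fe0408e78960145235cfe019e2405148c57f83698754231060fe0259e08d504187f8080cf12468a20b5fc07b3c11a28807ff04cf128a642073fc0433c91aa0832ff000219e48d50419bf8002d12ea8462089fc0343c91a288327f01ed0e468a2087fc0020000100020008100000810008100000800100cf12468a2053fc14c3391aa0828ff0330ce46a820a5fc080679823451050fe0007b3c2299082fff01fece8a642075fe002022468902001021a000810200081020000804041001a0400c120800702044090020784020000b02081801600001021261d88d50419ff88987654103200fe0c0841204105040c080081400706000440400000987601543266fe040010004103987601543267fe0407e0000000000408000061020200081010d2e468a2071fe000987654103200fe1000100000c002040010130eca8206401fc0c1020261d95040c803f818004000020008300040800200080020008100d12e648a206dfda25cc91440e7f80000a25d95040c85bfc4bb2a0819027f0512eca8206415fe25d95040c803f81020800080019e240514c89ff8189765410321eff12eca8206409fc0000330eca820641dfc18000001c2987654103200fe0800080f12c64a820c1fc04200000800000033c4aa1180857f003018002000018a0261d95040c80ff81897654103206fe0404600000800207e1d95040c86ff80000404c3b2a0819007f0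0000420004001000000406040008a0418202040000312eca8206439fc00002000434b9180a29dff02061a5c8c0514dff8a869723014538fe061a5c8c0514fbf8014003810130eca8206427fc00080099e248d14408bfb3c491a2880fff02040000100033c480a299107f0312eca8206423fc000820000100040010200000000000002000420800204000004c3b082a19087f000261d84150c82ffb3c49180aa11ff8010000003404b43aa0099167f030408100000008032105000203c4b2a00990cff800800000000000002002000000e0000001800261d8c950400ffb3c48091aa0dff000000c8600080000207e01000408114033c480a299097f678901453214ff1408081140458002280000400102040fb3c1180a280ff000008000000000003f00020010100000800200001020008002000400002181840408304040010308002000400100d30e20468a3ffc00004d30e20468a3bfc081021004800000010004082f87654103200fffeeca820641ffc100000800100040800004080040470200040000204000030e28000d12ea8460237fc000869745230119fe0218002041000008001000408000040c08b0808000060020130ec46a82069fe080011404182040000006100020408100cf30028a640bfe04c3b11aa0818ff0330ec46a82065fc080679823451008ff00001000403c4b192a08037f020008100f12c64a82007fc080769832451003feed30648a200dfc00080040c0040014004080800008080000000000000490001e618c950408ff8000040c000001400404080012c00016000818e0003cc3192a080f7f00043000c00706020428e042850380000c010f12c64a8200ffc4860102084120a1040c08002030820901061040c00040060008102f12c64a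82005fc0090c000018202303100400310080c6001048800000008003de18c9504077fc0000400002040821c0400e86387438000000000814c3b11a288007f05041001930ec468a2001fc0c01930ec468a2001fe61d88d144007fcc3b11a288017ff87623451003ff00000000400100000010000000011a000040000102080008a0404004081000730eca8206407fe61d95040c803f82800c001040c0010008000001818002003000200080000018102000cb0006002010c001050814c3b2a0819007ff87654103201ff00080020070104200001a020810004080000c086000204006000828c040040800005001010208140c002002068702000000008180040800104141020000102001020400002000810004025e1914c8400bf80000408304040010200002000400100182820418000000000100040000200081020000304000840d0408202001020c04006861834300000000008000000000000000000810202978645321000fe0008106000008004200001020102100400000000 [⟨Conf.gL, [], [], 1024, 0⟩] sO (fun _ _ => true) = true := by decide +kernel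

theorem Conf.final {E W Ed I : Type} [AddCommGroup E] [Module ℝ E] [FiniteDimensional ℝ E] [Fintype W] [Fintype Ed] [Fintype I]
    (C : Conf E W Ed I) (hd : finrank ℝ E = 5) (h : C.Cnt) (hI : Fintype.card I = 10) : False := by
  classical
  have h12 : C.Bl.card = 12 := by rw [C.card_Bl, h.cW]
  rcases C.sat_some h12 (C.cases hd h) with h | h | h | ⟨h1, h2, h⟩
  · exact (check_sound hI h12 13 _ [] _ _ tA1 (by simp)).1 h
  · exact (check_sound hI h12 13 _ [] _ _ tB (by simp)).1 h
  · exact (check_sound hI h12 13 _ [] _ _ tP (by simp)).1 h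
  · refine (check_sound hI h12 13 _ _ _ _ tO ?_).1 h
    intro r hr
    rw [List.mem_singleton] at hr
    subst hr
    exact Conf.geo hd h12 h1 h2
end PS

/-- `(12,35,33,10)` is not the f-vector of any convex 4-polytope. -/
theorem no_polytope_12_35_33_10 :
    ¬ ∃ V : Set (EuclideanSpace ℝ (Fin 4)), V.Finite ∧
      fVec V 0 = 12 ∧ fVec V 1 = 35 ∧ fVec V 2 = 33 ∧ fVec V 3 = 10 := by
  rintro ⟨V, hV, h0, h1, h2, h3⟩
  unfold fVec at h0 h1 h2 h3
  have hX : PS.Cone (PS.hat '' V) := by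
    apply PS.cone_of hV
    have := Set.nonempty_of_ncard_ne_zero (by rw [h3]; norm_num)
    exact this
  rw [← PS.card_eq hX 0 (by norm_num)] at h0
  rw [← PS.card_eq hX 1 (by norm_num)] at h1
  rw [← PS.card_eq hX 2 (by norm_num)] at h2
  rw [← PS.card_eq hX 3 (by norm_num)] at h3
  obtain ⟨C, hC⟩ := hX.conf
  have := hX.fcFinite 1
  have := hX.fcFinite 2
  have := hX.fcFinite 4
  letI : Fintype (PS.Fc (PS.hat '' V) 1) := Fintype.ofFinite _
  letI : Fintype (PS.Fc (PS.hat '' V) 2) := Fintype.ofFinite _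
  letI : Fintype (PS.Fc (PS.hat '' V) 4) := Fintype.ofFinite _
  exact C.final hX.dim (hX.cnt h0 h1 h2 h3 C hC) (by rw [← Nat.card_eq_fintype_card]; exact h3)
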